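/- There exists an absolute constant C > 0 such that for every finite set S ⊂ ℝ² with at least two points and every ε ∈ (0, 1], there exists a geometric graph E (a finite set of closed line segments in the plane) with total weight ‖E‖ ≤ C · ε^{−1} · mst(S), such that for all s, t ∈ S there is an st-path in E of weight at most (1+ε)·‖s − t‖. In other words, S admits a Euclidean Steiner (1+ε)-spanner of lightness O(ε^{−1}). -/

import Mathlib

open scoped Classical

noncomputable section

/-- The Euclidean plane. -/
abbrev Plane : Type := EuclideanSpace ℝ (Fin 2)

/-- The point `(x, y) ∈ ℝ²`. -/
def pt (x y : ℝ) : Plane := (EuclideanSpace.equiv (Fin 2) ℝ).symm ![x, y]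

/-- The union of the segments of a geometric graph. -/
def segUnion (E : Finset (Plane × Plane)) : Set Plane :=
  ⋃ e ∈ E, segment ℝ e.1 e.2

/-- The total weight of a geometric graph: the sum of the Euclidean lengths of its
segments. -/
def gweight (E : Finset (Plane × Plane)) : ℝ :=
  ∑ e ∈ E, ‖e.1 - e.2‖

/-- `HasPath E s t w` : there is a polygonal path from `s` to `t`, each of whose edges is
contained in the union of the segments of `E`, of weight at most `w`. -/
def HasPath (E : Finset (Plane × Plane)) (s t : Plane) (w : ℝ) : Prop :=
  ∃ (m : ℕ) (v : ℕ → Plane), v 0 = s ∧ v m = t ∧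
    (∀ i < m, segment ℝ (v i) (v (i + 1)) ⊆ segUnion E) ∧
    ∑ i ∈ Finset.range m, ‖v (i + 1) - v i‖ ≤ w

/-- `IsSpanningTree S T` : the edge set `T` (pairs of distinct points of `S`) forms a
tree with vertex set `S`: it is connected on `S` and has `|S| − 1` edges. -/
def IsSpanningTree (S : Finset Plane) (T : Finset (Plane × Plane)) : Prop :=
  (∀ e ∈ T, e.1 ∈ S ∧ e.2 ∈ S ∧ e.1 ≠ e.2) ∧
  (∀ a ∈ S, ∀ b ∈ S, ∃ (m : ℕ) (v : ℕ → Plane), v 0 = a ∧ v m = b ∧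
    ∀ i < m, (v i, v (i + 1)) ∈ T ∨ (v (i + 1), v i) ∈ T) ∧
  T.card + 1 = S.card

/-- The weight of a minimum spanning tree of `S`: the minimum of the total weight over
all trees with vertex set `S`. -/
def mst (S : Finset Plane) : ℝ :=
  sInf {w | ∃ T : Finset (Plane × Plane), IsSpanningTree S T ∧ w = gweight T}

lemma exists_nat_path_iff {α : Type*} {R : α → α → Prop} {a b : α} :
    (∃ (m : ℕ) (v : ℕ → α), v 0 = a ∧ v m = b ∧ ∀ i < m, R (v i) (v (i + 1))) ↔
      Relation.ReflTransGen R a b := by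
  constructor
  · rintro ⟨m, v, rfl, rfl, h⟩
    induction m with
    | zero => exact Relation.ReflTransGen.refl
    | succ m ih => exact (ih fun i hi => h i (by omega)).tail (h m (by omega))
  · intro h
    induction h using Relation.ReflTransGen.head_induction_on with
    | refl => exact ⟨0, fun _ => b, rfl, rfl, by simp⟩
    | @head a c hac _ ih =>
      obtain ⟨m, v, h0, hm, hv⟩ := ih
      refine ⟨m + 1, fun i => i.casesOn a v, rfl, hm, ?_⟩
      rintro (_ | i) hi
      · simpa [h0] using hac
      · exact hv i (by omega)

lemma segUnion_mono {E F : Finset (Plane × Plane)} (h : E ⊆ F) : segUnion E ⊆ segUnion F :=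
  Set.biUnion_subset_biUnion_left h

lemma segment_subset_segUnion {E : Finset (Plane × Plane)} {a b : Plane} (h : (a, b) ∈ E) :
    segment ℝ a b ⊆ segUnion E :=
  fun _ hx => Set.mem_biUnion (Finset.mem_coe.2 h) hx

namespace HasPath

variable {E F : Finset (Plane × Plane)} {a b c : Plane} {w w' : ℝ}

lemma mono (h : HasPath E a b w) (hE : E ⊆ F) (hw : w ≤ w') : HasPath F a b w' := by
  obtain ⟨m, v, h0, h1, h2, h3⟩ := h
  exact ⟨m, v, h0, h1, fun i hi => (h2 i hi).trans (segUnion_mono hE), h3.trans hw⟩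

lemma nonneg (h : HasPath E a b w) : 0 ≤ w := by
  obtain ⟨m, v, h0, h1, h2, h3⟩ := h
  exact (Finset.sum_nonneg fun _ _ => norm_nonneg _).trans h3

lemma refl (hw : 0 ≤ w) : HasPath E a a w :=
  ⟨0, fun _ => a, rfl, rfl, by simp, by simpa using hw⟩

lemma cons (hab : segment ℝ a b ⊆ segUnion E) (h : HasPath E b c w) :
    HasPath E a c (‖a - b‖ + w) := by
  obtain ⟨m, v, h0, h1, h2, h3⟩ := h
  refine ⟨m + 1, fun i => i.casesOn a v, rfl, h1, ?_, ?_⟩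
  · rintro (_ | i) hi
    · simpa [h0] using hab
    · exact h2 i (by omega)
  · rw [Finset.sum_range_succ']
    have : ‖v 0 - a‖ = ‖a - b‖ := by rw [h0, norm_sub_rev]
    exact (add_le_add h3 this.le).trans (by linarith)

lemma trans (h : HasPath E a b w) (h' : HasPath E b c w') : HasPath E a c (w + w') := by
  obtain ⟨m, v, h0, h1, h2, h3⟩ := h
  induction m generalizing a v w with
  | zero =>
    have : a = b := by rw [← h0, h1]
    subst this
    simp only [Finset.range_zero, Finset.sum_empty] at h3
    exact h'.mono subset_rfl (by linarith)
  | succ m ih =>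
    rw [Finset.sum_range_succ'] at h3
    have := ih (a := v 1) (w := w - ‖v 1 - v 0‖) (fun i => v (i + 1)) rfl h1
      (fun i hi => h2 (i + 1) (by omega)) (by simpa using by linarith)
    have h4 := cons (a := v 0) (h2 0 (by omega)) this
    subst h0
    refine h4.mono subset_rfl ?_
    simp only [zero_add]
    rw [norm_sub_rev]
    linarith

lemma of_segment (h : segment ℝ a b ⊆ segUnion E) : HasPath E a b ‖a - b‖ := by
  simpa using cons h (refl (le_refl (0 : ℝ)))

lemma of_mem (h : (a, b) ∈ E) : HasPath E a b ‖a - b‖ :=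
  of_segment (segment_subset_segUnion h)

lemma symm (h : HasPath E a b w) : HasPath E b a w := by
  obtain ⟨m, v, h0, h1, h2, h3⟩ := h
  refine ⟨m, fun i => v (m - i), by simpa using h1, by simpa using h0, ?_, ?_⟩
  · intro i hi
    have := h2 (m - (i + 1)) (by omega)
    rw [segment_symm]
    convert this using 3
    omega
  · refine le_trans (le_of_eq ?_) h3
    rw [← Finset.sum_range_reflect]
    refine Finset.sum_congr rfl fun i hi => ?_
    rw [Finset.mem_range] at hi
    rw [norm_sub_rev]
    have e1 : m - (m - 1 - i + 1) = i := by omega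
    have e2 : m - (m - 1 - i) = i + 1 := by omega
    simp only [e1, e2]

end HasPath

lemma gweight_nonneg (E : Finset (Plane × Plane)) : 0 ≤ gweight E :=
  Finset.sum_nonneg fun _ _ => norm_nonneg _

lemma gweight_mono {E F : Finset (Plane × Plane)} (h : E ⊆ F) : gweight E ≤ gweight F :=
  Finset.sum_le_sum_of_subset_of_nonneg h fun _ _ _ => norm_nonneg _

lemma gweight_union_le (E F : Finset (Plane × Plane)) :
    gweight (E ∪ F) ≤ gweight E + gweight F := by
  have h := Finset.sum_union_inter (s₁ := E) (s₂ := F) (f := fun e : Plane × Plane => ‖e.1 - e.2‖)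
  have := gweight_nonneg (E ∩ F)
  unfold gweight at *
  linarith

lemma gweight_biUnion_le {ι : Type*} (s : Finset ι) (f : ι → Finset (Plane × Plane)) :
    gweight (s.biUnion f) ≤ ∑ i ∈ s, gweight (f i) := by
  induction s using Finset.induction_on with
  | empty => simp [gweight]
  | insert a s ha ih =>
    rw [Finset.biUnion_insert, Finset.sum_insert ha]
    exact (gweight_union_le _ _).trans (by linarith)

lemma gweight_insert_le (e : Plane × Plane) (E : Finset (Plane × Plane)) :
    gweight (insert e E) ≤ ‖e.1 - e.2‖ + gweight E := by
  have := gweight_union_le {e} E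
  rwa [← Finset.insert_eq, gweight, gweight, Finset.sum_singleton] at this

lemma gweight_image_le {ι : Type*} (s : Finset ι) (f : ι → Plane × Plane) :
    gweight (s.image f) ≤ ∑ i ∈ s, ‖(f i).1 - (f i).2‖ := by
  unfold gweight
  exact Finset.sum_image_le_of_nonneg (g := f) (f := fun e : Plane × Plane => ‖e.1 - e.2‖)
    fun _ _ => norm_nonneg _

/-- If every pair of distinct points of `S` has a short detour through a pair of points of `S` at
comparable distance that is joined cheaply, then all pairs of points of `S` are joined cheaply. -/
lemma hasPath_of_good_pairs {S : Finset Plane} {E : Finset (Plane × Plane)} {ε K K' C' c : ℝ}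
    (hε : 0 ≤ ε) (hK : K * ε ≤ 1) (hc : 0 < c) (hC' : C' * ε < c) (hKC : 2 * C' ≤ (K - K') * c)
    (hC0 : 0 ≤ C') (hKK : K' ≤ K)
    (h : ∀ s ∈ S, ∀ t ∈ S, s ≠ t → ∃ z ∈ S, ∃ z' ∈ S,
      HasPath E z z' ((1 + K' * ε) * ‖z - z'‖) ∧ c * ‖s - t‖ ≤ ‖z - z'‖ ∧
      ‖s - z‖ + ‖z - z'‖ + ‖z' - t‖ ≤ (1 + C' * ε) * ‖s - t‖) :
    ∀ s ∈ S, ∀ t ∈ S, HasPath E s t ((1 + K * ε) * ‖s - t‖) := by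
  have key : ∀ (n : ℕ) (s t : Plane), s ∈ S → t ∈ S →
      (((S ×ˢ S).filter fun p => ‖p.1 - p.2‖ < ‖s - t‖).card ≤ n) →
      HasPath E s t ((1 + K * ε) * ‖s - t‖) := by
    intro n
    induction n using Nat.strong_induction_on with
    | _ n ih =>
      intro s t hs ht hn
      by_cases hst : s = t
      · subst hst; exact HasPath.refl (by simp)
      obtain ⟨z, hz, z', hz', hp, hlen, hdet⟩ := h s hs t ht hst
      have hpos : 0 < ‖s - t‖ := norm_pos_iff.2 (sub_ne_zero.2 hst)
      have sub : ∀ a ∈ S, ∀ b ∈ S, ‖a - b‖ < ‖s - t‖ →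
          HasPath E a b ((1 + K * ε) * ‖a - b‖) := by
        intro a ha b hb hab
        refine ih _ (lt_of_lt_of_le (Finset.card_lt_card ?_) hn) a b ha hb le_rfl
        refine ⟨fun p hp => ?_, fun hsub => ?_⟩
        · rw [Finset.mem_filter] at hp ⊢
          exact ⟨hp.1, hp.2.trans hab⟩
        · have : (a, b) ∈ (S ×ˢ S).filter fun p => ‖p.1 - p.2‖ < ‖s - t‖ := by
            simp [ha, hb, hab]
          simpa using hsub this
      have hb : c * ‖s - t‖ > C' * ε * ‖s - t‖ := by
        have := mul_lt_mul_of_pos_right hC' hpos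
        linarith
      have h1 := sub s hs z hz (by have := norm_nonneg (z' - t); nlinarith)
      have h2 := sub z' hz' t ht (by have := norm_nonneg (s - z); nlinarith)
      refine ((h1.trans hp).trans h2).mono subset_rfl ?_
      have e1 : (1 + K * ε) * ‖s - z‖ + (1 + K' * ε) * ‖z - z'‖ + (1 + K * ε) * ‖z' - t‖ =
        (1 + K * ε) * (‖s - z‖ + ‖z - z'‖ + ‖z' - t‖) - (K - K') * ε * ‖z - z'‖ := by ring
      rw [e1]
      have h3 : (K - K') * ε * ‖z - z'‖ ≥ 2 * C' * ε * ‖s - t‖ := by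
        have i1 : (K - K') * ε * ‖z - z'‖ ≥ (K - K') * ε * (c * ‖s - t‖) :=
          mul_le_mul_of_nonneg_left hlen (mul_nonneg (by linarith) hε)
        have i2 : (K - K') * c * (ε * ‖s - t‖) ≥ 2 * C' * (ε * ‖s - t‖) :=
          mul_le_mul_of_nonneg_right hKC (by positivity)
        nlinarith
      by_cases hKe : 0 ≤ 1 + K * ε
      · have h4 : (1 + K * ε) * (‖s - z‖ + ‖z - z'‖ + ‖z' - t‖) ≤
          (1 + K * ε) * ((1 + C' * ε) * ‖s - t‖) := mul_le_mul_of_nonneg_left hdet hKe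
        have h5 : (1 - K * ε) * (C' * ε * ‖s - t‖) ≥ 0 := by
          apply mul_nonneg (by linarith); positivity
        nlinarith
      · exfalso
        have q1 := h1.nonneg
        have q2 := hp.nonneg
        have : 0 < ‖z - z'‖ := lt_of_lt_of_le (by positivity) hlen
        have : 0 ≤ 1 + K' * ε := by
          by_contra hh
          push Not at hh
          nlinarith
        nlinarith [mul_le_mul_of_nonneg_right hKK hε]
  intro s hs t ht
  exact key _ s t hs ht le_rfl

/-- Adjacency in the undirected graph underlying an edge set. -/
def EAdj (E : Finset (Plane × Plane)) (a b : Plane) : Prop := (a, b) ∈ E ∨ (b, a) ∈ E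

lemma EAdj.symm {E : Finset (Plane × Plane)} {a b : Plane} (h : EAdj E a b) : EAdj E b a := Or.symm h

lemma EAdj.mono {E F : Finset (Plane × Plane)} (hEF : E ⊆ F) {a b : Plane} (h : EAdj E a b) :
    EAdj F a b := h.imp (fun h => hEF h) (fun h => hEF h)

lemma reflTransGen_eAdj_symm {E : Finset (Plane × Plane)} {a b : Plane}
    (h : Relation.ReflTransGen (EAdj E) a b) : Relation.ReflTransGen (EAdj E) b a := by
  induction h with
  | refl => exact Relation.ReflTransGen.refl
  | tail _ hcd ih => exact ih.head hcd.symm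

/-- The edges of `E` join distinct points of `S` and connect all of `S`. -/
def ConnectsOn (S : Finset Plane) (E : Finset (Plane × Plane)) : Prop :=
  (∀ e ∈ E, e.1 ∈ S ∧ e.2 ∈ S) ∧
    ∀ a ∈ S, ∀ b ∈ S, Relation.ReflTransGen (EAdj E) a b

lemma IsSpanningTree.connectsOn {S : Finset Plane} {T : Finset (Plane × Plane)}
    (h : IsSpanningTree S T) : ConnectsOn S T :=
  ⟨fun e he => ⟨(h.1 e he).1, (h.1 e he).2.1⟩,
    fun a ha b hb => exists_nat_path_iff.1 (h.2.1 a ha b hb)⟩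

/-- The length of the polygonal walk through the points of a list. -/
def tourLen : List Plane → ℝ
  | [] => 0
  | [_] => 0
  | a :: b :: l => ‖a - b‖ + tourLen (b :: l)

lemma tourLen_append (l₁ l₂ : List Plane) (u : Plane) :
    tourLen (l₁ ++ u :: l₂) = tourLen (l₁ ++ [u]) + tourLen (u :: l₂) := by
  induction l₁ with
  | nil => simp [tourLen]
  | cons a l₁ ih =>
    cases l₁ with
    | nil => simp [tourLen]
    | cons b l₁ =>
      simp only [List.cons_append, tourLen] at ih ⊢
      rw [ih]; ring

lemma exists_adj_leaving {α : Type*} {R : α → α → Prop} {U : Set α} {a b : α}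
    (h : Relation.ReflTransGen R a b) (ha : a ∈ U) (hb : b ∉ U) :
    ∃ u ∈ U, ∃ v ∉ U, R u v := by
  induction h with
  | refl => exact absurd ha hb
  | @tail c d _ hcd ih =>
    by_cases hc : c ∈ U
    · exact ⟨c, hc, d, hb, hcd⟩
    · exact ih hc

lemma ConnectsOn.exists_partial_tree {S : Finset Plane} {E : Finset (Plane × Plane)}
    (h : ConnectsOn S E) (hS : S.Nonempty) (n : ℕ) (hn : n + 1 ≤ S.card) :
    ∃ U ⊆ S, ∃ F ⊆ E, U.card = n + 1 ∧ F.card = n ∧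
      (∀ e ∈ F, e.1 ∈ U ∧ e.2 ∈ U ∧ e.1 ≠ e.2) ∧
      (∀ a ∈ U, ∀ b ∈ U, Relation.ReflTransGen (EAdj F) a b) ∧
      ∃ l : List Plane, (∀ x, x ∈ l ↔ x ∈ U) ∧ l.IsChain (EAdj F) ∧ tourLen l ≤ 2 * gweight F := by
  induction n with
  | zero =>
    obtain ⟨a, ha⟩ := hS
    refine ⟨{a}, by simpa using ha, ∅, by simp, by simp, by simp, by simp, ?_, [a], by simp,
      by simp, by simp [tourLen, gweight]⟩
    intro b hb c hc
    rw [Finset.mem_singleton] at hb hc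
    rw [hb, hc]
  | succ n ih =>
    obtain ⟨U, hUS, F, hFE, hU, hF, hend, hconn, l, hl, hchain, hlen⟩ := ih (by omega)
    obtain ⟨x, hx⟩ : U.Nonempty := Finset.card_pos.1 (by omega)
    obtain ⟨y, hy, hyU⟩ : ∃ y ∈ S, y ∉ U := Finset.exists_mem_notMem_of_card_lt_card (by omega)
    obtain ⟨u, hu, v, hv, huv⟩ := exists_adj_leaving (U := (U : Set Plane))
      (h.2 x (hUS hx) y hy) (by simpa using hx) (by simpa using hyU)
    rw [Finset.mem_coe] at hu hv
    have hne : u ≠ v := fun h => hv (h ▸ hu)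
    obtain ⟨e, heE, he, heF, hadj⟩ : ∃ e ∈ E, (e = (u, v) ∨ e = (v, u)) ∧ e ∉ F ∧
        (EAdj (insert e F) u v) := by
      rcases huv with huv | huv
      · exact ⟨_, huv, Or.inl rfl, fun hh => hv (hend _ hh).2.1, Or.inl (by simp)⟩
      · exact ⟨_, huv, Or.inr rfl, fun hh => hv (hend _ hh).1, Or.inr (by simp)⟩
    have hvS : v ∈ S := by
      rcases he with rfl | rfl
      · exact (h.1 _ heE).2
      · exact (h.1 _ heE).1
    have hsub : F ⊆ insert e F := Finset.subset_insert _ _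
    have hmono : ∀ a b, EAdj F a b → EAdj (insert e F) a b := fun a b hab => hab.mono hsub
    have hto : ∀ a ∈ insert v U, Relation.ReflTransGen (EAdj (insert e F)) u a := by
      intro a ha
      rcases Finset.mem_insert.1 ha with rfl | ha
      · exact Relation.ReflTransGen.single hadj
      · exact Relation.ReflTransGen.mono hmono _ _ (hconn u hu a ha)
    refine ⟨insert v U, ?_, insert e F, ?_, ?_, ?_, ?_, ?_, ?_⟩
    · exact Finset.insert_subset hvS hUS
    · exact Finset.insert_subset heE hFE
    · rw [Finset.card_insert_of_notMem hv, hU]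
    · rw [Finset.card_insert_of_notMem heF, hF]
    · intro f hf
      rcases Finset.mem_insert.1 hf with rfl | hf
      · rcases he with rfl | rfl
        · simp [hu, hne]
        · simp [hu, hne.symm]
      · have := hend f hf
        simp [this.1, this.2.1, this.2.2]
    · intro a ha b hb
      exact (reflTransGen_eAdj_symm (hto a ha)).trans (hto b hb)
    · obtain ⟨l₁, l₂, rfl⟩ := List.append_of_mem ((hl u).2 hu)
      refine ⟨l₁ ++ u :: v :: u :: l₂, ?_, ?_, ?_⟩
      · intro z
        have := hl z
        simp only [List.mem_append, List.mem_cons, Finset.mem_insert] at this ⊢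
        tauto
      · have hc := hchain.imp hmono
        rw [List.isChain_append_cons_cons, List.isChain_cons_cons]
        rw [List.isChain_split] at hc
        exact ⟨hc.1, hadj, hadj.symm, hc.2⟩
      · rw [tourLen_append] at hlen ⊢
        simp only [tourLen]
        have hw : gweight (insert e F) = ‖u - v‖ + gweight F := by
          unfold gweight
          rw [Finset.sum_insert heF]
          rcases he with rfl | rfl
          · rfl
          · simp only [norm_sub_rev v u]
        rw [hw, norm_sub_rev v u]
        linarith

lemma ConnectsOn.exists_tree {S : Finset Plane} {E : Finset (Plane × Plane)}
    (h : ConnectsOn S E) (hS : S.Nonempty) :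
    ∃ F ⊆ E, IsSpanningTree S F ∧ ∃ l : List Plane, (∀ x, x ∈ l ↔ x ∈ S) ∧
      l.IsChain (EAdj F) ∧ tourLen l ≤ 2 * gweight F := by
  have hpos := Finset.card_pos.2 hS
  obtain ⟨U, hUS, F, hFE, hU, hF, hend, hconn, l, hl, hchain, hlen⟩ :=
    h.exists_partial_tree hS (S.card - 1) (by omega)
  obtain rfl : U = S := Finset.eq_of_subset_of_card_le hUS (by omega)
  exact ⟨F, hFE, ⟨hend, fun a ha b hb => exists_nat_path_iff.2 (hconn a ha b hb), by omega⟩,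
    l, hl, hchain, hlen⟩

lemma mst_le_of_isSpanningTree {S : Finset Plane} {T : Finset (Plane × Plane)}
    (h : IsSpanningTree S T) : mst S ≤ gweight T :=
  csInf_le ⟨0, by rintro _ ⟨T, _, rfl⟩; exact gweight_nonneg T⟩ ⟨T, h, rfl⟩

lemma ConnectsOn.mst_le {S : Finset Plane} {E : Finset (Plane × Plane)}
    (h : ConnectsOn S E) (hS : S.Nonempty) : mst S ≤ gweight E := by
  obtain ⟨F, hF, hT, -⟩ := h.exists_tree hS
  exact (mst_le_of_isSpanningTree hT).trans (gweight_mono hF)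

lemma exists_minimum_spanning_tree {S : Finset Plane} (hS : S.Nonempty) :
    ∃ T, IsSpanningTree S T ∧ gweight T = mst S := by
  have hne : {w | ∃ T : Finset (Plane × Plane), IsSpanningTree S T ∧ w = gweight T}.Nonempty := by
    have : ConnectsOn S (S ×ˢ S) := by
      refine ⟨fun e he => Finset.mem_product.1 he, fun a ha b hb => ?_⟩
      exact Relation.ReflTransGen.single (Or.inl (Finset.mk_mem_product ha hb))
    obtain ⟨F, -, hT, -⟩ := this.exists_tree hS
    exact ⟨_, F, hT, rfl⟩
  have hfin : {w | ∃ T : Finset (Plane × Plane), IsSpanningTree S T ∧ w = gweight T}.Finite := by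
    refine ((S ×ˢ S).powerset.image gweight).finite_toSet.subset ?_
    rintro _ ⟨T, hT, rfl⟩
    rw [Finset.coe_image]
    refine ⟨T, ?_, rfl⟩
    rw [Finset.mem_coe, Finset.mem_powerset]
    intro e he
    exact Finset.mem_product.2 ⟨(hT.1 e he).1, (hT.1 e he).2.1⟩
  obtain ⟨T, hT, h⟩ := hne.csInf_mem hfin
  exact ⟨T, hT, h.symm⟩

lemma IsSpanningTree.not_exchange {S : Finset Plane} {T : Finset (Plane × Plane)}
    (hT : IsSpanningTree S T) (hmin : gweight T = mst S) {a b t : Plane} (hab : EAdj T a b)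
    (ht : t ∈ S) : ¬ (‖a - t‖ < ‖a - b‖ ∧ ‖t - b‖ < ‖a - b‖) := by
  wlog hmem : (a, b) ∈ T generalizing a b
  · rintro ⟨h1, h2⟩
    refine this hab.symm (hab.resolve_left hmem) ⟨?_, ?_⟩
    · rwa [norm_sub_rev b t, norm_sub_rev b a]
    · rwa [norm_sub_rev t a, norm_sub_rev b a]
  rintro ⟨h1, h2⟩
  have hS := (hT.1 _ hmem)
  set T₀ := T.erase (a, b) with hT₀
  have hw : gweight T₀ + ‖a - b‖ = gweight T := by
    unfold gweight
    exact Finset.sum_erase_add T (fun e : Plane × Plane => ‖e.1 - e.2‖) hmem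
  have hstep : ∀ x y, EAdj T x y → EAdj T₀ x y ∨ (x = a ∧ y = b) ∨ (x = b ∧ y = a) := by
    rintro x y (h | h)
    · by_cases he : (x, y) = (a, b)
      · right; left; simpa using he
      · exact Or.inl (Or.inl (Finset.mem_erase.2 ⟨he, h⟩))
    · by_cases he : (y, x) = (a, b)
      · right; right; simp at he; tauto
      · exact Or.inl (Or.inr (Finset.mem_erase.2 ⟨he, h⟩))
  have hreach : ∀ x, Relation.ReflTransGen (EAdj T) t x → Relation.ReflTransGen (EAdj T₀) t x ∨
      Relation.ReflTransGen (EAdj T₀) t a ∨ Relation.ReflTransGen (EAdj T₀) t b := by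
    intro x hx
    induction hx with
    | refl => exact Or.inl Relation.ReflTransGen.refl
    | @tail y z _ hyz ih =>
      rcases ih with ih | ih
      · rcases hstep y z hyz with h | ⟨rfl, rfl⟩ | ⟨rfl, rfl⟩
        · exact Or.inl (ih.tail h)
        · exact Or.inr (Or.inl ih)
        · exact Or.inr (Or.inr ih)
      · exact Or.inr ih
  have key : ∀ c d, (c = a ∧ d = b ∨ c = b ∧ d = a) → Relation.ReflTransGen (EAdj T₀) t c →
      ‖t - d‖ < ‖a - b‖ → d ∈ S → False := by
    intro c d hcd hc hd hdS
    have hsub : T₀ ⊆ insert (t, d) T₀ := Finset.subset_insert _ _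
    have hcd' : Relation.ReflTransGen (EAdj (insert (t, d) T₀)) c d :=
      (Relation.ReflTransGen.mono (fun _ _ h => EAdj.mono hsub h) _ _
        (reflTransGen_eAdj_symm hc)).tail
        (Or.inl (by simp))
    have hc' : ConnectsOn S (insert (t, d) T₀) := by
      refine ⟨fun e he => ?_, fun x hx y hy => ?_⟩
      · rcases Finset.mem_insert.1 he with rfl | he
        · exact ⟨ht, hdS⟩
        · exact hT.connectsOn.1 e (Finset.mem_of_mem_erase he)
      · refine Relation.reflTransGen_closed ?_ _ _ (hT.connectsOn.2 x hx y hy)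
        intro p q hpq
        rcases hstep p q hpq with h | ⟨rfl, rfl⟩ | ⟨rfl, rfl⟩
        · exact Relation.ReflTransGen.single (h.mono hsub)
        · rcases hcd with ⟨rfl, rfl⟩ | ⟨rfl, rfl⟩
          · exact hcd'
          · exact reflTransGen_eAdj_symm hcd'
        · rcases hcd with ⟨rfl, rfl⟩ | ⟨rfl, rfl⟩
          · exact reflTransGen_eAdj_symm hcd'
          · exact hcd'
    have h3 := hc'.mst_le ⟨t, ht⟩
    have h4 := gweight_insert_le (t, d) T₀
    simp only at h4
    linarith
  rcases hreach a (hT.connectsOn.2 t ht a hS.1) with h | h | h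
  · exact key a b (by simp) h h2 hS.2.1
  · exact key a b (by simp) h h2 hS.2.1
  · exact key b a (by simp) h (by rwa [norm_sub_rev]) hS.1

lemma EAdj.segment_subset {E : Finset (Plane × Plane)} {a b : Plane} (h : EAdj E a b) :
    segment ℝ a b ⊆ segUnion E := by
  rcases h with h | h
  · exact segment_subset_segUnion h
  · rw [segment_symm]; exact segment_subset_segUnion h

lemma ConnectsOn.mem_segUnion {S : Finset Plane} {E : Finset (Plane × Plane)}
    (h : ConnectsOn S E) (hS : 2 ≤ S.card) {s : Plane} (hs : s ∈ S) : s ∈ segUnion E := by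
  obtain ⟨t, ht, hne⟩ := Finset.exists_mem_ne (by omega : 1 < S.card) s
  rcases Relation.ReflTransGen.cases_head (h.2 s hs t ht) with h1 | ⟨c, hc, -⟩
  · exact absurd h1.symm hne
  · exact hc.segment_subset (left_mem_segment ℝ s c)

lemma ConnectsOn.exists_curve {S : Finset Plane} {E : Finset (Plane × Plane)}
    (h : ConnectsOn S E) {p q : Plane} (hp : p ∈ segUnion E) (hq : q ∈ segUnion E) :
    ∃ γ : ℝ → Plane, Continuous γ ∧ γ 0 = p ∧ γ 1 = q ∧ ∀ x, γ x ∈ segUnion E := by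
  have hv : ∀ p ∈ segUnion E, ∃ a ∈ S, a ∈ segUnion E ∧ JoinedIn (segUnion E) p a := by
    intro p hp
    obtain ⟨e, he, hpe⟩ := Set.mem_iUnion₂.1 hp
    have hsub := segment_subset_segUnion (E := E) (a := e.1) (b := e.2) he
    refine ⟨e.1, (h.1 e he).1, hsub (left_mem_segment ℝ _ _), JoinedIn.of_segment_subset ?_⟩
    exact ((convex_segment (𝕜 := ℝ) e.1 e.2).segment_subset hpe (left_mem_segment ℝ _ _)).trans hsub
  obtain ⟨a, ha, haE, hpa⟩ := hv p hp
  obtain ⟨b, hb, -, hqb⟩ := hv q hq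
  have hab : JoinedIn (segUnion E) a b := by
    have := h.2 a ha b hb
    clear hqb hb
    induction this with
    | refl => exact JoinedIn.refl haE
    | tail _ hcd ih => exact ih.trans (JoinedIn.of_segment_subset hcd.segment_subset)
  have hpq := (hpa.trans hab).trans hqb.symm
  refine ⟨hpq.somePath.extend, hpq.somePath.continuous_extend, by simp, by simp, fun x => ?_⟩
  exact hpq.somePath_mem _

/-- Greedy thinning of the list `l`, started at `a`: keep the first point at distance at least `r`
from the last kept point. -/
def thinAux (r : ℝ) : Plane → List Plane → List Plane
  | _, [] => []
  | a, b :: l => if ‖a - b‖ < r then thinAux r a l else b :: thinAux r b l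

lemma mem_of_mem_thinAux {r : ℝ} {l : List Plane} {a x : Plane} (h : x ∈ thinAux r a l) :
    x ∈ l := by
  induction l generalizing a with
  | nil => simp [thinAux] at h
  | cons b l ih =>
    rw [thinAux] at h
    split_ifs at h
    · exact List.mem_cons_of_mem _ (ih h)
    · rcases List.mem_cons.1 h with rfl | h
      · exact List.mem_cons_self
      · exact List.mem_cons_of_mem _ (ih h)

lemma pair_infix_cons_cons {α : Type*} {z z' a c : α} {l : List α} :
    [z, z'] <:+: a :: c :: l ↔ (z = a ∧ z' = c) ∨ [z, z'] <:+: c :: l := by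
  rw [List.infix_cons_iff]
  simp

lemma JoinedIn.of_closedBall {Γ : Set Plane} {c c' x y : Plane} {ρ ρ' : ℝ}
    (h : JoinedIn (Γ ∩ Metric.closedBall c ρ) x y) (hc : ‖c - c'‖ + ρ ≤ ρ') :
    JoinedIn (Γ ∩ Metric.closedBall c' ρ') x y := by
  refine h.mono (Set.inter_subset_inter_right _ (Metric.closedBall_subset_closedBall' ?_))
  rw [dist_eq_norm]
  linarith

lemma exists_mem_thinAux_near {Γ : Set Plane} {r ρ : ℝ} (hr : 0 < r) (hρ : 3 * ρ ≤ r)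
    {l : List Plane} {a b x : Plane} (hab : ‖a - b‖ < r)
    (hJab : JoinedIn (Γ ∩ Metric.closedBall a (4 * r)) a b) (hΓ : ∀ y ∈ b :: l, y ∈ Γ)
    (hJ : ∀ y y', [y, y'] <:+: b :: l →
      JoinedIn (Γ ∩ Metric.closedBall y (3 * ρ + ‖y - y'‖)) y y')
    (h : x ∈ b :: l) : ∃ y ∈ a :: thinAux r a l, ‖x - y‖ ≤ r ∧
      JoinedIn (Γ ∩ Metric.closedBall y (4 * r)) x y := by
  rcases List.mem_cons.1 h with rfl | h
  · exact ⟨a, List.mem_cons_self, by rw [norm_sub_rev]; exact hab.le, hJab.symm⟩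
  induction l generalizing a b with
  | nil => simp at h
  | cons c l ih =>
    have hJ' : ∀ y y', [y, y'] <:+: c :: l →
        JoinedIn (Γ ∩ Metric.closedBall y (3 * ρ + ‖y - y'‖)) y y' := fun y y' h =>
      hJ y y' (pair_infix_cons_cons.2 (Or.inr h))
    have hΓ' : ∀ y ∈ c :: l, y ∈ Γ := fun y hy => hΓ y (List.mem_cons_of_mem _ hy)
    have hcc : JoinedIn (Γ ∩ Metric.closedBall c (4 * r)) c c :=
      JoinedIn.refl ⟨hΓ' c List.mem_cons_self, Metric.mem_closedBall_self (by positivity)⟩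
    rw [thinAux]
    split_ifs with hac
    · have hbc := hJ b c (pair_infix_cons_cons.2 (Or.inl ⟨rfl, rfl⟩))
      have hJac : JoinedIn (Γ ∩ Metric.closedBall a (4 * r)) a c := by
        refine hJab.trans (hbc.of_closedBall ?_)
        have := norm_sub_le_norm_sub_add_norm_sub b a c
        rw [norm_sub_rev b a] at *
        linarith
      rcases List.mem_cons.1 h with rfl | h
      · exact ⟨a, List.mem_cons_self, by rw [norm_sub_rev]; exact hac.le, hJac.symm⟩
      · exact ih hac hJac hΓ' hJ' (List.mem_cons_of_mem _ h) h
    · rcases List.mem_cons.1 h with rfl | h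
      · exact ⟨x, by simp, by simpa using hr.le, hcc⟩
      · obtain ⟨y, hy, hxy⟩ := ih (a := c) (b := c) (by simpa using hr) hcc hΓ' hJ'
          (List.mem_cons_of_mem _ h) h
        exact ⟨y, List.mem_cons_of_mem _ hy, hxy⟩

lemma thinAux_consecutive {Γ : Set Plane} {r ρ : ℝ} {l : List Plane} {a b z z' : Plane}
    (hr : 0 < r) (hρ : 3 * ρ ≤ r) (hab : ‖a - b‖ < r)
    (hJab : JoinedIn (Γ ∩ Metric.closedBall a (4 * r)) a b) (hΓ : ∀ y ∈ b :: l, y ∈ Γ)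
    (hJ : ∀ y y', [y, y'] <:+: b :: l →
      JoinedIn (Γ ∩ Metric.closedBall y (3 * ρ + ‖y - y'‖)) y y')
    (h : [z, z'] <:+: a :: thinAux r a l) :
    r ≤ ‖z - z'‖ ∧ ∃ y, [y, z'] <:+: b :: l ∧ ‖z - y‖ < r ∧
      JoinedIn (Γ ∩ Metric.closedBall z (4 * r)) z y := by
  induction l generalizing a b with
  | nil =>
    have := h.length_le
    simp [thinAux] at this
  | cons c l ih =>
    have hJ' : ∀ y y', [y, y'] <:+: c :: l →
        JoinedIn (Γ ∩ Metric.closedBall y (3 * ρ + ‖y - y'‖)) y y' := fun y y' h =>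
      hJ y y' (pair_infix_cons_cons.2 (Or.inr h))
    have hΓ' : ∀ y ∈ c :: l, y ∈ Γ := fun y hy => hΓ y (List.mem_cons_of_mem _ hy)
    rw [thinAux] at h
    split_ifs at h with hac
    · have hbc := hJ b c (pair_infix_cons_cons.2 (Or.inl ⟨rfl, rfl⟩))
      have hJac : JoinedIn (Γ ∩ Metric.closedBall a (4 * r)) a c := by
        refine hJab.trans (hbc.of_closedBall ?_)
        have := norm_sub_le_norm_sub_add_norm_sub b a c
        rw [norm_sub_rev b a] at *
        linarith
      obtain ⟨h1, y, h2, h3⟩ := ih hac hJac hΓ' hJ' h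
      exact ⟨h1, y, pair_infix_cons_cons.2 (Or.inr h2), h3⟩
    · rcases pair_infix_cons_cons.1 h with ⟨rfl, rfl⟩ | h
      · exact ⟨not_lt.1 hac, b, pair_infix_cons_cons.2 (Or.inl ⟨rfl, rfl⟩), hab, hJab⟩
      · obtain ⟨h1, y, h2, h3⟩ := ih (a := c) (b := c) (by simpa using hr)
          (JoinedIn.refl ⟨hΓ' c List.mem_cons_self, Metric.mem_closedBall_self (by positivity)⟩)
          hΓ' hJ' h
        exact ⟨h1, y, pair_infix_cons_cons.2 (Or.inr h2), h3⟩

lemma exists_consecutive {α : Type*} {L : List α} {z w : α} (hz : z ∈ L) (hw : w ∈ L)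
    (hne : z ≠ w) : ∃ z', [z, z'] <:+: L ∨ [z', z] <:+: L := by
  induction L with
  | nil => simp at hz
  | cons a L ih =>
    cases L with
    | nil => simp at hz hw; exact absurd (hz.trans hw.symm) hne
    | cons b L =>
      by_cases h1 : z = a
      · exact ⟨b, Or.inl (pair_infix_cons_cons.2 (Or.inl ⟨h1, rfl⟩))⟩
      have hz' : z ∈ b :: L := by simpa [h1] using hz
      by_cases h2 : z = b
      · exact ⟨a, Or.inr (pair_infix_cons_cons.2 (Or.inl ⟨rfl, h2⟩))⟩
      by_cases h3 : w = a
      · obtain ⟨z', h⟩ : ∃ z', [z, z'] <:+: b :: L ∨ [z', z] <:+: b :: L := by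
          clear ih hz hw
          induction L generalizing b with
          | nil => simp [h2] at hz'
          | cons c L ih' =>
            by_cases h4 : z = c
            · exact ⟨b, Or.inr (pair_infix_cons_cons.2 (Or.inl ⟨rfl, h4⟩))⟩
            · obtain ⟨z', h⟩ := ih' c (by simpa [h2] using hz') h4
              exact ⟨z', h.imp (fun h => pair_infix_cons_cons.2 (Or.inr h))
                (fun h => pair_infix_cons_cons.2 (Or.inr h))⟩
        exact ⟨z', h.imp (fun h => pair_infix_cons_cons.2 (Or.inr h))
          (fun h => pair_infix_cons_cons.2 (Or.inr h))⟩
      · obtain ⟨z', h⟩ := ih hz' (by simpa [h3] using hw)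
        exact ⟨z', h.imp (fun h => pair_infix_cons_cons.2 (Or.inr h))
          (fun h => pair_infix_cons_cons.2 (Or.inr h))⟩

/-- `GoodWalk E η a l ω`: consecutive points of `a :: l` are joined in `E` with stretch at
most `1 + η`, by paths of total weight `ω`. -/
inductive GoodWalk (E : Finset (Plane × Plane)) (η : ℝ) : Plane → List Plane → ℝ → Prop
  | nil (a : Plane) : GoodWalk E η a [] 0
  | cons {a b : Plane} {p ω : ℝ} {l : List Plane} (h : HasPath E a b p)
      (hp : p ≤ (1 + η) * ‖a - b‖) (hl : GoodWalk E η b l ω) : GoodWalk E η a (b :: l) (p + ω)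

lemma GoodWalk.mono {E F : Finset (Plane × Plane)} {η ω : ℝ} {a : Plane} {l : List Plane}
    (h : GoodWalk E η a l ω) (hEF : E ⊆ F) : GoodWalk F η a l ω := by
  induction h with
  | nil a => exact .nil a
  | cons h hp _ ih => exact .cons (h.mono hEF le_rfl) hp ih

lemma GoodWalk.nonneg {E : Finset (Plane × Plane)} {η ω : ℝ} {a : Plane} {l : List Plane}
    (h : GoodWalk E η a l ω) : 0 ≤ ω := by
  induction h with
  | nil a => exact le_rfl
  | cons h hp _ ih => exact add_nonneg h.nonneg ih

lemma GoodWalk.hasPath {E : Finset (Plane × Plane)} {η ω : ℝ} {a z z' : Plane} {l : List Plane}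
    (h : GoodWalk E η a l ω) (hz : [z, z'] <:+: a :: l) :
    HasPath E z z' ((1 + η) * ‖z - z'‖) := by
  induction h with
  | nil a => have := hz.length_le; simp at this
  | cons h hp _ ih =>
    rcases pair_infix_cons_cons.1 hz with ⟨rfl, rfl⟩ | hz
    · exact h.mono subset_rfl hp
    · exact ih hz

lemma GoodWalk.exists_thin {E : Finset (Plane × Plane)} {η ω p r : ℝ} {a b : Plane}
    {l : List Plane} (hη : 0 ≤ η) (h : GoodWalk E η b l ω) (hab : HasPath E a b p) :
    ∃ E', E ⊆ E' ∧ ∃ ω', GoodWalk E' η a (thinAux r a l) ω' ∧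
      η * (gweight E' - gweight E) + ω' ≤ p + ω := by
  induction l generalizing E a b p ω with
  | nil =>
    exact ⟨E, subset_rfl, 0, .nil a, by have := hab.nonneg; have := h.nonneg; linarith⟩
  | cons c l ih =>
    rw [thinAux]
    cases h with
    | @cons _ _ q ω _ hbc hq hl =>
      split_ifs with hac
      · obtain ⟨E', hE, ω', h1, h2⟩ := ih hl (hab.trans hbc)
        exact ⟨E', hE, ω', h1, by linarith⟩
      · by_cases hpq : p + q ≤ (1 + η) * ‖a - c‖
        · obtain ⟨E', hE, ω', h1, h2⟩ := ih hl (HasPath.refl le_rfl)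
          exact ⟨E', hE, _, .cons ((hab.trans hbc).mono hE le_rfl) hpq h1, by linarith⟩
        · have hsub : E ⊆ insert (a, c) E := Finset.subset_insert _ _
          obtain ⟨E', hE, ω', h1, h2⟩ := ih (hl.mono hsub) (HasPath.refl le_rfl)
          refine ⟨E', hsub.trans hE, _, .cons (HasPath.of_mem (hE (Finset.mem_insert_self _ _)))
            ?_ h1, ?_⟩
          · nlinarith [norm_nonneg (a - c), mul_nonneg hη (norm_nonneg (a - c))]
          · have h3 := mul_le_mul_of_nonneg_left (gweight_insert_le (a, c) E) hη
            simp only at h3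
            nlinarith

lemma goodWalk_of_isChain {T : Finset (Plane × Plane)} {η : ℝ} (hη : 0 ≤ η) {a : Plane}
    {l : List Plane} (h : (a :: l).IsChain (EAdj T)) : GoodWalk T η a l (tourLen (a :: l)) := by
  induction l generalizing a with
  | nil => exact .nil a
  | cons b l ih =>
    rw [List.isChain_cons_cons] at h
    refine .cons (HasPath.of_segment h.1.segment_subset) ?_ (ih h.2)
    nlinarith [mul_nonneg hη (norm_nonneg (a - b))]

/-- The hierarchy of walks: a network of weight `O(η⁻¹ mst)` containing, at every scale `r k`,
a `(1 + η)`-stretch edge of length about `r k` near every point, unless there is a tree edge of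
length at least `r k` nearby; near is meant along the tree. -/
lemma exists_walk_network {S : Finset Plane} {T : Finset (Plane × Plane)}
    (hT : IsSpanningTree S T) (hmin : gweight T = mst S) (hS : 2 ≤ S.card) {η : ℝ} (hη : 0 < η)
    (r : ℕ → ℝ) (hr : ∀ k, 0 < r k) (hr3 : ∀ k, 3 * r k ≤ r (k + 1)) (N : ℕ) :
    ∃ E : Finset (Plane × Plane), gweight E ≤ (1 + 2 / η) * mst S ∧
      ∀ k < N, ∀ u ∈ S, (∃ w ∈ S, 4 * r k < ‖u - w‖) →
        (∃ z ∈ S, ∃ z' ∈ S, JoinedIn (segUnion T ∩ Metric.closedBall u (12 * r k)) u z ∧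
          JoinedIn (segUnion T ∩ Metric.closedBall u (12 * r k)) u z' ∧ r k ≤ ‖z - z'‖ ∧
          HasPath E z z' ((1 + η) * ‖z - z'‖)) ∨
        ∃ a b, EAdj T a b ∧ JoinedIn (segUnion T ∩ Metric.closedBall u (12 * r k)) u a ∧
          r k ≤ ‖a - b‖ := by
  have hSne : S.Nonempty := Finset.card_pos.1 (by omega)
  obtain ⟨F, hFT, -, l, hl, hchain, hlen⟩ := hT.connectsOn.exists_tree hSne
  have hlT : l.IsChain (EAdj T) := hchain.imp fun a b h => h.mono hFT
  have hlen' : tourLen l ≤ 2 * mst S :=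
    hlen.trans (by have := gweight_mono hFT; linarith)
  obtain ⟨a₀, l₀, rfl⟩ : ∃ a₀ l₀, l = a₀ :: l₀ := by
    obtain ⟨s, hs⟩ := hSne
    exact List.exists_cons_of_ne_nil (List.ne_nil_of_mem ((hl s).2 hs))
  let ℓ : ℕ → List Plane := fun k => Nat.rec l₀ (fun k L => thinAux (r k) a₀ L) k
  have hℓ : ∀ k, ℓ (k + 1) = thinAux (r k) a₀ (ℓ k) := fun k => rfl
  have hnet : ∀ N, ∃ E, T ⊆ E ∧ (∃ ω, GoodWalk E η a₀ (ℓ N) ω ∧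
      η * (gweight E - gweight T) + ω ≤ 2 * mst S) ∧
      ∀ k ≤ N, ∃ ω, GoodWalk E η a₀ (ℓ k) ω := by
    intro N
    induction N with
    | zero =>
      have h0 : GoodWalk T η a₀ (ℓ 0) (tourLen (a₀ :: l₀)) := goodWalk_of_isChain hη.le hlT
      refine ⟨T, subset_rfl, ⟨_, h0, by linarith⟩, fun k hk => ?_⟩
      obtain rfl : k = 0 := by omega
      exact ⟨_, h0⟩
    | succ N ih =>
      obtain ⟨E, hTE, ⟨ω, hω, hw⟩, hall⟩ := ih
      obtain ⟨E', hE, ω', h1, h2⟩ := hω.exists_thin (r := r N) hη.le (HasPath.refl le_rfl)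
      refine ⟨E', hTE.trans hE, ⟨ω', h1, by nlinarith⟩, fun k hk => ?_⟩
      rcases Nat.lt_or_eq_of_le hk with hk | rfl
      · obtain ⟨ω'', h⟩ := hall k (by omega)
        exact ⟨ω'', h.mono hE⟩
      · exact ⟨ω', h1⟩
  have hmem : ∀ k, ∀ x ∈ a₀ :: ℓ k, x ∈ S := by
    intro k
    induction k with
    | zero => exact fun x hx => (hl x).1 hx
    | succ k ih =>
      intro x hx
      rcases List.mem_cons.1 hx with rfl | hx
      · exact ih _ List.mem_cons_self
      · exact ih x (List.mem_cons_of_mem _ (mem_of_mem_thinAux hx))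
  have hΓ : ∀ k, ∀ x ∈ a₀ :: ℓ k, x ∈ segUnion T := fun k x hx =>
    hT.connectsOn.mem_segUnion hS (hmem k x hx)
  have hself : ∀ k, ∀ ρ : ℝ, 0 ≤ ρ → JoinedIn (segUnion T ∩ Metric.closedBall a₀ ρ) a₀ a₀ :=
    fun k ρ hρ => JoinedIn.refl
      ⟨hΓ k a₀ List.mem_cons_self, Metric.mem_closedBall_self hρ⟩
  have hedge : ∀ z z', [z, z'] <:+: a₀ :: ℓ 0 →
      JoinedIn (segUnion T ∩ Metric.closedBall z (3 * 0 + ‖z - z'‖)) z z' := by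
    intro z z' h
    have hadj : EAdj T z z' := by
      have := hlT.infix h
      rwa [List.isChain_pair] at this
    refine JoinedIn.of_segment_subset (Set.subset_inter hadj.segment_subset ?_)
    refine (convex_closedBall _ _).segment_subset (Metric.mem_closedBall_self (by positivity)) ?_
    rw [Metric.mem_closedBall, dist_eq_norm, norm_sub_rev]
    linarith
  have hcons : ∀ k z z', [z, z'] <:+: a₀ :: ℓ (k + 1) → r k ≤ ‖z - z'‖ ∧
      JoinedIn (segUnion T ∩ Metric.closedBall z (3 * r k + ‖z - z'‖)) z z' ∧
      (‖z - z'‖ ≤ 3 * r k ∨ ∃ p, EAdj T p z' ∧ ‖p - z‖ ≤ 2 * r k ∧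
        JoinedIn (segUnion T ∩ Metric.closedBall z (4 * r k)) z p) := by
    intro k
    induction k with
    | zero =>
      intro z z' h
      have hr0 := hr 0
      obtain ⟨h1, y, h2, h3, h4⟩ := thinAux_consecutive (b := a₀) (hr 0) (by simpa using hr0.le)
        (by simpa using hr 0) (hself 0 _ (by positivity)) (hΓ 0) hedge h
      refine ⟨h1, (h4.of_closedBall ?_).trans ((hedge y z' h2).of_closedBall ?_),
        Or.inr ⟨y, ?_, by rw [norm_sub_rev]; linarith, h4⟩⟩
      · rw [sub_self, norm_zero]; linarith
      · have := norm_sub_le_norm_sub_add_norm_sub y z z'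
        rw [norm_sub_rev y z] at *
        linarith
      · have := hlT.infix h2
        rwa [List.isChain_pair] at this
    | succ k ih =>
      intro z z' h
      have hr0 := hr (k + 1)
      obtain ⟨h1, y, h2, h3, h4⟩ := thinAux_consecutive (b := a₀) (hr (k + 1)) (hr3 k)
        (by simpa using hr (k + 1)) (hself 0 _ (by positivity)) (hΓ (k + 1))
        (fun y y' hyy => (ih y y' hyy).2.1) h
      have := hr3 k
      have := hr k
      obtain ⟨-, h5, h6⟩ := ih y z' h2
      refine ⟨h1, (h4.of_closedBall ?_).trans (h5.of_closedBall ?_), ?_⟩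
      · rw [sub_self, norm_zero]; linarith
      · have := norm_sub_le_norm_sub_add_norm_sub y z z'
        rw [norm_sub_rev y z] at *
        linarith
      rcases h6 with h6 | ⟨p, hp, h6, h7⟩
      · left
        have := norm_sub_le_norm_sub_add_norm_sub z y z'
        linarith
      · right
        refine ⟨p, hp, ?_, h4.trans (h7.of_closedBall ?_)⟩
        · have := norm_sub_le_norm_sub_add_norm_sub p y z
          rw [norm_sub_rev y z] at this
          linarith
        · rw [norm_sub_rev y z]; linarith
  have hcover : ∀ k, ∀ u ∈ S, ∃ v ∈ a₀ :: ℓ (k + 1), ‖u - v‖ ≤ 2 * r k ∧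
      JoinedIn (segUnion T ∩ Metric.closedBall v (4 * r k)) u v := by
    intro k
    induction k with
    | zero =>
      intro u hu
      have hr0 := hr 0
      obtain ⟨y, hy, h, hJ⟩ := exists_mem_thinAux_near (a := a₀) (hr 0) (by simpa using hr0.le)
        (by simpa using hr 0) (hself 0 _ (by positivity)) (hΓ 0) hedge ((hl u).2 hu)
      exact ⟨y, hy, by linarith, hJ⟩
    | succ k ih =>
      intro u hu
      have hr0 := hr (k + 1)
      obtain ⟨v, hv, huv, hJ⟩ := ih u hu
      obtain ⟨y, hy, h, hJ'⟩ := exists_mem_thinAux_near (a := a₀) (hr (k + 1)) (hr3 k)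
        (by simpa using hr (k + 1)) (hself 0 _ (by positivity)) (hΓ (k + 1))
        (fun y y' hyy => (hcons k y y' hyy).2.1) hv
      have := hr3 k
      have := hr k
      refine ⟨y, hy, ?_, (hJ.of_closedBall ?_).trans hJ'⟩
      · have := norm_sub_le_norm_sub_add_norm_sub u v y
        linarith
      · linarith
  obtain ⟨E, hTE, ⟨ω, hω, hw⟩, hall⟩ := hnet N
  refine ⟨E, ?_, ?_⟩
  · have h1 := hω.nonneg
    have h2 : gweight E - gweight T ≤ 2 * mst S / η := by
      rw [le_div_iff₀ hη]; linarith
    have : (1 + 2 / η) * mst S = mst S + 2 * mst S / η := by ring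
    rw [this]; linarith
  · rintro k hk u hu ⟨w, hw, huw⟩
    obtain ⟨ω', hgood⟩ := hall (k + 1) (by omega)
    obtain ⟨v, hv, huv, hJ⟩ := hcover k u hu
    obtain ⟨v', hv', hwv, -⟩ := hcover k w hw
    have hne : v ≠ v' := by
      rintro rfl
      have := norm_sub_le_norm_sub_add_norm_sub u v w
      rw [norm_sub_rev v w] at this
      linarith
    have hrk := hr k
    have hvu : ‖v - u‖ ≤ 2 * r k := by rwa [norm_sub_rev]
    have hJu : JoinedIn (segUnion T ∩ Metric.closedBall u (12 * r k)) u v :=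
      hJ.of_closedBall (by linarith)
    obtain ⟨z', hz'⟩ := exists_consecutive hv hv' hne
    rcases hz' with h | h
    · obtain ⟨h1, hJ1, h2⟩ := hcons k v z' h
      by_cases h3 : ‖v - z'‖ ≤ 3 * r k
      · left
        exact ⟨v, hmem (k + 1) v hv, z', hmem (k + 1) z' (h.subset (by simp)), hJu,
          hJu.trans (hJ1.of_closedBall (by linarith)), h1, hgood.hasPath h⟩
      obtain ⟨p, hp, h4, h5⟩ := h2.resolve_left h3
      right
      refine ⟨p, z', hp, hJu.trans (h5.of_closedBall (by linarith)), ?_⟩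
      have := norm_sub_le_norm_sub_add_norm_sub v p z'
      rw [norm_sub_rev v p] at this
      linarith
    · obtain ⟨h1, hJ1, h2⟩ := hcons k z' v h
      rw [norm_sub_rev z' v] at h1 h2
      by_cases h3 : ‖v - z'‖ ≤ 3 * r k
      · left
        refine ⟨v, hmem (k + 1) v hv, z', hmem (k + 1) z' (h.subset (by simp)), hJu,
          hJu.trans (hJ1.symm.of_closedBall ?_), h1, ?_⟩
        · have := norm_sub_le_norm_sub_add_norm_sub z' v u
          rw [norm_sub_rev z' v] at *
          linarith
        · rw [norm_sub_rev]; exact (hgood.hasPath h).symm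
      obtain ⟨p, hp, h4, h5⟩ := h2.resolve_left h3
      right
      refine ⟨v, p, hp.symm, hJu, ?_⟩
      have := norm_sub_le_norm_sub_add_norm_sub v p z'
      linarith

/-- Coordinate of `v` along `e`. -/
def xc (e v : Plane) : ℝ := e 0 * v 0 + e 1 * v 1

/-- Coordinate of `v` across `e`. -/
def vc (e v : Plane) : ℝ := e 0 * v 1 - e 1 * v 0

lemma xc_sub (e v w : Plane) : xc e (v - w) = xc e v - xc e w := by
  simp only [xc, PiLp.sub_apply]; ring

lemma vc_sub (e v w : Plane) : vc e (v - w) = vc e v - vc e w := by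
  simp only [vc, PiLp.sub_apply]; ring

lemma xc_add (e v w : Plane) : xc e (v + w) = xc e v + xc e w := by
  simp only [xc, PiLp.add_apply]; ring

lemma vc_add (e v w : Plane) : vc e (v + w) = vc e v + vc e w := by
  simp only [vc, PiLp.add_apply]; ring

lemma xc_smul (e v : Plane) (c : ℝ) : xc e (c • v) = c * xc e v := by
  simp only [xc, PiLp.smul_apply, smul_eq_mul]; ring

lemma vc_smul (e v : Plane) (c : ℝ) : vc e (c • v) = c * vc e v := by
  simp only [vc, PiLp.smul_apply, smul_eq_mul]; ring

lemma xc_neg_left (e v : Plane) : xc (-e) v = - xc e v := by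
  simp only [xc, PiLp.neg_apply]; ring

lemma vc_neg_left (e v : Plane) : vc (-e) v = - vc e v := by
  simp only [vc, PiLp.neg_apply]; ring

lemma continuous_xc (e : Plane) : Continuous (xc e) := by
  unfold xc; fun_prop

lemma continuous_vc (e : Plane) : Continuous (vc e) := by
  unfold vc; fun_prop

lemma plane_norm_sq (v : Plane) : ‖v‖ ^ 2 = v 0 ^ 2 + v 1 ^ 2 := by
  rw [EuclideanSpace.norm_sq_eq]
  simp

lemma xc_sq_add_vc_sq {e : Plane} (he : ‖e‖ = 1) (v : Plane) :
    xc e v ^ 2 + vc e v ^ 2 = ‖v‖ ^ 2 := by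
  have h := plane_norm_sq e
  rw [he] at h
  rw [plane_norm_sq, xc, vc]
  linear_combination (-(v 0 ^ 2 + v 1 ^ 2)) * h

lemma abs_xc_le {e : Plane} (he : ‖e‖ = 1) (v : Plane) : |xc e v| ≤ ‖v‖ :=
  abs_le_of_sq_le_sq (by nlinarith [xc_sq_add_vc_sq he v, sq_nonneg (vc e v)]) (norm_nonneg v)

lemma abs_vc_le {e : Plane} (he : ‖e‖ = 1) (v : Plane) : |vc e v| ≤ ‖v‖ :=
  abs_le_of_sq_le_sq (by nlinarith [xc_sq_add_vc_sq he v, sq_nonneg (xc e v)]) (norm_nonneg v)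

lemma xc_le_norm {e : Plane} (he : ‖e‖ = 1) (v : Plane) : xc e v ≤ ‖v‖ :=
  (le_abs_self _).trans (abs_xc_le he v)

lemma norm_le_abs_add {e : Plane} (he : ‖e‖ = 1) (v : Plane) : ‖v‖ ≤ |xc e v| + |vc e v| := by
  refine le_of_sq_le_sq ?_ (by positivity)
  rw [← xc_sq_add_vc_sq he v, ← sq_abs (xc e v), ← sq_abs (vc e v)]
  nlinarith [abs_nonneg (xc e v), abs_nonneg (vc e v)]

lemma norm_le_xc_add {e : Plane} (he : ‖e‖ = 1) (v : Plane) {y c : ℝ} (hx : 0 ≤ c)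
    (hy : 0 ≤ xc e v) (h : vc e v ^ 2 ≤ 2 * c * xc e v) (hyc : y = xc e v + c) : ‖v‖ ≤ y := by
  refine le_of_sq_le_sq ?_ (by linarith)
  rw [← xc_sq_add_vc_sq he v, hyc]
  nlinarith

/-- The point with coordinates `x` along `e` and `y` across `e`. -/
def framePt (e : Plane) (x y : ℝ) : Plane := pt (e 0 * x - e 1 * y) (e 1 * x + e 0 * y)

@[simp] lemma pt_zero (x y : ℝ) : pt x y 0 = x := rfl

@[simp] lemma pt_one (x y : ℝ) : pt x y 1 = y := rfl

lemma xc_framePt {e : Plane} (he : ‖e‖ = 1) (x y : ℝ) : xc e (framePt e x y) = x := by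
  have h := plane_norm_sq e
  rw [he] at h
  simp only [xc, framePt, pt_zero, pt_one]
  linear_combination (-x) * h

lemma vc_framePt {e : Plane} (he : ‖e‖ = 1) (x y : ℝ) : vc e (framePt e x y) = y := by
  have h := plane_norm_sq e
  rw [he] at h
  simp only [vc, framePt, pt_zero, pt_one]
  linear_combination (-y) * h

lemma exists_kernel {α : Type*} (x y : α → ℝ) (c : ℝ) (F : Finset α) :
    ∃ A ⊆ F, (∀ a ∈ A, ∀ b ∈ A, a ≠ b → c * (x a - x b) ^ 2 < |y a - y b| ^ 3) ∧
      ∀ s ∈ F, ∃ a ∈ A, x s ≤ x a ∧ |y a - y s| ^ 3 ≤ c * (x a - x s) ^ 2 := by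
  induction F using Finset.strongInduction with
  | H F ih =>
    rcases F.eq_empty_or_nonempty with rfl | hF
    · exact ⟨∅, by simp, by simp, by simp⟩
    obtain ⟨m, hm, hmax⟩ := F.exists_max_image x hF
    set G := F.filter fun a => c * (x m - x a) ^ 2 < |y m - y a| ^ 3 with hG
    have hmG : m ∉ G := by simp [hG]
    obtain ⟨A, hA, hind, hdom⟩ := ih G
      ⟨Finset.filter_subset _ _, fun h => hmG (h hm)⟩
    have hAF : A ⊆ F := hA.trans (Finset.filter_subset _ _)
    refine ⟨insert m A, Finset.insert_subset hm hAF, ?_, ?_⟩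
    · have hmA : ∀ a ∈ A, c * (x m - x a) ^ 2 < |y m - y a| ^ 3 := fun a ha =>
        (Finset.mem_filter.1 (hA ha)).2
      intro a ha b hb hab
      rcases Finset.mem_insert.1 ha with ha' | ha' <;>
        rcases Finset.mem_insert.1 hb with hb' | hb'
      · exact absurd (ha'.trans hb'.symm) hab
      · rw [ha']
        exact hmA b hb'
      · have := hmA a ha'
        rw [hb']
        rwa [abs_sub_comm, ← neg_sub (x a) (x m), neg_sq] at this
      · exact hind a ha' b hb' hab
    · intro s hs
      by_cases hsG : s ∈ G
      · obtain ⟨a, ha, h⟩ := hdom s hsG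
        exact ⟨a, Finset.mem_insert_of_mem ha, h⟩
      · refine ⟨m, Finset.mem_insert_self _ _, hmax s hs, ?_⟩
        by_contra hcon
        exact hsG (Finset.mem_filter.2 ⟨hs, not_le.1 hcon⟩)

/-- A tree of weight `O(w)` along `e` joining the points in a `w × δw` box to a common hub,
with additive error `O(δ² w)` after a first hop. -/
lemma exists_half_gadget {e : Plane} (he : ‖e‖ = 1) {δ w x₀ v₀ : ℝ} (hδ : 0 < δ) (hδ1 : δ ≤ 1)
    (hw : 0 < w) {F : Finset Plane} (hFx : ∀ a ∈ F, x₀ ≤ xc e a ∧ xc e a < x₀ + w)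
    (hFv : ∀ a ∈ F, v₀ ≤ vc e a ∧ vc e a < v₀ + δ * w) :
    ∃ (h : Plane) (E : Finset (Plane × Plane)), gweight E ≤ 50 * w ∧
      x₀ + w ≤ xc e h ∧ xc e h ≤ x₀ + 3 * w ∧ v₀ ≤ vc e h ∧ vc e h ≤ v₀ + δ * w ∧
      ∀ s ∈ F, ∃ z ∈ F, ‖s - z‖ ≤ xc e z - xc e s + 5 * δ ^ 2 * w ∧
        HasPath E z h (xc e h - xc e z + 2 * δ ^ 2 * w) := by
  rcases F.eq_empty_or_nonempty with rfl | hF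
  · refine ⟨framePt e (x₀ + w) v₀, ∅, by simp [gweight]; positivity, ?_⟩
    rw [xc_framePt he, vc_framePt he]
    have : 0 < δ * w := by positivity
    exact ⟨le_rfl, by linarith, le_rfl, by linarith, by simp⟩
  obtain ⟨n, hn1, hn2⟩ : ∃ n : ℕ, (2 : ℝ) ^ n ≤ 1 / δ ∧ 1 / δ < 2 ^ (n + 1) :=
    exists_nat_pow_near ((one_le_div hδ).2 hδ1) one_lt_two
  have hnδ : (n : ℝ) * δ ≤ 1 := by
    have h1 : (n : ℝ) ≤ 2 ^ n := by exact_mod_cast Nat.lt_two_pow_self.le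
    have := h1.trans hn1
    rwa [le_div_iff₀ hδ] at this
  obtain ⟨A, hAF, hind, hdom⟩ := exists_kernel (xc e) (vc e) (δ ^ 3 * w) F
  have hA : A.Nonempty := by
    obtain ⟨s, hs⟩ := hF
    obtain ⟨a, ha, -⟩ := hdom s hs
    exact ⟨a, ha⟩
  have hδw : 0 < δ * w := by positivity
  let ρ : ℕ → Plane → ℕ := fun i a => ⌊(vc e a - v₀) / (δ * w) * 4 ^ i⌋₊
  have hρ : ∀ i a, a ∈ F → (ρ i a : ℝ) * (δ * w * (1 / 4) ^ i) ≤ vc e a - v₀ ∧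
      vc e a - v₀ < (ρ i a + 1) * (δ * w * (1 / 4) ^ i) := by
    intro i a ha
    have h4 : (0 : ℝ) < 4 ^ i := by positivity
    have hnn : 0 ≤ (vc e a - v₀) / (δ * w) * 4 ^ i := by
      have := (hFv a ha).1
      have : 0 ≤ vc e a - v₀ := by linarith
      positivity
    have h1 := Nat.floor_le hnn
    have h2 := Nat.lt_floor_add_one ((vc e a - v₀) / (δ * w) * 4 ^ i)
    have e1 : vc e a - v₀ = ((vc e a - v₀) / (δ * w) * 4 ^ i) * (δ * w * (1 / 4) ^ i) := by
      rw [one_div, inv_pow]; field_simp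
    have hp : 0 < δ * w * (1 / 4) ^ i := by positivity
    constructor
    · calc (ρ i a : ℝ) * (δ * w * (1 / 4) ^ i) ≤ _ := mul_le_mul_of_nonneg_right h1 hp.le
        _ = _ := e1.symm
    · calc vc e a - v₀ = _ := e1
        _ < _ := mul_lt_mul_of_pos_right h2 hp
  have hρlt : ∀ i a, a ∈ F → ρ i a < 4 ^ i := by
    intro i a ha
    have h1 := (hρ i a ha).1
    have h2 := (hFv a ha).2
    have h3 : (ρ i a : ℝ) * (1 / 4) ^ i < 1 := by
      by_contra hcon
      push Not at hcon
      nlinarith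
    have h4 : (ρ i a : ℝ) < 4 ^ i := by
      rw [one_div, inv_pow, ← div_eq_mul_inv, div_lt_one (by positivity)] at h3
      exact h3
    exact_mod_cast h4
  have hρdiv : ∀ i a, ρ i a = ρ (i + 1) a / 4 := by
    intro i a
    have : (vc e a - v₀) / (δ * w) * 4 ^ i = (vc e a - v₀) / (δ * w) * 4 ^ (i + 1) / (4 : ℕ) := by
      rw [pow_succ]; push_cast; ring
    simp only [ρ]
    rw [this, Nat.floor_div_natCast]
  have hspread : ∀ i, ∀ a ∈ A, ∀ b ∈ A, ρ i a = ρ i b → xc e a - xc e b < w * (1 / 8) ^ i := by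
    intro i a ha b hb hab
    by_contra hcon
    push Not at hcon
    have hpos : 0 < w * (1 / 8) ^ i := by positivity
    have hne : a ≠ b := by rintro rfl; linarith [sub_self (xc e a)]
    have h1 := hind a ha b hb hne
    have h2 := hρ i a (hAF ha)
    have h3 := hρ i b (hAF hb)
    rw [hab] at h2
    have h4 : |vc e a - vc e b| ≤ δ * w * (1 / 4) ^ i := by
      rw [abs_le]; constructor <;> nlinarith
    have h5 := pow_le_pow_left₀ (abs_nonneg _) h4 3
    have h6 := pow_le_pow_left₀ hpos.le hcon 2
    have e1 : ((1 / 4 : ℝ) ^ i) ^ 3 = ((1 / 8) ^ i) ^ 2 := by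
      rw [← pow_mul, ← pow_mul, mul_comm i 3, mul_comm i 2, pow_mul, pow_mul]; norm_num
    have e2 : (δ * w * (1 / 4) ^ i) ^ 3 = δ ^ 3 * w * (w * (1 / 8) ^ i) ^ 2 := by
      rw [mul_pow, e1]; ring
    have h7 := mul_le_mul_of_nonneg_left h6 (by positivity : 0 ≤ δ ^ 3 * w)
    linarith
  have hrep : ∀ i j, ∃ z, (∃ a ∈ A, ρ i a = j) → z ∈ A ∧ ρ i z = j ∧
      ∀ a ∈ A, ρ i a = j → xc e a ≤ xc e z := by
    intro i j
    by_cases h : ∃ a ∈ A, ρ i a = j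
    · obtain ⟨a, ha, haj⟩ := h
      obtain ⟨z, hz, hmax⟩ := (A.filter fun a => ρ i a = j).exists_max_image (xc e)
        ⟨a, Finset.mem_filter.2 ⟨ha, haj⟩⟩
      rw [Finset.mem_filter] at hz
      exact ⟨z, fun _ => ⟨hz.1, hz.2, fun b hb hbj => hmax b (Finset.mem_filter.2 ⟨hb, hbj⟩)⟩⟩
    · exact ⟨0, fun h' => absurd h' h⟩
  choose rep hrep using hrep
  let node : ℕ → ℕ → Plane := fun i j => framePt e (xc e (rep i j) + 2 * (w * (1 / 8) ^ i))
    (v₀ + (j + 1 / 2) * (δ * w * (1 / 4) ^ i))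
  have hnx : ∀ i j, xc e (node i j) = xc e (rep i j) + 2 * (w * (1 / 8) ^ i) := fun i j =>
    xc_framePt he _ _
  have hnv : ∀ i j, vc e (node i j) = v₀ + (j + 1 / 2) * (δ * w * (1 / 4) ^ i) := fun i j =>
    vc_framePt he _ _
  -- a leaf edge and a tree edge are short and almost parallel to `e`
  have hleafx : ∀ a ∈ A, xc e (node n (ρ n a) - rep n (ρ n a)) = 2 * (w * (1 / 8) ^ n) := by
    intro a _; rw [xc_sub, hnx]; ring
  have hleafv : ∀ a ∈ A, |vc e (node n (ρ n a) - rep n (ρ n a))| ≤ δ * w * (1 / 4) ^ n := by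
    intro a ha
    obtain ⟨h1, h2, -⟩ := hrep n _ ⟨a, ha, rfl⟩
    have h3 := hρ n _ (hAF h1)
    rw [h2] at h3
    have : 0 < δ * w * (1 / 4) ^ n := by positivity
    rw [vc_sub, hnv, abs_le]
    constructor <;> nlinarith
  have hedgex : ∀ i, ∀ a ∈ A, (7 / 4) * (w * (1 / 8) ^ i) ≤
      xc e (node i (ρ i a) - node (i + 1) (ρ (i + 1) a)) ∧
      xc e (node i (ρ i a) - node (i + 1) (ρ (i + 1) a)) ≤ 3 * (w * (1 / 8) ^ i) := by
    intro i a ha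
    obtain ⟨h1, h2, h3⟩ := hrep i _ ⟨a, ha, rfl⟩
    obtain ⟨h1', h2', h3'⟩ := hrep (i + 1) _ ⟨a, ha, rfl⟩
    have h4 : ρ i (rep (i + 1) (ρ (i + 1) a)) = ρ i a := by rw [hρdiv, h2', ← hρdiv]
    have h5 := h3 _ h1' h4
    have h6 := hspread i _ h1 _ h1' (h2.trans h4.symm)
    rw [xc_sub, hnx, hnx]
    have h7 : w * (1 / 8 : ℝ) ^ (i + 1) = w * (1 / 8) ^ i / 8 := by rw [pow_succ]; ring
    have : 0 < w * (1 / 8 : ℝ) ^ i := by positivity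
    rw [h7]
    constructor <;> linarith
  have hedgev : ∀ i, ∀ a ∈ A, |vc e (node i (ρ i a) - node (i + 1) (ρ (i + 1) a))| ≤
      δ * w * (1 / 4) ^ i := by
    intro i a ha
    rw [vc_sub, hnv, hnv]
    set q := δ * w * (1 / 4 : ℝ) ^ i with hq
    have hqpos : 0 < q := by positivity
    have h7 : δ * w * (1 / 4 : ℝ) ^ (i + 1) = q / 4 := by rw [pow_succ, hq]; ring
    have h8 : 4 * ρ i a ≤ ρ (i + 1) a ∧ ρ (i + 1) a ≤ 4 * ρ i a + 3 := by
      have := hρdiv i a; omega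
    have h9 : (4 : ℝ) * ρ i a ≤ ρ (i + 1) a := by exact_mod_cast h8.1
    have h10 : (ρ (i + 1) a : ℝ) ≤ 4 * ρ i a + 3 := by exact_mod_cast h8.2
    rw [h7, abs_le]
    constructor <;> nlinarith
  let leaves : Finset (Plane × Plane) := (A.image (ρ n)).image fun j => (rep n j, node n j)
  let level : ℕ → Finset (Plane × Plane) := fun i =>
    (A.image (ρ (i + 1))).image fun j => (node (i + 1) j, node i (j / 4))
  let E := leaves ∪ (Finset.range n).biUnion level
  have hleaf_mem : ∀ a ∈ A, (rep n (ρ n a), node n (ρ n a)) ∈ E := fun a ha =>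
    Finset.mem_union_left _ (Finset.mem_image_of_mem _ (Finset.mem_image_of_mem _ ha))
  have hlevel_mem : ∀ i < n, ∀ a ∈ A, (node (i + 1) (ρ (i + 1) a), node i (ρ i a)) ∈ E := by
    intro i hi a ha
    refine Finset.mem_union_right _ (Finset.mem_biUnion.2 ⟨i, Finset.mem_range.2 hi, ?_⟩)
    rw [hρdiv i a]
    exact Finset.mem_image_of_mem (fun j => (node (i + 1) j, node i (j / 4)))
      (Finset.mem_image_of_mem _ ha)
  have hcard : ∀ i, ((A.image (ρ i)).card : ℝ) ≤ 4 ^ i := by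
    intro i
    have : (A.image (ρ i)) ⊆ Finset.range (4 ^ i) := by
      intro j hj
      obtain ⟨a, ha, rfl⟩ := Finset.mem_image.1 hj
      exact Finset.mem_range.2 (hρlt i a (hAF ha))
    have := Finset.card_le_card this
    rw [Finset.card_range] at this
    exact_mod_cast this
  have hwleaves : gweight leaves ≤ 3 * w := by
    refine (gweight_image_le _ _).trans ?_
    have hb : ∀ j ∈ A.image (ρ n), ‖(rep n j, node n j).1 - (rep n j, node n j).2‖ ≤
        3 * (w * (1 / 4) ^ n) := by
      intro j hj
      obtain ⟨a, ha, rfl⟩ := Finset.mem_image.1 hj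
      simp only
      rw [norm_sub_rev]
      refine (norm_le_abs_add he _).trans ?_
      rw [hleafx a ha, abs_of_pos (by positivity)]
      have h1 := hleafv a ha
      have h2 : (1 / 8 : ℝ) ^ n ≤ (1 / 4) ^ n := pow_le_pow_left₀ (by norm_num) (by norm_num) n
      have h3 : (0 : ℝ) < (1 / 4) ^ n := by positivity
      have h4 := mul_le_mul_of_nonneg_left h2 hw.le
      have h5 : δ * w * (1 / 4 : ℝ) ^ n ≤ 1 * (w * (1 / 4) ^ n) := by
        rw [mul_assoc]; exact mul_le_mul_of_nonneg_right hδ1 (by positivity)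
      linarith
    refine (Finset.sum_le_card_nsmul _ _ _ hb).trans ?_
    rw [nsmul_eq_mul]
    calc ((A.image (ρ n)).card : ℝ) * (3 * (w * (1 / 4) ^ n))
        ≤ 4 ^ n * (3 * (w * (1 / 4) ^ n)) := mul_le_mul_of_nonneg_right (hcard n) (by positivity)
      _ = 3 * w * (4 * (1 / 4)) ^ n := by rw [mul_pow]; ring
      _ = 3 * w := by norm_num
  have hwlevel : ∀ i, gweight (level i) ≤ 12 * w * (1 / 2) ^ i + 4 * (δ * w) := by
    intro i
    refine (gweight_image_le _ _).trans ?_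
    have hb : ∀ j ∈ A.image (ρ (i + 1)), ‖(node (i + 1) j, node i (j / 4)).1 -
        (node (i + 1) j, node i (j / 4)).2‖ ≤ 3 * (w * (1 / 8) ^ i) + δ * w * (1 / 4) ^ i := by
      intro j hj
      obtain ⟨a, ha, rfl⟩ := Finset.mem_image.1 hj
      simp only
      rw [norm_sub_rev, ← hρdiv]
      refine (norm_le_abs_add he _).trans ?_
      have h0 : 0 < w * (1 / 8 : ℝ) ^ i := by positivity
      rw [abs_of_nonneg (by linarith [(hedgex i a ha).1])]
      linarith [(hedgex i a ha).2, hedgev i a ha]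
    refine (Finset.sum_le_card_nsmul _ _ _ hb).trans ?_
    rw [nsmul_eq_mul]
    calc ((A.image (ρ (i + 1))).card : ℝ) * (3 * (w * (1 / 8) ^ i) + δ * w * (1 / 4) ^ i)
        ≤ 4 ^ (i + 1) * (3 * (w * (1 / 8) ^ i) + δ * w * (1 / 4) ^ i) :=
          mul_le_mul_of_nonneg_right (hcard _) (by positivity)
      _ = 12 * w * (4 * (1 / 8)) ^ i + 4 * (δ * w) * (4 * (1 / 4)) ^ i := by
          rw [mul_pow, mul_pow, pow_succ]; ring
      _ = 12 * w * (1 / 2) ^ i + 4 * (δ * w) := by norm_num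
  have hwE : gweight E ≤ 50 * w := by
    have h1 : gweight E ≤ gweight leaves + ∑ i ∈ Finset.range n, gweight (level i) :=
      (gweight_union_le _ _).trans (by linarith [gweight_biUnion_le (Finset.range n) level])
    have h2 : ∑ i ∈ Finset.range n, gweight (level i) ≤
        ∑ i ∈ Finset.range n, (12 * w * (1 / 2) ^ i + 4 * (δ * w)) :=
      Finset.sum_le_sum fun i _ => hwlevel i
    rw [Finset.sum_add_distrib, ← Finset.mul_sum, Finset.sum_const, Finset.card_range,
      nsmul_eq_mul] at h2
    have h3 : ∑ i ∈ Finset.range n, (1 / 2 : ℝ) ^ i ≤ 2 := sum_geometric_two_le n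
    have h4 := mul_le_mul_of_nonneg_left h3 (by positivity : 0 ≤ 12 * w)
    have h5 : (n : ℝ) * (4 * (δ * w)) ≤ 4 * w := by nlinarith
    linarith
  have hpath : ∀ a ∈ A, ∀ k ≤ n, HasPath E (rep n (ρ n a)) (node (n - k) (ρ (n - k) a))
      (xc e (node (n - k) (ρ (n - k) a)) - xc e (rep n (ρ n a)) +
        δ ^ 2 * w * (2 * (1 / 2) ^ (n - k) - (1 / 2) ^ n)) := by
    intro a ha k
    induction k with
    | zero =>
      intro _
      refine (HasPath.of_mem (hleaf_mem a ha)).mono subset_rfl ?_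
      rw [norm_sub_rev]
      have hx := hleafx a ha
      have hv := hleafv a ha
      refine norm_le_xc_add he _ (c := δ ^ 2 * w * (1 / 2) ^ n) (by positivity)
        (by rw [hx]; positivity) ?_ (by rw [xc_sub, Nat.sub_zero]; ring)
      rw [hx]
      have h1 := sq_le_sq' (by linarith [abs_le.1 hv]) (abs_le.1 hv).2
      have e1 : ((1 / 4 : ℝ) ^ n) ^ 2 = (1 / 2) ^ n * (1 / 8) ^ n := by
        rw [← pow_mul, mul_comm n 2, pow_mul, ← mul_pow]; norm_num
      have e2 : (δ * w * (1 / 4 : ℝ) ^ n) ^ 2 =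
        δ ^ 2 * w * (1 / 2) ^ n * (w * (1 / 8) ^ n) := by rw [mul_pow, e1]; ring
      have : 0 < δ ^ 2 * w * (1 / 2) ^ n * (w * (1 / 8) ^ n) := by positivity
      linarith
    | succ k ih =>
      intro hk
      obtain ⟨i, hi⟩ : ∃ i, n - (k + 1) = i := ⟨_, rfl⟩
      have hi' : n - k = i + 1 := by omega
      have h1 := ih (by omega)
      rw [hi'] at h1
      rw [hi]
      refine (h1.trans (HasPath.of_mem (hlevel_mem i (by omega) a ha))).mono subset_rfl ?_
      have hx := hedgex i a ha
      have hv := hedgev i a ha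
      have hpos : 0 < w * (1 / 8 : ℝ) ^ i := by positivity
      have h2 : ‖node i (ρ i a) - node (i + 1) (ρ (i + 1) a)‖ ≤
          xc e (node i (ρ i a) - node (i + 1) (ρ (i + 1) a)) + δ ^ 2 * w * (1 / 2) ^ i := by
        refine norm_le_xc_add he _ (c := δ ^ 2 * w * (1 / 2) ^ i) (by positivity)
          (by linarith) ?_ rfl
        have h1 := sq_le_sq' (by linarith [abs_le.1 hv]) (abs_le.1 hv).2
        have e1 : ((1 / 4 : ℝ) ^ i) ^ 2 = (1 / 2) ^ i * (1 / 8) ^ i := by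
          rw [← pow_mul, mul_comm i 2, pow_mul, ← mul_pow]; norm_num
        have e2 : (δ * w * (1 / 4 : ℝ) ^ i) ^ 2 =
          δ ^ 2 * w * (1 / 2) ^ i * (w * (1 / 8) ^ i) := by rw [mul_pow, e1]; ring
        have h3 : 0 < δ ^ 2 * w * (1 / 2 : ℝ) ^ i := by positivity
        have h4 := mul_le_mul_of_nonneg_left hx.1 h3.le
        have h5 : 0 < δ ^ 2 * w * (1 / 2) ^ i * (w * (1 / 8) ^ i) := by positivity
        linarith
      rw [norm_sub_rev]
      rw [xc_sub] at h2
      have h3 : (1 / 2 : ℝ) ^ (i + 1) = (1 / 2) ^ i / 2 := by rw [pow_succ]; ring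
      rw [h3]
      linarith
  obtain ⟨a₀, ha₀⟩ := hA
  have hρ0 : ∀ a ∈ F, ρ 0 a = 0 := fun a ha => by have := hρlt 0 a ha; omega
  obtain ⟨hr1, -, -⟩ := hrep 0 0 ⟨a₀, ha₀, hρ0 _ (hAF ha₀)⟩
  have hr2 := hFx _ (hAF hr1)
  refine ⟨node 0 0, E, hwE, ?_, ?_, ?_, ?_, ?_⟩
  · rw [hnx]; norm_num; linarith
  · rw [hnx]; norm_num; linarith
  · rw [hnv]; norm_num; linarith
  · rw [hnv]; norm_num; linarith
  intro s hs
  obtain ⟨a, ha, hsa, hdv⟩ := hdom s hs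
  obtain ⟨hz, hzρ, hzmax⟩ := hrep n _ ⟨a, ha, rfl⟩
  refine ⟨rep n (ρ n a), hAF hz, ?_, ?_⟩
  · have h1 : ‖a - s‖ ≤ xc e a - xc e s + δ ^ 2 * w := by
      refine norm_le_xc_add he _ (c := δ ^ 2 * w) (by positivity) (by rw [xc_sub]; linarith) ?_
        (by rw [xc_sub])
      rw [xc_sub, vc_sub]
      set X := xc e a - xc e s
      have hX0 : 0 ≤ X := sub_nonneg.2 hsa
      have hXw : X ≤ w := by
        have := (hFx a (hAF ha)).2; have := (hFx s hs).1; simp only [X]; linarith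
      set V := vc e a - vc e s
      have h2 : (V ^ 2) ^ 3 ≤ (δ ^ 2 * w * X) ^ 3 := by
        have h3 := pow_le_pow_left₀ (by positivity) hdv 2
        have h4 : (|V| ^ 3) ^ 2 = (V ^ 2) ^ 3 := by rw [← pow_mul, ← sq_abs V, ← pow_mul]
        rw [h4] at h3
        refine h3.trans ?_
        have h5 : δ ^ 6 * w ^ 2 * X ^ 3 * X ≤ δ ^ 6 * w ^ 2 * X ^ 3 * w :=
          mul_le_mul_of_nonneg_left hXw (by positivity)
        nlinarith
      have h3 : V ^ 2 ≤ δ ^ 2 * w * X := le_of_pow_le_pow_left₀ (by norm_num) (by positivity) h2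
      have : 0 ≤ δ ^ 2 * w * X := by positivity
      linarith
    have h2 : ‖rep n (ρ n a) - a‖ ≤ xc e (rep n (ρ n a)) - xc e a + 4 * δ ^ 2 * w := by
      refine (norm_le_abs_add he _).trans ?_
      have h3 := hzmax a ha rfl
      rw [xc_sub, abs_of_nonneg (by linarith)]
      have h4 : |vc e (rep n (ρ n a) - a)| ≤ δ * w * (1 / 4) ^ n := by
        have h5 := hρ n _ (hAF hz)
        have h6 := hρ n _ (hAF ha)
        rw [hzρ] at h5
        rw [vc_sub, abs_le]
        constructor <;> nlinarith
      have h5 : (1 / 2 : ℝ) ^ n ≤ 2 * δ := by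
        rw [pow_succ, div_lt_iff₀ hδ] at hn2
        rw [one_div, inv_pow]
        rw [inv_le_iff_one_le_mul₀ (by positivity)]
        linarith
      have h6 : (1 / 4 : ℝ) ^ n ≤ 4 * δ ^ 2 := by
        have : (1 / 4 : ℝ) ^ n = ((1 / 2) ^ n) ^ 2 := by
          rw [← pow_mul, mul_comm, pow_mul]; norm_num
        rw [this]
        calc ((1 / 2 : ℝ) ^ n) ^ 2 ≤ (2 * δ) ^ 2 := pow_le_pow_left₀ (by positivity) h5 2
          _ = _ := by ring
      have h7 : δ * w * (1 / 4) ^ n ≤ 1 * w * (4 * δ ^ 2) := by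
        apply mul_le_mul _ h6 (by positivity) (by positivity)
        exact mul_le_mul_of_nonneg_right hδ1 hw.le
      linarith
    have h3 := norm_sub_le_norm_sub_add_norm_sub s a (rep n (ρ n a))
    have h4 := norm_sub_rev s a
    have h5 := norm_sub_rev a (rep n (ρ n a))
    linarith
  · have h := hpath a ha n le_rfl
    rw [Nat.sub_self, hρ0 a (hAF ha)] at h
    refine h.mono subset_rfl ?_
    have h1 : (0 : ℝ) < (1 / 2) ^ n := by positivity
    have h2 : 0 < δ ^ 2 * w := by positivity
    have h3 := mul_pos h2 h1
    norm_num only [pow_zero]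
    linarith

set_option maxHeartbeats 400000 in
/-- Two half gadgets joined by a segment: all points of `F` are connected to all points of `F'`
through good pairs. -/
lemma exists_gadget {e : Plane} (he : ‖e‖ = 1) {δ d x₀ v₀ x₁ v₁ R : ℝ} (hδ : 0 < δ) (hδ1 : δ ≤ 1)
    (hd : 0 < d) (hR : 1 ≤ R) {F F' : Finset Plane}
    (hFx : ∀ a ∈ F, x₀ ≤ xc e a ∧ xc e a < x₀ + d)
    (hFv : ∀ a ∈ F, v₀ ≤ vc e a ∧ vc e a < v₀ + δ * d)
    (hFx' : ∀ a ∈ F', x₁ ≤ xc e a ∧ xc e a < x₁ + d)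
    (hFv' : ∀ a ∈ F', v₁ ≤ vc e a ∧ vc e a < v₁ + δ * d)
    (hx : 14 * d ≤ x₁ - x₀) (hxR : x₁ - x₀ ≤ R * d) (hv : |v₁ - v₀| ≤ R * (δ * d)) :
    ∃ E : Finset (Plane × Plane), gweight E ≤ (200 + 2 * R) * d ∧
      ∀ s ∈ F, ∀ t ∈ F', ∃ z ∈ F, ∃ z' ∈ F', 13 * d ≤ ‖z - z'‖ ∧
        HasPath E z z' ((1 + 5 * R ^ 2 * δ ^ 2) * ‖z - z'‖) ∧
        ‖s - z‖ + ‖z - z'‖ + ‖z' - t‖ ≤ ‖s - t‖ + 20 * R ^ 2 * δ ^ 2 * d := by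
  have hδd : 0 < δ * d := by positivity
  obtain ⟨h, E₁, hE₁, hh1, hh2, hh3, hh4, hz⟩ := exists_half_gadget he hδ hδ1 hd hFx hFv
  obtain ⟨h', E₂, hE₂, hh1', hh2', hh3', hh4', hz'⟩ :=
    exists_half_gadget (e := -e) (by rw [norm_neg, he]) (x₀ := -x₁ - d) (v₀ := -v₁ - δ * d)
      (F := F') hδ hδ1 (mul_pos two_pos hd)
      (fun a ha => by rw [xc_neg_left]; have := hFx' a ha; constructor <;> linarith)
      (fun a ha => by rw [vc_neg_left]; have := hFv' a ha; constructor <;> linarith)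
  simp only [xc_neg_left, vc_neg_left] at hh1' hh2' hh3' hh4' hz'
  rw [abs_le] at hv
  have hR2 : R ≤ R ^ 2 := by nlinarith
  have hRδd : R * (δ * d) ≥ δ * d := by nlinarith
  -- the segment between the hubs
  have hgx : xc e (h' - h) = xc e h' - xc e h := xc_sub _ _ _
  have hgv : vc e (h' - h) = vc e h' - vc e h := vc_sub _ _ _
  have hgap : 6 * d ≤ xc e (h' - h) := by linarith
  have hgv' : |vc e (h' - h)| ≤ 4 * R * (δ * d) := by
    rw [hgv, abs_le]; constructor <;> linarith
  have hghub : ‖h - h'‖ ≤ xc e h' - xc e h + 2 * R ^ 2 * δ ^ 2 * d := by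
    rw [norm_sub_rev, ← hgx]
    refine norm_le_xc_add he _ (c := 2 * R ^ 2 * δ ^ 2 * d) (by positivity) (by linarith) ?_ rfl
    calc vc e (h' - h) ^ 2 = |vc e (h' - h)| ^ 2 := (sq_abs _).symm
      _ ≤ (4 * R * (δ * d)) ^ 2 := pow_le_pow_left₀ (abs_nonneg _) hgv' 2
      _ ≤ 2 * (2 * R ^ 2 * δ ^ 2 * d) * (6 * d) := by
        have : 0 ≤ R ^ 2 * δ ^ 2 * d ^ 2 := by positivity
        nlinarith
      _ ≤ _ := mul_le_mul_of_nonneg_left hgap (by positivity)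
  have hδ2 : δ ^ 2 ≤ 1 := pow_le_one₀ hδ.le hδ1
  refine ⟨insert (h, h') (E₁ ∪ E₂), ?_, ?_⟩
  · have h1 := gweight_insert_le (h, h') (E₁ ∪ E₂)
    have h2 := gweight_union_le E₁ E₂
    have h3 := norm_le_abs_add he (h' - h)
    rw [abs_of_nonneg (by linarith : 0 ≤ xc e (h' - h)), norm_sub_rev] at h3
    have h4 : δ * d ≤ d := by nlinarith
    have h5 : vc e (h' - h) ≤ R * (δ * d) + 3 * (δ * d) := by rw [hgv]; linarith
    have h5' : |vc e (h' - h)| ≤ R * (δ * d) + 3 * (δ * d) := by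
      rw [hgv, abs_le]; constructor <;> linarith
    have h6 : R * (δ * d) ≤ R * d := mul_le_mul_of_nonneg_left h4 (by linarith)
    simp only at h1
    have : xc e (h' - h) ≤ R * d := by linarith
    linarith
  · intro s hs t ht
    obtain ⟨z, hzF, hsz, hzh⟩ := hz s hs
    obtain ⟨z', hzF', htz, hzh'⟩ := hz' t ht
    have b1 := hFx s hs
    have b2 := hFx z hzF
    have b3 := hFx' t ht
    have b4 := hFx' z' hzF'
    have b5 := hFv z hzF
    have b6 := hFv' z' hzF'
    have hzx : xc e (z' - z) = xc e z' - xc e z := xc_sub _ _ _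
    have hn : xc e z' - xc e z ≤ ‖z - z'‖ := by
      rw [norm_sub_rev, ← hzx]; exact xc_le_norm he _
    have hP : 0 ≤ R ^ 2 * δ ^ 2 * d := by positivity
    have hQ : δ ^ 2 * d ≤ R ^ 2 * δ ^ 2 * d := by
      have : 1 ≤ R ^ 2 := by nlinarith
      have h0 : 0 ≤ δ ^ 2 * d := by positivity
      nlinarith
    have h13 : 13 * d ≤ ‖z - z'‖ := by linarith
    refine ⟨z, hzF, z', hzF', h13, ?_, ?_⟩
    · have hE1 : E₁ ⊆ insert (h, h') (E₁ ∪ E₂) :=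
        Finset.subset_union_left.trans (Finset.subset_insert _ _)
      have hE2 : E₂ ⊆ insert (h, h') (E₁ ∪ E₂) :=
        Finset.subset_union_right.trans (Finset.subset_insert _ _)
      have p1 := hzh.mono hE1 le_rfl
      have p2 : HasPath (insert (h, h') (E₁ ∪ E₂)) h h' ‖h - h'‖ :=
        HasPath.of_mem (Finset.mem_insert_self _ _)
      have p3 := (hzh'.mono hE2 le_rfl).symm
      refine ((p1.trans p2).trans p3).mono subset_rfl ?_
      have : 0 ≤ R ^ 2 * δ ^ 2 := by positivity
      have h14 := mul_le_mul_of_nonneg_left h13 this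
      have h15 : (1 + 5 * R ^ 2 * δ ^ 2) * ‖z - z'‖ =
        ‖z - z'‖ + 5 * (R ^ 2 * δ ^ 2 * ‖z - z'‖) := by ring
      rw [h15]
      linarith
    · have hzz : ‖z - z'‖ ≤ xc e z' - xc e z + R ^ 2 * δ ^ 2 * d := by
        rw [norm_sub_rev, ← hzx]
        refine norm_le_xc_add he _ (c := R ^ 2 * δ ^ 2 * d) (by positivity) (by linarith) ?_ rfl
        have hzv : |vc e (z' - z)| ≤ 2 * R * (δ * d) := by
          rw [vc_sub, abs_le]; constructor <;> linarith
        calc vc e (z' - z) ^ 2 = |vc e (z' - z)| ^ 2 := (sq_abs _).symm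
          _ ≤ (2 * R * (δ * d)) ^ 2 := pow_le_pow_left₀ (abs_nonneg _) hzv 2
          _ ≤ 2 * (R ^ 2 * δ ^ 2 * d) * (13 * d) := by
            have : 0 ≤ R ^ 2 * δ ^ 2 * d ^ 2 := by positivity
            nlinarith
          _ ≤ _ := mul_le_mul_of_nonneg_left (by linarith) (by positivity)
      have hst : xc e t - xc e s ≤ ‖s - t‖ := by
        rw [norm_sub_rev, ← xc_sub]; exact xc_le_norm he _
      rw [norm_sub_rev z' t]
      linarith

lemma exists_round_slope {κ d D σ₁ L : ℝ} {q : ℕ} (hκ : 0 < κ) (hd : 0 < d) (hD0 : D ≠ 0)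
    (hD2 : |D| ≤ L * d) (hq0 : (0 : ℝ) < q) (hq : 32 * L / κ ≤ q) (θ : ℝ) :
    ∃ n : ℤ, |(σ₁ - n / q) * D - θ * (κ * d)| ≤ κ * d / 32 := by
  refine ⟨round ((σ₁ - θ * (κ * d) / D) * q), ?_⟩
  have h1 := abs_sub_round ((σ₁ - θ * (κ * d) / D) * q)
  set n := round ((σ₁ - θ * (κ * d) / D) * q)
  have h2 : (σ₁ - n / q) * D - θ * (κ * d) =
      ((σ₁ - θ * (κ * d) / D) * q - n) * (D / q) := by
    field_simp
    ring
  rw [h2, abs_mul, abs_div, abs_of_pos hq0]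
  have h3 : |D| / q ≤ κ * d / 32 := by
    rw [div_le_iff₀ hq0]
    rw [div_le_iff₀ hκ] at hq
    have := mul_le_mul_of_nonneg_right hq hd.le
    linarith
  have h4 : 0 ≤ |D| / q := by positivity
  have h5 := mul_le_mul_of_nonneg_right h1 h4
  linarith

lemma slope_close {κ d D σ₁ σ θ L : ℝ} (hκ : 0 < κ) (hκ1 : κ ≤ 1) (hd : 0 < d) (hD1 : d / 2 ≤ |D|)
    (hσ : |σ₁| ≤ L) (hθ1 : 1 / 4 ≤ θ) (hθ2 : θ ≤ 1 / 2)
    (h : |(σ₁ - σ) * D - θ * (κ * d)| ≤ κ * d / 32) :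
    |σ₁ - σ| ≤ 17 / 16 * κ ∧ |σ| ≤ L + 3 := by
  have hκd : 0 < κ * d := by positivity
  have h1 : |σ₁ - σ| * |D| ≤ 17 / 32 * (κ * d) := by
    rw [← abs_mul]
    have h5 := mul_le_mul_of_nonneg_right hθ1 hκd.le
    have h6 := mul_le_mul_of_nonneg_right hθ2 hκd.le
    rw [abs_le] at h ⊢
    constructor <;> linarith
  have h2 : |σ₁ - σ| ≤ 17 / 16 * κ := by
    by_contra hcon
    push Not at hcon
    have h4 : 17 / 16 * κ * (d / 2) < |σ₁ - σ| * |D| :=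
      lt_of_lt_of_le (mul_lt_mul_of_pos_right hcon (by positivity))
        (mul_le_mul_of_nonneg_left hD1 (abs_nonneg _))
    linarith
  refine ⟨h2, ?_⟩
  have h3 : |σ| ≤ |σ₁| + |σ₁ - σ| := by
    have := abs_sub σ₁ (σ₁ - σ)
    rwa [sub_sub_cancel] at this
  linarith

lemma transversal_of_two_slopes {L κ c d D σ₁ wx wu s₁ s₂ : ℝ} (hL : 1 ≤ L) (hκ : 0 < κ)
    (hκ1 : κ ≤ 1) (hd : 0 < d) (hD2 : |D| ≤ L * d) (h7 : c * (1024 * L * (L + 3)) = κ)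
    (hc0 : 0 < c)
    (hw : |wx| = d / 8 ∨ |wu| = d / 8)
    (h1 : |(σ₁ - s₁) * D - 1 / 4 * (κ * d)| ≤ κ * d / 32)
    (h2 : |(σ₁ - s₂) * D - 1 / 2 * (κ * d)| ≤ κ * d / 32)
    (hn1 : |s₁| ≤ L + 3) (hW1 : |wu - s₁ * wx| < c * d) (hW2 : |wu - s₂ * wx| < c * d) : False := by
  have hκd : 0 < κ * d := by positivity
  have h3 : |s₁ - s₂| * |D| ≥ 3 / 16 * (κ * d) := by
    rw [← abs_mul]
    refine le_trans ?_ (le_abs_self _)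
    rw [abs_le] at h1 h2
    linarith [h1.1, h1.2, h2.1, h2.2]
  have h4 : |s₁ - s₂| * |wx| ≤ 2 * (c * d) := by
    rw [← abs_mul]
    rw [abs_lt] at hW1 hW2
    rw [abs_le]
    constructor <;> linarith [hW1.1, hW1.2, hW2.1, hW2.2]
  have h5 : 3 / 16 * κ ≤ |s₁ - s₂| * L := by
    have := mul_le_mul_of_nonneg_left hD2 (abs_nonneg (s₁ - s₂))
    have : 3 / 16 * κ * d ≤ |s₁ - s₂| * L * d := by linarith
    exact le_of_mul_le_mul_right this hd
  have h6 : 3 / 16 * κ * |wx| ≤ 2 * (c * d) * L := by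
    have h8 := mul_le_mul_of_nonneg_right h5 (abs_nonneg wx)
    have h9 := mul_le_mul_of_nonneg_right h4 (by linarith : 0 ≤ L)
    linarith
  have h8 : κ * (3 / 16 * (|wx| * (L + 3))) ≤ κ * (d / 512) := by
    have h9 := mul_le_mul_of_nonneg_right h6 (by linarith : 0 ≤ L + 3)
    have h10 : 2 * (c * d) * L * (L + 3) = κ * (d / 512) := by
      rw [← h7]; ring
    linarith
  have h9 : |wx| * (L + 3) ≤ d / 96 := by
    have := le_of_mul_le_mul_left h8 hκ
    linarith
  have h10 : |wx| ≤ d / 96 := by nlinarith [abs_nonneg wx]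
  have hcκ : c ≤ 1 / 1024 := by
    have : 1024 * c ≤ c * (1024 * L * (L + 3)) := by
      have : 1024 * 1 ≤ 1024 * L * (L + 3) := by nlinarith
      have := mul_le_mul_of_nonneg_left this hc0.le
      linarith
    linarith
  rcases hw with hw | hw
  · linarith
  · have h11 : |wu| ≤ |wu - s₁ * wx| + |s₁ * wx| := by
      have := abs_add_le (wu - s₁ * wx) (s₁ * wx)
      rwa [sub_add_cancel] at this
    rw [abs_mul] at h11
    have h12 : |s₁| * |wx| ≤ (L + 3) * |wx| :=
      mul_le_mul_of_nonneg_right hn1 (abs_nonneg _)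
    have h13 : c * d ≤ 1 / 1024 * d := mul_le_mul_of_nonneg_right hcκ hd.le
    linarith

lemma exists_common_offsets_of_pos {L κ : ℝ} (hL : 1 ≤ L) (hκ : 0 < κ) (hκ1 : κ ≤ 1) :
    ∃ q : ℕ, 0 < q ∧ ∃ c : ℝ, 0 < c ∧ ∀ d D σ₁ vx vu wx wu : ℝ, 0 < d → d / 2 ≤ |D| →
      |D| ≤ L * d → |σ₁| ≤ L → |vx| ≤ d / 8 → |wx| ≤ d / 8 →
      (|wx| = d / 8 ∨ |wu| = d / 8) → κ * d ≤ vu - σ₁ * vx →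
      ∃ n : ℤ, |(n / q : ℝ)| ≤ L + 3 ∧ ∃ o₁ o₂ : ℝ, c * d ≤ o₂ - o₁ ∧
        Set.Icc o₁ o₂ ⊆ Set.uIcc 0 (vu - n / q * vx) ∧
        Set.Icc o₁ o₂ ⊆ Set.uIcc ((σ₁ - n / q) * D) ((σ₁ - n / q) * D + (wu - n / q * wx)) := by
  obtain ⟨q, hq⟩ := exists_nat_ge (32 * L / κ)
  have hq0 : (0 : ℝ) < q := lt_of_lt_of_le (by positivity) hq
  obtain ⟨c, hc⟩ : ∃ c, c = κ / (1024 * L * (L + 3)) := ⟨_, rfl⟩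
  have hc0 : 0 < c := by rw [hc]; positivity
  have hcκ : c ≤ κ / 1024 := by
    rw [hc]
    apply div_le_div_of_nonneg_left hκ.le (by norm_num)
    nlinarith
  have h7 : c * (1024 * L * (L + 3)) = κ := by
    rw [hc]; field_simp
  refine ⟨q, by exact_mod_cast hq0, c, hc0, ?_⟩
  intro d D σ₁ vx vu wx wu hd hD1 hD2 hσ hvx hwx hw hV
  have hDpos : 0 < |D| := by linarith
  have hD0 : D ≠ 0 := abs_pos.1 hDpos
  have hκd : 0 < κ * d := by positivity
  have hround := exists_round_slope (σ₁ := σ₁) hκ hd hD0 hD2 hq0 hq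
  obtain ⟨n, θ, hθ1, hθ2, hn, hW⟩ : ∃ n : ℤ, ∃ θ : ℝ, 1 / 4 ≤ θ ∧ θ ≤ 1 / 2 ∧
      |(σ₁ - n / q) * D - θ * (κ * d)| ≤ κ * d / 32 ∧ c * d ≤ |wu - n / q * wx| := by
    obtain ⟨n₁, h1⟩ := hround (1 / 4)
    obtain ⟨n₂, h2⟩ := hround (1 / 2)
    by_contra hcon
    push Not at hcon
    have hW1 := hcon n₁ (1 / 4) le_rfl (by norm_num) h1
    have hW2 := hcon n₂ (1 / 2) (by norm_num) le_rfl h2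
    exact transversal_of_two_slopes hL hκ hκ1 hd hD2 h7 hc0 hw h1 h2
      (slope_close hκ hκ1 hd hD1 hσ le_rfl (by norm_num) h1).2 hW1 hW2
  obtain ⟨hg, hnL⟩ := slope_close hκ hκ1 hd hD1 hσ hθ1 hθ2 hn
  refine ⟨n, hnL, ?_⟩
  generalize (n / q : ℝ) = σ at *
  obtain ⟨G, hG⟩ : ∃ G, G = (σ₁ - σ) * D := ⟨_, rfl⟩
  rw [← hG] at hn ⊢
  rw [abs_le] at hn
  have h5 := mul_le_mul_of_nonneg_right hθ1 hκd.le
  have h6 := mul_le_mul_of_nonneg_right hθ2 hκd.le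
  have hG1 : 7 / 32 * (κ * d) ≤ G := by linarith [hn.1]
  have hG2 : G ≤ 17 / 32 * (κ * d) := by linarith [hn.2]
  have hV' : 111 / 128 * (κ * d) ≤ vu - σ * vx := by
    have h1 : |(σ₁ - σ) * vx| ≤ 17 / 16 * κ * (d / 8) := by
      rw [abs_mul]; exact mul_le_mul hg hvx (abs_nonneg _) (by positivity)
    rw [abs_le] at h1
    linarith [h1.1, h1.2]
  have hcd : c * d ≤ κ * d / 1024 := by
    have := mul_le_mul_of_nonneg_right hcκ hd.le
    linarith
  have hcd0 : 0 < c * d := by positivity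
  rw [Set.uIcc_of_le (by linarith : (0 : ℝ) ≤ vu - σ * vx)]
  rcases le_or_gt 0 (wu - σ * wx) with hpos | hneg
  · rw [abs_of_nonneg hpos] at hW
    refine ⟨G, G + c * d, by linarith, Set.Icc_subset_Icc (by linarith) (by linarith), ?_⟩
    rw [Set.uIcc_of_le (by linarith)]
    exact Set.Icc_subset_Icc le_rfl (by linarith)
  · rw [abs_of_neg hneg] at hW
    refine ⟨G - c * d, G, by linarith, Set.Icc_subset_Icc (by linarith) (by linarith), ?_⟩
    rw [Set.uIcc_of_ge (by linarith)]
    exact Set.Icc_subset_Icc (by linarith) le_rfl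

lemma exists_common_offsets {L κ : ℝ} (hL : 1 ≤ L) (hκ : 0 < κ) (hκ1 : κ ≤ 1) :
    ∃ q : ℕ, 0 < q ∧ ∃ c : ℝ, 0 < c ∧ ∀ d D σ₁ vx vu wx wu : ℝ, 0 < d → d / 2 ≤ |D| →
      |D| ≤ L * d → |σ₁| ≤ L → |vx| ≤ d / 8 → |wx| ≤ d / 8 →
      (|wx| = d / 8 ∨ |wu| = d / 8) → κ * d ≤ |vu - σ₁ * vx| →
      ∃ n : ℤ, |(n / q : ℝ)| ≤ L + 3 ∧ ∃ o₁ o₂ : ℝ, c * d ≤ o₂ - o₁ ∧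
        Set.Icc o₁ o₂ ⊆ Set.uIcc 0 (vu - n / q * vx) ∧
        Set.Icc o₁ o₂ ⊆ Set.uIcc ((σ₁ - n / q) * D) ((σ₁ - n / q) * D + (wu - n / q * wx)) := by
  obtain ⟨q, hq, c, hc, H⟩ := exists_common_offsets_of_pos hL hκ hκ1
  refine ⟨q, hq, c, hc, ?_⟩
  intro d D σ₁ vx vu wx wu hd hD1 hD2 hσ hvx hwx hw hV
  rcases le_abs.1 hV with hV | hV
  · exact H d D σ₁ vx vu wx wu hd hD1 hD2 hσ hvx hwx hw hV
  · obtain ⟨n, hn, o₁, o₂, ho, h1, h2⟩ := H d (-D) σ₁ (-vx) (-vu) (-wx) (-wu) hd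
      (by rwa [abs_neg]) (by rwa [abs_neg]) hσ (by rwa [abs_neg]) (by rwa [abs_neg])
      (by rwa [abs_neg, abs_neg]) (by linarith)
    refine ⟨n, hn, -o₂, -o₁, by linarith, ?_, ?_⟩
    · intro o ho
      have := h1 (⟨by linarith [ho.2], by linarith [ho.1]⟩ : -o ∈ Set.Icc o₁ o₂)
      rw [Set.mem_uIcc] at this ⊢
      rcases this with h | h
      · right; constructor <;> linarith [h.1, h.2]
      · left; constructor <;> linarith [h.1, h.2]
    · intro o ho
      have := h2 (⟨by linarith [ho.2], by linarith [ho.1]⟩ : -o ∈ Set.Icc o₁ o₂)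
      rw [Set.mem_uIcc] at this ⊢
      rcases this with h | h
      · right; constructor <;> linarith [h.1, h.2]
      · left; constructor <;> linarith [h.1, h.2]

lemma exists_first_hit {f : ℝ → ℝ} (hf : Continuous f) {a b ρ : ℝ} (hab : a ≤ b) (h0 : f a ≤ ρ)
    (h1 : ρ ≤ f b) : ∃ τ ∈ Set.Icc a b, f τ = ρ ∧ ∀ t ∈ Set.Icc a τ, f t ≤ ρ := by
  have hne : (Set.Icc a b ∩ f ⁻¹' {ρ}).Nonempty := by
    obtain ⟨t, ht, h⟩ := intermediate_value_Icc hab hf.continuousOn ⟨h0, h1⟩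
    exact ⟨t, ht, h⟩
  obtain ⟨τ, ⟨hτ, hfτ⟩, hleast⟩ :=
    (isCompact_Icc.inter_right (isClosed_singleton.preimage hf)).exists_isLeast hne
  refine ⟨τ, hτ, hfτ, fun t ht => ?_⟩
  by_contra hcon
  push Not at hcon
  obtain ⟨t', ht', h⟩ := intermediate_value_Icc ht.1 hf.continuousOn ⟨h0, hcon.le⟩
  have h2 : τ ≤ t' := hleast ⟨⟨ht'.1, ht'.2.trans (ht.2.trans hτ.2)⟩, h⟩
  have h3 : t' = t := le_antisymm ht'.2 (ht.2.trans h2)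
  rw [h3] at h
  linarith

/-- Any two points of `Γ` are joined by a curve in `Γ`. -/
def CurveConnected (Γ : Set Plane) : Prop :=
  ∀ p ∈ Γ, ∀ q ∈ Γ, ∃ γ : ℝ → Plane, Continuous γ ∧ γ 0 = p ∧ γ 1 = q ∧ ∀ x, γ x ∈ Γ

lemma CurveConnected.exists_strand {Γ : Set Plane} (hΓ : CurveConnected Γ) {X U : Plane → ℝ}
    (hX : Continuous X) (hU : Continuous U) {p q : Plane} (hp : p ∈ Γ) (hq : q ∈ Γ) {ρ : ℝ}
    (hρ : 0 ≤ ρ) (h : ρ ≤ |X q - X p|) :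
    ∃ K ⊆ Γ, IsPreconnected K ∧ p ∈ K ∧ ∃ p' ∈ K,
      (∀ y ∈ K, |X y - X p| ≤ ρ ∧ |U y - U p| ≤ ρ) ∧ (|X p' - X p| = ρ ∨ |U p' - U p| = ρ) := by
  obtain ⟨γ, hγ, h0, h1, hmem⟩ := hΓ p hp q hq
  obtain ⟨τ, hτ, hf, hle⟩ := exists_first_hit
    (f := fun t => max |X (γ t) - X p| |U (γ t) - U p|) (by fun_prop) (ρ := ρ)
    zero_le_one (by simp [h0, hρ]) (by rw [h1]; exact h.trans (le_max_left _ _))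
  refine ⟨γ '' Set.Icc 0 τ, by rintro _ ⟨t, -, rfl⟩; exact hmem t,
    isPreconnected_Icc.image _ hγ.continuousOn, ⟨0, ⟨le_rfl, hτ.1⟩, h0⟩, γ τ,
    ⟨τ, ⟨hτ.1, le_rfl⟩, rfl⟩, ?_, ?_⟩
  · rintro _ ⟨t, ht, rfl⟩
    exact max_le_iff.1 (hle t ht)
  · rcases max_choice |X (γ τ) - X p| |U (γ τ) - U p| with h | h
    · left; rw [← hf, h]
    · right; rw [← hf, h]

/-- In the coordinates `X, U`, a whole interval of lines of slope `n / q`, of size comparable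
to `d`, meets `Γ` in two points at distance comparable to `d`, within distance `R * d` of `m`. -/
def DoublyHit (Γ : Set Plane) (X U : Plane → ℝ) (q : ℕ) (c R d : ℝ) (m : Plane) : Prop :=
  ∃ n : ℤ, |(n / q : ℝ)| ≤ R ∧ ∃ o₁ o₂ : ℝ, c * d ≤ o₂ - o₁ ∧ ∀ o ∈ Set.Icc o₁ o₂,
    ∃ h₁ ∈ Γ, ∃ h₂ ∈ Γ, U h₁ - n / q * X h₁ = o ∧ U h₂ - n / q * X h₂ = o ∧
      d / 4 ≤ X h₂ - X h₁ ∧ X h₂ - X h₁ ≤ R * d ∧ |X h₁ - X m| ≤ R * d ∧ |U h₁ - U m| ≤ R * d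

lemma IsPreconnected.exists_eq {K : Set Plane} (hK : IsPreconnected K) {f : Plane → ℝ}
    (hf : Continuous f) {a b : Plane} (ha : a ∈ K) (hb : b ∈ K) {o : ℝ}
    (ho : o ∈ Set.uIcc (f a) (f b)) : ∃ y ∈ K, f y = o :=
  (hK.image f hf.continuousOn).ordConnected.uIcc_subset ⟨a, ha, rfl⟩ ⟨b, hb, rfl⟩ ho

lemma exists_doublyHit_of_strands {L κ : ℝ} (hL : 1 ≤ L) (hκ : 0 < κ) (hκ1 : κ ≤ 1) :
    ∃ q : ℕ, 0 < q ∧ ∃ c : ℝ, 0 < c ∧ ∀ (Γ : Set Plane) (X U : Plane → ℝ), Continuous X →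
      Continuous U → ∀ (d : ℝ) (m : Plane), 0 < d → ∀ K₁ ⊆ Γ, ∀ K₂ ⊆ Γ, IsPreconnected K₁ →
      IsPreconnected K₂ → ∀ r₁ ∈ K₁, ∀ r₁' ∈ K₁, ∀ r₂ ∈ K₂, ∀ r₂' ∈ K₂,
      (∀ y ∈ K₁, |X y - X r₁| ≤ d / 8 ∧ |U y - U r₁| ≤ d / 8) →
      (∀ y ∈ K₂, |X y - X r₂| ≤ d / 8 ∧ |U y - U r₂| ≤ d / 8) →
      (|X r₂' - X r₂| = d / 8 ∨ |U r₂' - U r₂| = d / 8) →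
      d / 2 ≤ |X r₂ - X r₁| → |X r₂ - X r₁| ≤ L * d →
      ∀ σ₁ : ℝ, |σ₁| ≤ L → U r₂ - U r₁ = σ₁ * (X r₂ - X r₁) →
      κ * d ≤ |(U r₁' - U r₁) - σ₁ * (X r₁' - X r₁)| →
      |X r₁ - X m| ≤ L * d → |U r₁ - U m| ≤ L * d →
      DoublyHit Γ X U q c (L ^ 2 + 2 * L + 3) d m := by
  obtain ⟨q, hq, c, hc, H⟩ := exists_common_offsets hL hκ hκ1
  refine ⟨q, hq, c, hc, ?_⟩
  intro Γ X U hX hU d m hd K₁ hK₁ K₂ hK₂ hc₁ hc₂ r₁ hr₁ r₁' hr₁' r₂ hr₂ r₂' hr₂' hb₁ hb₂ hfull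
    hD1 hD2 σ₁ hσ hσ₁ htr hmX hmU
  obtain ⟨n, hn, o₁, o₂, ho, h1, h2⟩ := H d (X r₂ - X r₁) σ₁ (X r₁' - X r₁) (U r₁' - U r₁)
    (X r₂' - X r₂) (U r₂' - U r₂) hd hD1 hD2 hσ (hb₁ _ hr₁').1 (hb₂ _ hr₂').1 hfull htr
  refine ⟨n, by nlinarith, ?_⟩
  generalize (n / q : ℝ) = σ at *
  have hf : Continuous fun y => U y - σ * X y := by fun_prop
  refine ⟨U r₁ - σ * X r₁ + o₁, U r₁ - σ * X r₁ + o₂, by linarith, fun o hoI => ?_⟩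
  have hoI' : o - (U r₁ - σ * X r₁) ∈ Set.Icc o₁ o₂ :=
    ⟨by linarith [hoI.1], by linarith [hoI.2]⟩
  obtain ⟨y₁, hy₁, ho₁⟩ := hc₁.exists_eq hf hr₁ hr₁' (o := o) (by
    have := h1 hoI'
    rw [Set.mem_uIcc] at this ⊢
    rcases this with h | h
    · left; constructor <;> linarith [h.1, h.2]
    · right; constructor <;> linarith [h.1, h.2])
  obtain ⟨y₂, hy₂, ho₂⟩ := hc₂.exists_eq hf hr₂ hr₂' (o := o) (by
    have := h2 hoI'
    rw [Set.mem_uIcc] at this ⊢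
    rcases this with h | h
    · left; constructor <;> linarith [h.1, h.2]
    · right; constructor <;> linarith [h.1, h.2])
  have b₁ := hb₁ _ hy₁
  have b₂ := hb₂ _ hy₂
  have hU2 : |U r₂ - U r₁| ≤ L * (L * d) := by
    rw [hσ₁, abs_mul]
    exact mul_le_mul hσ hD2 (abs_nonneg _) (by linarith)
  have hLd : d ≤ L * d := by nlinarith
  have hLd2 : 0 ≤ L * (L * d) := by positivity
  simp only [abs_le] at b₁ b₂ hU2 hmX hmU
  obtain ⟨⟨_, _⟩, _, _⟩ := b₁
  obtain ⟨⟨_, _⟩, _, _⟩ := b₂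
  obtain ⟨_, _⟩ := hU2
  obtain ⟨_, _⟩ := hmX
  obtain ⟨_, _⟩ := hmU
  rw [abs_le] at hD2
  obtain ⟨_, _⟩ := hD2
  have hR : (L ^ 2 + 2 * L + 3) * d = L * (L * d) + 2 * (L * d) + 3 * d := by ring
  rcases le_abs.1 hD1 with hD | hD
  · refine ⟨y₁, hK₁ hy₁, y₂, hK₂ hy₂, ho₁, ho₂, by linarith, by linarith, ?_, ?_⟩ <;>
    · rw [abs_le]; constructor <;> linarith
  · refine ⟨y₂, hK₂ hy₂, y₁, hK₁ hy₁, ho₂, ho₁, by linarith, by linarith, ?_, ?_⟩ <;>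
    · rw [abs_le]; constructor <;> linarith

lemma exists_doublyHit_of_not_collinear {L κ : ℝ} (hL : 1 ≤ L) (hκ : 0 < κ) (hκ1 : κ ≤ 1) :
    ∃ q : ℕ, 0 < q ∧ ∃ c : ℝ, 0 < c ∧ ∃ R : ℝ, 1 ≤ R ∧ ∀ (Γ : Set Plane) (X U : Plane → ℝ),
      CurveConnected Γ → Continuous X → Continuous U →
      ∀ (d : ℝ) (m : Plane), 0 < d → ∀ s ∈ Γ, ∀ t ∈ Γ, ∀ p ∈ Γ,
      d ≤ X t - X s → X t - X s ≤ L * d → |U t - U s| ≤ X t - X s →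
      |X p - X s| ≤ L * d → |U p - U s| ≤ L * d → |X s - X m| ≤ L * d → |U s - U m| ≤ L * d →
      ∀ σ₁ : ℝ, U t - U s = σ₁ * (X t - X s) →
      κ * d ≤ |(U p - U s) - σ₁ * (X p - X s)| → DoublyHit Γ X U q c R d m := by
  obtain ⟨κ', hκ'⟩ : ∃ κ', κ' = κ / (64 * L) := ⟨_, rfl⟩
  have hκ'0 : 0 < κ' := by rw [hκ']; positivity
  have hκ'L : κ' * (64 * L) = κ := by rw [hκ']; field_simp
  have hκ'1 : κ' ≤ 1 / 64 := by nlinarith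
  obtain ⟨q, hq, c, hc, H⟩ := exists_doublyHit_of_strands (L := 4 * L) (by linarith) hκ'0
    (by linarith)
  refine ⟨q, hq, c, hc, (4 * L) ^ 2 + 2 * (4 * L) + 3, by nlinarith, ?_⟩
  intro Γ X U hΓ hX hU d m hd s hs t ht p hp hst1 hst2 hUst hpX hpU hmX hmU σ₁ hσ₁ htr
  have hD0 : 0 < X t - X s := by linarith
  have hLd : d ≤ L * d := by nlinarith
  have hσ : |σ₁| ≤ 1 := by
    rw [hσ₁, abs_mul, abs_of_pos hD0] at hUst
    exact le_of_mul_le_mul_right (by linarith) hD0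
  obtain ⟨Ks, hKs, hcs, hsK, s', hs', hbs, hfs⟩ := hΓ.exists_strand hX hU hs ht (ρ := d / 8)
    (by positivity) (by rw [abs_of_pos hD0]; linarith)
  obtain ⟨Kt, hKt, hct, htK, t', ht', hbt, hft⟩ := hΓ.exists_strand hX hU ht hs (ρ := d / 8)
    (by positivity) (by rw [abs_sub_comm, abs_of_pos hD0]; linarith)
  rw [abs_le] at hpX hpU hmX hmU hUst
  obtain ⟨_, _⟩ := hpX
  obtain ⟨_, _⟩ := hpU
  obtain ⟨_, _⟩ := hmX
  obtain ⟨_, _⟩ := hmU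
  obtain ⟨_, _⟩ := hUst
  by_cases hts : κ' * d ≤ |(U s' - U s) - σ₁ * (X s' - X s)|
  · refine H Γ X U hX hU d m hd Ks hKs Kt hKt hcs hct s hsK s' hs' t htK t' ht' hbs hbt hft
      ?_ ?_ σ₁ (by linarith) hσ₁ hts ?_ ?_
    · rw [abs_of_pos hD0]; linarith
    · rw [abs_of_pos hD0]; linarith
    · rw [abs_le]; constructor <;> linarith
    · rw [abs_le]; constructor <;> linarith
  by_cases htt : κ' * d ≤ |(U t' - U t) - σ₁ * (X t' - X t)|
  · refine H Γ X U hX hU d m hd Kt hKt Ks hKs hct hcs t htK t' ht' s hsK s' hs' hbt hbs hfs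
      ?_ ?_ σ₁ (by linarith) (by linarith) htt ?_ ?_
    · rw [abs_sub_comm, abs_of_pos hD0]; linarith
    · rw [abs_sub_comm, abs_of_pos hD0]; linarith
    · rw [abs_le]; constructor <;> linarith
    · rw [abs_le]; constructor <;> linarith
  push Not at hts htt
  have key : ∀ r ∈ Γ, ∀ K ⊆ Γ, IsPreconnected K → r ∈ K → ∀ r' ∈ K,
      (∀ y ∈ K, |X y - X r| ≤ d / 8 ∧ |U y - U r| ≤ d / 8) →
      (|X r' - X r| = d / 8 ∨ |U r' - U r| = d / 8) →
      |(U r' - U r) - σ₁ * (X r' - X r)| < κ' * d → d / 2 ≤ |X p - X r| →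
      |X p - X r| ≤ 2 * (L * d) → |U p - U r| ≤ 2 * (L * d) →
      κ * d ≤ |(U p - U r) - σ₁ * (X p - X r)| →
      |X r - X m| ≤ 4 * L * d → |U r - U m| ≤ 4 * L * d →
      DoublyHit Γ X U q c ((4 * L) ^ 2 + 2 * (4 * L) + 3) d m := by
    intro r hr K hK hcK hrK r' hr' hbr hfr hlt hD1 hD2 hU2 hw hmX hmU
    obtain ⟨Kp, hKp, hcp, hpK, p', hp', hbp, hfp⟩ := hΓ.exists_strand hX hU hp hr (ρ := d / 8)
      (by positivity) (by rw [abs_sub_comm]; linarith)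
    have hDpos : 0 < |X p - X r| := by linarith
    have hD0 : X p - X r ≠ 0 := abs_pos.1 hDpos
    have hvx : d / 16 ≤ |X r' - X r| := by
      rcases hfr with h | h
      · linarith
      · have h1 : |U r' - U r| ≤ |(U r' - U r) - σ₁ * (X r' - X r)| + |σ₁ * (X r' - X r)| := by
          have := abs_add_le ((U r' - U r) - σ₁ * (X r' - X r)) (σ₁ * (X r' - X r))
          rwa [sub_add_cancel] at this
        rw [abs_mul] at h1
        have h2 := mul_le_mul_of_nonneg_right hσ (abs_nonneg (X r' - X r))
        have h3 := mul_le_mul_of_nonneg_right hκ'1 hd.le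
        linarith
    refine H Γ X U hX hU d m hd K hK Kp hKp hcK hcp r hrK r' hr' p hpK p' hp' hbr hbp hfp
      hD1 (by linarith) ((U p - U r) / (X p - X r)) ?_ (by field_simp) ?_ hmX hmU
    · rw [abs_div, div_le_iff₀ hDpos]
      have := mul_le_mul_of_nonneg_left hD1 (by linarith : 0 ≤ 4 * L)
      linarith
    · set τ := (U p - U r) / (X p - X r) with hτ
      have h1 : (U p - U r) - σ₁ * (X p - X r) = (τ - σ₁) * (X p - X r) := by
        rw [hτ]; field_simp
      rw [h1, abs_mul] at hw
      have h2 : κ ≤ |τ - σ₁| * (2 * L) := by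
        have := mul_le_mul_of_nonneg_left hD2 (abs_nonneg (τ - σ₁))
        exact le_of_mul_le_mul_right (by linarith) hd
      have h3 : 32 * κ' ≤ |τ - σ₁| := by
        have : 32 * κ' * (2 * L) ≤ |τ - σ₁| * (2 * L) := by linarith
        exact le_of_mul_le_mul_right this (by linarith)
      have h4 : |(τ - σ₁) * (X r' - X r)| ≤ |U r' - U r - τ * (X r' - X r)| +
          |U r' - U r - σ₁ * (X r' - X r)| := by
        have := abs_sub (U r' - U r - σ₁ * (X r' - X r)) (U r' - U r - τ * (X r' - X r))
        rw [show U r' - U r - σ₁ * (X r' - X r) - (U r' - U r - τ * (X r' - X r)) =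
          (τ - σ₁) * (X r' - X r) by ring] at this
        linarith
      rw [abs_mul] at h4
      have h5 := mul_le_mul h3 hvx (by positivity) (abs_nonneg _)
      linarith
  rcases le_or_gt (d / 2) |X p - X s| with h | h
  · refine key s hs Ks hKs hcs hsK s' hs' hbs hfs hts h ?_ ?_ htr ?_ ?_ <;>
    · rw [abs_le]; constructor <;> linarith
  · rw [abs_lt] at h
    refine key t ht Kt hKt hct htK t' ht' hbt hft htt ?_ ?_ ?_ ?_ ?_ ?_
    · rw [abs_sub_comm]; exact le_trans (by linarith) (le_abs_self _)
    · rw [abs_le]; constructor <;> linarith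
    · rw [abs_le]; constructor <;> linarith
    · convert htr using 2; linarith
    · rw [abs_le]; constructor <;> linarith
    · rw [abs_le]; constructor <;> linarith

lemma xc_rot {e : Plane} (he : ‖e‖ = 1) (f v : Plane) :
    xc f v = xc e f * xc e v + vc e f * vc e v := by
  have h := plane_norm_sq e
  rw [he] at h
  simp only [xc, vc]
  linear_combination (f 0 * v 0 + f 1 * v 1) * h

lemma vc_rot {e : Plane} (he : ‖e‖ = 1) (f v : Plane) :
    vc f v = xc e f * vc e v - vc e f * xc e v := by
  have h := plane_norm_sq e
  rw [he] at h
  simp only [xc, vc]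
  linear_combination (f 0 * v 1 - f 1 * v 0) * h

lemma xc_comm (e f : Plane) : xc e f = xc f e := by simp only [xc]; ring

lemma vc_comm (e f : Plane) : vc e f = - vc f e := by simp only [vc]; ring

lemma Finset.card_le_of_abs_sub_le {s : Finset ℤ} {y A : ℝ} (hA : 0 ≤ A)
    (h : ∀ i ∈ s, |(i : ℝ) - y| ≤ A) : (s.card : ℝ) ≤ 2 * A + 1 := by
  have hsub : s ⊆ Finset.Icc ⌈y - A⌉ ⌊y + A⌋ := by
    intro i hi
    have := abs_le.1 (h i hi)
    rw [Finset.mem_Icc]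
    exact ⟨Int.ceil_le.2 (by linarith), Int.le_floor.2 (by linarith)⟩
  have h1 := Finset.card_le_card hsub
  rw [Int.card_Icc] at h1
  have h2 : (s.card : ℝ) ≤ ((⌊y + A⌋ + 1 - ⌈y - A⌉).toNat : ℝ) := by exact_mod_cast h1
  have h3 : ((⌊y + A⌋ + 1 - ⌈y - A⌉).toNat : ℝ) ≤ 2 * A + 1 := by
    rcases le_or_gt 0 (⌊y + A⌋ + 1 - ⌈y - A⌉) with h0 | h0
    · have : ((⌊y + A⌋ + 1 - ⌈y - A⌉).toNat : ℝ) = ((⌊y + A⌋ + 1 - ⌈y - A⌉ : ℤ) : ℝ) := by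
        exact_mod_cast congrArg (Int.cast : ℤ → ℝ) (Int.toNat_of_nonneg h0)
      rw [this]
      push_cast
      linarith [Int.floor_le (y + A), Int.le_ceil (y - A)]
    · rw [Int.toNat_of_nonpos h0.le]
      simp; linarith
  linarith

/-- The unit vector in the direction of `v`. -/
def unit (v : Plane) : Plane := ‖v‖⁻¹ • v

lemma norm_unit {v : Plane} (hv : v ≠ 0) : ‖unit v‖ = 1 := by
  rw [unit, norm_smul, norm_inv, norm_norm, inv_mul_cancel₀ (norm_ne_zero_iff.2 hv)]

lemma xc_unit (v w : Plane) : xc (unit v) w = ‖v‖⁻¹ * xc v w := by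
  simp only [xc, unit, PiLp.smul_apply, smul_eq_mul]; ring

lemma vc_unit (v w : Plane) : vc (unit v) w = ‖v‖⁻¹ * vc v w := by
  simp only [vc, unit, PiLp.smul_apply, smul_eq_mul]; ring

lemma xc_unit_self {v : Plane} (hv : v ≠ 0) : xc (unit v) v = ‖v‖ := by
  have h := plane_norm_sq v
  have h0 := norm_ne_zero_iff.2 hv
  rw [xc_unit, xc, show v 0 * v 0 + v 1 * v 1 = ‖v‖ ^ 2 by rw [h]; ring]
  field_simp

lemma vc_unit_self (v : Plane) : vc (unit v) v = 0 := by
  rw [vc_unit, vc]; ring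

/-- The grid direction of type `t` with index `i`. -/
def gridDir (δ : ℝ) (t : Bool × Bool) (i : ℤ) : Plane :=
  (if t.1 then (1 : ℝ) else -1) • (if t.2 then pt 1 (i * δ / 2) else pt (i * δ / 2) 1)

/-- A grid of unit vectors that is roughly `δ`-dense. -/
def frames (δ : ℝ) : Finset Plane :=
  ((Finset.univ : Finset (Bool × Bool)) ×ˢ Finset.Icc (-(⌈2 / δ⌉ + 1)) (⌈2 / δ⌉ + 1)).image
    fun x => unit (gridDir δ x.1 x.2)

lemma norm_sq_gridDir (δ : ℝ) (t : Bool × Bool) (i : ℤ) :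
    ‖gridDir δ t i‖ ^ 2 = 1 + (i * δ / 2) ^ 2 := by
  rw [plane_norm_sq, gridDir]
  rcases t with ⟨_ | _, _ | _⟩ <;> simp <;> ring

lemma gridDir_ne_zero (δ : ℝ) (t : Bool × Bool) (i : ℤ) : gridDir δ t i ≠ 0 := by
  intro h
  have := norm_sq_gridDir δ t i
  rw [h, norm_zero] at this
  nlinarith [sq_nonneg (i * δ / 2)]

lemma norm_of_mem_frames {δ : ℝ} {φ : Plane} (h : φ ∈ frames δ) : ‖φ‖ = 1 := by
  obtain ⟨x, -, rfl⟩ := Finset.mem_image.1 h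
  exact norm_unit (gridDir_ne_zero _ _ _)

lemma card_frames_le {δ : ℝ} (hδ : 0 < δ) (hδ1 : δ ≤ 1) : ((frames δ).card : ℝ) ≤ 40 / δ := by
  have h1 : ((frames δ).card : ℝ) ≤
      ((Finset.univ : Finset (Bool × Bool)).card * (Finset.Icc (-(⌈2 / δ⌉ + 1)) (⌈2 / δ⌉ + 1)).card : ℕ) := by
    rw [← Finset.card_product]
    exact_mod_cast Finset.card_image_le
  have h2 := Finset.card_le_of_abs_sub_le (s := Finset.Icc (-(⌈2 / δ⌉ + 1)) (⌈2 / δ⌉ + 1)) (y := 0)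
    (A := 2 / δ + 2) (by positivity) (by
      intro i hi
      rw [Finset.mem_Icc] at hi
      have h3 : (i : ℝ) ≤ ⌈2 / δ⌉ + 1 := by exact_mod_cast hi.2
      have h4 : -((⌈2 / δ⌉ : ℝ) + 1) ≤ i := by exact_mod_cast hi.1
      have h5 := Int.ceil_lt_add_one (2 / δ)
      rw [abs_le]; constructor <;> linarith)
  have h3 : (Finset.univ : Finset (Bool × Bool)).card = 4 := rfl
  rw [h3] at h1
  push_cast at h1
  have h4 : 1 ≤ 1 / δ := by rw [le_div_iff₀ hδ]; linarith
  have h5 : 2 / δ = 2 * (1 / δ) := by ring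
  have h6 : 40 / δ = 40 * (1 / δ) := by ring
  linarith

lemma exists_frame {δ : ℝ} (hδ : 0 < δ) (hδ1 : δ ≤ 1) {v : Plane} (hv : v ≠ 0) :
    ∃ φ ∈ frames δ, 0 < xc φ v ∧ |vc φ v| ≤ δ * xc φ v := by
  suffices H : ∃ t : Bool × Bool, ∃ i : ℤ, |(i : ℝ)| ≤ 2 / δ + 1 ∧
      0 < xc (gridDir δ t i) v ∧ |vc (gridDir δ t i) v| ≤ δ * xc (gridDir δ t i) v by
    obtain ⟨t, i, hi, h1, h2⟩ := H
    have hn : 0 < ‖gridDir δ t i‖⁻¹ := by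
      have := gridDir_ne_zero δ t i
      positivity
    refine ⟨unit (gridDir δ t i), Finset.mem_image.2 ⟨(t, i), ?_, rfl⟩, ?_, ?_⟩
    · rw [Finset.mem_product, Finset.mem_Icc]
      have := Int.le_ceil (2 / δ)
      rw [abs_le] at hi
      refine ⟨Finset.mem_univ _, ?_, ?_⟩
      · have : -((⌈2 / δ⌉ : ℝ) + 1) ≤ i := by linarith
        exact_mod_cast this
      · have : (i : ℝ) ≤ ⌈2 / δ⌉ + 1 := by linarith
        exact_mod_cast this
    · rw [xc_unit]; positivity
    · rw [xc_unit, vc_unit, abs_mul, abs_of_pos hn]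
      have := mul_le_mul_of_nonneg_left h2 hn.le
      linarith
  have key : ∀ a b : ℝ, 0 < a → |b| ≤ a → ∃ i : ℤ, |(i : ℝ)| ≤ 2 / δ + 1 ∧
      0 < a + i * δ / 2 * b ∧ |b - i * δ / 2 * a| ≤ δ * (a + i * δ / 2 * b) := by
    intro a b ha hb
    obtain ⟨σ, hσ⟩ : ∃ σ, σ = b / a := ⟨_, rfl⟩
    have hbσ : b = σ * a := by rw [hσ]; field_simp
    have hσ1 : |σ| ≤ 1 := by rw [hσ, abs_div, abs_of_pos ha, div_le_one ha]; exact hb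
    obtain ⟨hσl, hσu⟩ := abs_le.1 hσ1
    have h1 := Int.floor_le (2 * σ / δ)
    have h2 := Int.lt_floor_add_one (2 * σ / δ)
    set i := ⌊2 * σ / δ⌋
    rw [le_div_iff₀ hδ] at h1
    rw [div_lt_iff₀ hδ] at h2
    obtain ⟨ρ, hρ⟩ : ∃ ρ, ρ = σ - i * δ / 2 := ⟨_, rfl⟩
    have hρ0 : 0 ≤ ρ := by linarith
    have hρ1 : ρ ≤ δ / 2 := by linarith
    have hi : (i : ℝ) * δ / 2 = σ - ρ := by linarith
    have hhalf : 1 / 2 ≤ 1 + (σ - ρ) * σ := by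
      have : ρ * σ ≤ 1 / 2 := by nlinarith
      nlinarith [sq_nonneg σ]
    refine ⟨i, ?_, ?_, ?_⟩
    · rw [show 2 / δ + 1 = (2 + δ) / δ by field_simp, le_div_iff₀ hδ]
      rw [show |(i : ℝ)| * δ = |(i : ℝ) * δ| by rw [abs_mul, abs_of_pos hδ], abs_le]
      constructor <;> linarith
    · rw [hi, hbσ]; nlinarith
    · rw [hi, hbσ, show σ * a - (σ - ρ) * a = ρ * a by ring, abs_of_nonneg (by positivity)]
      have : δ * (1 / 2) * a ≤ δ * (1 + (σ - ρ) * σ) * a := by gcongr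
      nlinarith
  rcases le_or_gt |v 1| |v 0| with h | h
  · have h0 : v 0 ≠ 0 := by
      intro h0
      rw [h0, abs_zero] at h
      have h1 := abs_nonpos_iff.1 h
      apply hv; ext j; fin_cases j <;> simp [h0, h1]
    rcases lt_or_gt_of_ne h0 with hneg | hpos
    · obtain ⟨i, hi, h1, h2⟩ := key (-v 0) (-v 1) (by linarith) (by rwa [abs_neg, ← abs_of_neg hneg])
      refine ⟨(false, true), i, hi, ?_, ?_⟩
      · simp [gridDir, xc]; linarith
      · simp [gridDir, xc, vc]
        convert h2 using 2 <;> ring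
    · obtain ⟨i, hi, h1, h2⟩ := key (v 0) (v 1) hpos (by rwa [← abs_of_pos hpos])
      refine ⟨(true, true), i, hi, ?_, ?_⟩
      · simp [gridDir, xc]; linarith
      · simp [gridDir, xc, vc]
        convert h2 using 2
  · have h0 : v 1 ≠ 0 := by
      intro h0
      rw [h0, abs_zero] at h
      linarith [abs_nonneg (v 0)]
    rcases lt_or_gt_of_ne h0 with hneg | hpos
    · obtain ⟨i, hi, h1, h2⟩ := key (-v 1) (-v 0) (by linarith)
        (by rw [abs_neg, ← abs_of_neg hneg]; exact h.le)
      refine ⟨(false, false), i, hi, ?_, ?_⟩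
      · simp [gridDir, xc]; linarith
      · simp [gridDir, xc, vc]
        rw [← abs_neg]
        convert h2 using 2 <;> ring
    · obtain ⟨i, hi, h1, h2⟩ := key (v 1) (v 0) hpos (by rw [← abs_of_pos hpos]; exact h.le)
      refine ⟨(true, false), i, hi, ?_, ?_⟩
      · simp [gridDir, xc]; linarith
      · simp [gridDir, xc, vc]
        rw [← abs_neg]
        convert h2 using 2 <;> ring

lemma card_frames_near_le {δ A : ℝ} (hδ : 0 < δ) (hδ1 : δ ≤ 1) (hA : 0 ≤ A) (hAδ : A * δ ≤ 1 / 8)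
    {e : Plane} (he : ‖e‖ = 1) :
    (((frames δ).filter fun φ => |vc φ e| ≤ A * δ).card : ℝ) ≤ 4 * (48 * A + 1) := by
  set I := Finset.Icc (-(⌈2 / δ⌉ + 1)) (⌈2 / δ⌉ + 1) with hI
  have hsub : ((frames δ).filter fun φ => |vc φ e| ≤ A * δ) ⊆
      (Finset.univ : Finset (Bool × Bool)).biUnion fun t =>
        (I.filter fun i => |vc (unit (gridDir δ t i)) e| ≤ A * δ).image
          fun i => unit (gridDir δ t i) := by
    intro φ hφ
    rw [Finset.mem_filter] at hφ
    obtain ⟨x, hx, rfl⟩ := Finset.mem_image.1 hφ.1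
    rw [Finset.mem_product] at hx
    exact Finset.mem_biUnion.2 ⟨x.1, Finset.mem_univ _, Finset.mem_image.2
      ⟨x.2, Finset.mem_filter.2 ⟨hx.2, hφ.2⟩, rfl⟩⟩
  have hsq := plane_norm_sq e
  rw [he] at hsq
  have hi2 : ∀ i ∈ I, |(i : ℝ) * δ / 2| ≤ 2 := by
    intro i hi
    rw [hI, Finset.mem_Icc] at hi
    have h3 : (i : ℝ) ≤ ⌈2 / δ⌉ + 1 := by exact_mod_cast hi.2
    have h4 : -((⌈2 / δ⌉ : ℝ) + 1) ≤ i := by exact_mod_cast hi.1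
    have h5 := Int.ceil_lt_add_one (2 / δ)
    have h6 : |(i : ℝ)| ≤ 2 / δ + 2 := by rw [abs_le]; constructor <;> linarith
    have h7 := mul_le_mul_of_nonneg_right h6 hδ.le
    have h8 : (2 / δ + 2) * δ = 2 + 2 * δ := by field_simp
    rw [show (i : ℝ) * δ / 2 = i * (δ / 2) by ring, abs_mul, abs_of_pos (by positivity : 0 < δ / 2)]
    linarith
  have key : ∀ a b : ℝ, a ^ 2 + b ^ 2 = 1 → ∀ i ∈ I,
      |b - i * δ / 2 * a| ≤ 3 * (A * δ) → |(i : ℝ) - 2 * b / (a * δ)| ≤ 24 * A := by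
    intro a b hab i hi h
    have hi2 := hi2 i hi
    have ha : 1 / 4 ≤ |a| := by
      by_contra hcon
      push Not at hcon
      have h1 : |b| ≤ |b - i * δ / 2 * a| + |i * δ / 2 * a| := by
        have := abs_add_le (b - i * δ / 2 * a) (i * δ / 2 * a)
        rwa [sub_add_cancel] at this
      rw [abs_mul] at h1
      have h2 : |(i : ℝ) * δ / 2| * |a| ≤ 2 * (1 / 4) :=
        mul_le_mul hi2 hcon.le (abs_nonneg _) (by norm_num)
      have h3 : |b| ≤ 7 / 8 := by linarith
      rw [← sq_abs a, ← sq_abs b] at hab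
      nlinarith [abs_nonneg a, abs_nonneg b]
    have ha0 : a ≠ 0 := by rintro rfl; norm_num at ha
    have h1 : (i : ℝ) - 2 * b / (a * δ) = -((b - i * δ / 2 * a) * (2 / (a * δ))) := by
      field_simp; ring
    rw [h1, abs_neg, abs_mul, abs_div, abs_mul, abs_of_pos hδ, abs_two]
    have h2 : 2 / (|a| * δ) ≤ 8 / δ := by
      rw [div_le_div_iff₀ (by positivity) hδ]
      nlinarith
    calc |b - i * δ / 2 * a| * (2 / (|a| * δ)) ≤ 3 * (A * δ) * (8 / δ) :=
          mul_le_mul h h2 (by positivity) (by positivity)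
      _ = 24 * A := by field_simp; ring
  have hcard : ∀ t : Bool × Bool, ((I.filter fun i => |vc (unit (gridDir δ t i)) e| ≤ A * δ).card : ℝ)
      ≤ 48 * A + 1 := by
    intro t
    have hb : ∀ i ∈ I, |vc (unit (gridDir δ t i)) e| ≤ A * δ →
        |vc (gridDir δ t i) e| ≤ 3 * (A * δ) := by
      intro i hi h
      have hn : 0 < ‖gridDir δ t i‖ := norm_pos_iff.2 (gridDir_ne_zero _ _ _)
      have hn3 : ‖gridDir δ t i‖ ≤ 3 := by
        have h1 := norm_sq_gridDir δ t i
        have h2 := hi2 i hi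
        rw [← sq_abs ((i : ℝ) * δ / 2)] at h1
        nlinarith [abs_nonneg ((i : ℝ) * δ / 2)]
      rw [vc_unit, abs_mul, abs_inv, abs_norm, inv_mul_le_iff₀ hn] at h
      have := mul_le_mul_of_nonneg_right hn3 (by positivity : 0 ≤ A * δ)
      linarith
    have h0 : (24 : ℝ) * A * 2 = 48 * A := by ring
    rw [← h0, mul_comm _ (2 : ℝ)]
    rcases t with ⟨t₁, _ | _⟩
    · refine Finset.card_le_of_abs_sub_le (y := 2 * e 0 / (e 1 * δ)) (by positivity) fun i hi => ?_
      rw [Finset.mem_filter] at hi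
      refine key (e 1) (e 0) (by linarith) i hi.1 ?_
      have := hb i hi.1 hi.2
      cases t₁
      · simp only [gridDir, vc] at this
        simp at this
        convert this using 2; ring
      · rw [← abs_neg] at this
        simp only [gridDir, vc] at this
        simp at this
        exact this
    · refine Finset.card_le_of_abs_sub_le (y := 2 * e 1 / (e 0 * δ)) (by positivity) fun i hi => ?_
      rw [Finset.mem_filter] at hi
      refine key (e 0) (e 1) (by linarith) i hi.1 ?_
      have := hb i hi.1 hi.2
      cases t₁
      · simp only [gridDir, vc] at this
        simp at this
        rw [← abs_neg]
        convert this using 2; ring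
      · simp only [gridDir, vc] at this
        simp at this
        convert this using 2
  calc (((frames δ).filter fun φ => |vc φ e| ≤ A * δ).card : ℝ)
      ≤ ((∑ t : Bool × Bool, (I.filter fun i => |vc (unit (gridDir δ t i)) e| ≤ A * δ).card : ℕ) : ℝ) := by
        exact_mod_cast (Finset.card_le_card hsub).trans (Finset.card_biUnion_le.trans
          (Finset.sum_le_sum fun t _ => Finset.card_image_le))
    _ ≤ ∑ t : Bool × Bool, (48 * A + 1) := by
        push_cast
        exact Finset.sum_le_sum fun t _ => hcard t
    _ = 4 * (48 * A + 1) := by simp; ring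

lemma exists_separated_net (A : Finset ℝ) {r : ℝ} (hr : 0 ≤ r) :
    ∃ A' ⊆ A, (∀ x ∈ A', ∀ y ∈ A', x ≠ y → r ≤ |x - y|) ∧ ∀ x ∈ A, ∃ y ∈ A', |x - y| ≤ r := by
  obtain ⟨A', hA', hmax⟩ := (A.powerset.filter
    fun A' => ∀ x ∈ A', ∀ y ∈ A', x ≠ y → r ≤ |x - y|).exists_max_image Finset.card
      ⟨∅, by simp⟩
  rw [Finset.mem_filter, Finset.mem_powerset] at hA'
  refine ⟨A', hA'.1, hA'.2, fun x hx => ?_⟩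
  by_contra hcon
  push Not at hcon
  have hxA : x ∉ A' := fun h => by
    have := hcon x h
    rw [sub_self, abs_zero] at this
    linarith
  have := hmax (insert x A') (by
    rw [Finset.mem_filter, Finset.mem_powerset]
    refine ⟨Finset.insert_subset hx hA'.1, ?_⟩
    intro a ha b hb hab
    rw [Finset.mem_insert] at ha hb
    rcases ha with rfl | ha <;> rcases hb with rfl | hb
    · exact absurd rfl hab
    · exact (hcon b hb).le
    · rw [abs_sub_comm]; exact (hcon a ha).le
    · exact hA'.2 a ha b hb hab)
  rw [Finset.card_insert_of_notMem hxA] at this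
  omega

lemma exists_scale_charge (H : Finset ℝ) {d : ℕ → ℝ} {B R : ℝ} (hd : ∀ k, 0 < d k)
    (hdB : ∀ k, d (k + 1) = B * d k) (hB : 2 ≤ B) (hR : 0 ≤ R) (hBR : 32 * (R + 1) < B ^ 2) (N : ℕ) :
    ∃ A : ℕ → Finset ℝ, (∑ k ∈ Finset.range N, (A k).card ≤ 2 * H.card) ∧
      ∀ k, ∀ x ∈ H, ∀ y ∈ H, d k / 4 ≤ y - x → y - x ≤ R * d k →
        ∃ a ∈ A k, |a - x| ≤ (R + 1) * d k := by
  choose net hnet1 hnet2 hnet3 using fun (A : Finset ℝ) (k : ℕ) =>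
    exists_separated_net A (r := d k / 32) (by have := hd k; positivity)
  let A : ℕ → Finset ℝ := fun k => Nat.rec H (fun k A => net A (k + 1)) k
  have hA0 : A 0 = H := rfl
  have hA1 : ∀ k, A (k + 1) = net (A k) (k + 1) := fun k => rfl
  have hsub : ∀ k, A (k + 1) ⊆ A k := fun k => hnet1 _ _
  have hdist : ∀ k, ∀ x ∈ H, ∃ a ∈ A k, |x - a| ≤ d k / 16 := by
    intro k
    induction k with
    | zero => intro x hx; exact ⟨x, hx, by have := hd 0; simp; linarith⟩
    | succ k ih =>
      intro x hx
      obtain ⟨a, ha, hxa⟩ := ih x hx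
      obtain ⟨b, hb, hab⟩ := hnet3 (A k) (k + 1) a ha
      refine ⟨b, hb, ?_⟩
      have h1 := abs_sub_le x a b
      have h2 := hdB k
      have h3 := hd k
      have h4 : 2 * d k ≤ d (k + 1) := by rw [h2]; nlinarith
      linarith
  refine ⟨fun k => A k \ A (k + 2), ?_, ?_⟩
  · have h1 : ∀ N, ∑ k ∈ Finset.range N, (A k \ A (k + 2)).card + (A N).card + (A (N + 1)).card
        ≤ (A 0).card + (A 1).card := by
      intro N
      induction N with
      | zero => simp
      | succ N ih =>
        rw [Finset.sum_range_succ]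
        have h2 := Finset.card_sdiff_add_card_eq_card ((hsub (N + 1)).trans (hsub N))
        have h3 : A (N + 1 + 1) = A (N + 2) := rfl
        rw [h3] at h2 ⊢
        omega
    have h2 := h1 N
    have h3 := Finset.card_le_card (hsub 0)
    rw [hA0] at h2 h3
    rw [zero_add] at h3
    show ∑ k ∈ Finset.range N, (A k \ A (k + 2)).card ≤ 2 * H.card
    omega
  · intro k x hx y hy h1 h2
    obtain ⟨a, ha, hxa⟩ := hdist k x hx
    obtain ⟨b, hb, hyb⟩ := hdist k y hy
    have hdk := hd k
    rw [abs_le] at hxa hyb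
    have hne : a ≠ b := by rintro rfl; linarith [hxa.1, hxa.2, hyb.1, hyb.2]
    have hRd : 0 ≤ R * d k := by positivity
    have hnot : ¬ (a ∈ A (k + 2) ∧ b ∈ A (k + 2)) := by
      rintro ⟨ha2, hb2⟩
      have h3 := hnet2 (A (k + 1)) (k + 2) a ha2 b hb2 hne
      have h4 : d (k + 2) = B ^ 2 * d k := by rw [hdB (k + 1), hdB k]; ring
      rw [h4] at h3
      have h5 : |a - b| ≤ (R + 1) * d k := by
        rw [abs_le]; constructor <;> linarith [hxa.1, hxa.2, hyb.1, hyb.2]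
      have h6 := mul_lt_mul_of_pos_right hBR hdk
      linarith
    by_cases ha2 : a ∈ A (k + 2)
    · refine ⟨b, Finset.mem_sdiff.2 ⟨hb, fun hb2 => hnot ⟨ha2, hb2⟩⟩, ?_⟩
      rw [abs_le]; constructor <;> linarith [hxa.1, hxa.2, hyb.1, hyb.2]
    · refine ⟨a, Finset.mem_sdiff.2 ⟨ha, ha2⟩, ?_⟩
      rw [abs_le]; constructor <;> linarith [hxa.1, hxa.2]

lemma sum_length_le {ι κ : Type*} (I : Finset ι) (J : Finset κ) (a b : ι → ℝ) (u v : κ → ℝ)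
    (hab : ∀ i ∈ I, a i ≤ b i) (Z : Finset ℝ) (N : ℝ)
    (h : ∀ o ∉ Z, ((I.filter fun i => o ∈ Set.Icc (a i) (b i)).card : ℝ) ≤
      N * (J.filter fun j => o ∈ Set.uIcc (u j) (v j)).card) :
    ∑ i ∈ I, (b i - a i) ≤ N * ∑ j ∈ J, |v j - u j| := by
  have hI : ∀ s t : ℝ, MeasureTheory.Integrable (Set.indicator (Set.Icc s t) (fun _ => (1 : ℝ))) :=
    fun s t => (MeasureTheory.integrable_indicator_iff measurableSet_Icc).2
      (by simp [MeasureTheory.integrableOn_const_iff])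
  have hL : ∀ s t : ℝ, s ≤ t → ∫ o, Set.indicator (Set.Icc s t) (fun _ => (1 : ℝ)) o = t - s := by
    intro s t hst
    rw [MeasureTheory.integral_indicator measurableSet_Icc]
    simp [hst]
  have h1 : ∑ i ∈ I, (b i - a i) =
      ∫ o, ∑ i ∈ I, Set.indicator (Set.Icc (a i) (b i)) (fun _ => (1 : ℝ)) o := by
    rw [MeasureTheory.integral_finsetSum _ fun i _ => hI _ _]
    exact Finset.sum_congr rfl fun i hi => (hL _ _ (hab i hi)).symm
  have h2 : ∑ j ∈ J, |v j - u j| =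
      ∫ o, ∑ j ∈ J, Set.indicator (Set.uIcc (u j) (v j)) (fun _ => (1 : ℝ)) o := by
    simp only [Set.uIcc]
    rw [MeasureTheory.integral_finsetSum _ fun i _ => hI _ _]
    refine Finset.sum_congr rfl fun j _ => ?_
    rw [hL _ _ inf_le_sup, max_sub_min_eq_abs]
  rw [h1, h2, ← MeasureTheory.integral_const_mul]
  refine MeasureTheory.integral_mono_ae (MeasureTheory.integrable_finsetSum _ fun i _ => hI _ _)
    ((MeasureTheory.integrable_finsetSum _ fun i _ => hI _ _).const_mul _) ?_
  have hZ : ∀ᵐ o : ℝ, o ∉ (Z : Set ℝ) :=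
    MeasureTheory.measure_eq_zero_iff_ae_notMem.1 (Z.finite_toSet.measure_zero _)
  filter_upwards [hZ] with o ho
  have := h o ho
  simp only [Set.indicator_apply, Finset.sum_boole]
  exact this

/-- The grid cell containing `m`, for the frame `φ`, cells being `d` long and `δ * d` wide. -/
def cell (δ d : ℝ) (φ m : Plane) : ℤ × ℤ := (⌊xc φ m / d⌋, ⌊vc φ m / (δ * d)⌋)

lemma card_le_of_near {s : Finset (ℤ × ℤ)} {y₁ y₂ A : ℝ} (hA : 0 ≤ A)
    (h : ∀ p ∈ s, |(p.1 : ℝ) - y₁| ≤ A ∧ |(p.2 : ℝ) - y₂| ≤ A) :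
    (s.card : ℝ) ≤ (2 * A + 1) ^ 2 := by
  have h1 : s ⊆ s.image Prod.fst ×ˢ s.image Prod.snd := fun p hp =>
    Finset.mem_product.2 ⟨Finset.mem_image_of_mem _ hp, Finset.mem_image_of_mem _ hp⟩
  have h2 := Finset.card_le_card h1
  rw [Finset.card_product] at h2
  have h3 : ((s.image Prod.fst).card : ℝ) ≤ 2 * A + 1 :=
    Finset.card_le_of_abs_sub_le (y := y₁) hA (by
      intro i hi
      obtain ⟨p, hp, rfl⟩ := Finset.mem_image.1 hi
      exact (h p hp).1)
  have h4 : ((s.image Prod.snd).card : ℝ) ≤ 2 * A + 1 :=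
    Finset.card_le_of_abs_sub_le (y := y₂) hA (by
      intro i hi
      obtain ⟨p, hp, rfl⟩ := Finset.mem_image.1 hi
      exact (h p hp).2)
  calc (s.card : ℝ) ≤ (s.image Prod.fst).card * (s.image Prod.snd).card := by exact_mod_cast h2
    _ ≤ (2 * A + 1) * (2 * A + 1) := mul_le_mul h3 h4 (by positivity) (by positivity)
    _ = _ := by ring

lemma abs_floor_div_sub_le {x y d A : ℝ} (hd : 0 < d) (h : |x - y| ≤ A * d) :
    |(⌊x / d⌋ : ℝ) - y / d| ≤ A + 1 := by
  have h1 := Int.floor_le (x / d)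
  have h2 := Int.lt_floor_add_one (x / d)
  have h3 : |x / d - y / d| ≤ A := by
    rw [← sub_div, abs_div, abs_of_pos hd, div_le_iff₀ hd]; exact h
  rw [abs_le] at h3 ⊢
  constructor <;> linarith [h3.1, h3.2]

/-- The part of `DoublyHit` for lines of slope `σ`. -/
def DoublyHitAt (Γ : Set Plane) (X U : Plane → ℝ) (σ c R d : ℝ) (m : Plane) : Prop :=
  ∃ o₁ o₂ : ℝ, c * d ≤ o₂ - o₁ ∧ ∀ o ∈ Set.Icc o₁ o₂,
    ∃ h₁ ∈ Γ, ∃ h₂ ∈ Γ, U h₁ - σ * X h₁ = o ∧ U h₂ - σ * X h₂ = o ∧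
      d / 4 ≤ X h₂ - X h₁ ∧ X h₂ - X h₁ ≤ R * d ∧ |X h₁ - X m| ≤ R * d ∧ |U h₁ - U m| ≤ R * d

lemma exists_level_set (T : Finset (Plane × Plane)) (φ : Plane) (δ σ : ℝ) {o : ℝ}
    (ho : o ∉ T.image fun e => vc φ e.1 / δ - σ * xc φ e.1) :
    ∃ H : Finset ℝ, H.card ≤ (T.filter fun e => o ∈ Set.uIcc (vc φ e.1 / δ - σ * xc φ e.1)
      (vc φ e.2 / δ - σ * xc φ e.2)).card ∧
      ∀ h ∈ segUnion T, vc φ h / δ - σ * xc φ h = o → xc φ h ∈ H := by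
  let f : Plane → ℝ := fun p => vc φ p / δ - σ * xc φ p
  refine ⟨(T.filter fun e => o ∈ Set.uIcc (f e.1) (f e.2)).image fun e =>
    xc φ e.1 + (o - f e.1) / (f e.2 - f e.1) * (xc φ e.2 - xc φ e.1), Finset.card_image_le, ?_⟩
  intro h hh hf
  obtain ⟨e, he, hhe⟩ := Set.mem_iUnion₂.1 hh
  obtain ⟨a, b, ha, hb, hab, rfl⟩ := hhe
  have hfo : f (a • e.1 + b • e.2) = o := hf
  have hlin : f (a • e.1 + b • e.2) = a * f e.1 + b * f e.2 := by
    simp only [f, xc_add, vc_add, xc_smul, vc_smul]; ring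
  have ha' : a = 1 - b := by linarith
  have hob : o - f e.1 = b * (f e.2 - f e.1) := by rw [← hfo, hlin, ha']; ring
  have hne : f e.2 - f e.1 ≠ 0 := by
    intro h0
    rw [h0, mul_zero] at hob
    exact ho (Finset.mem_image.2 ⟨e, he, by show f e.1 = o; linarith⟩)
  refine Finset.mem_image.2 ⟨e, Finset.mem_filter.2 ⟨he, ?_⟩, ?_⟩
  · rw [Set.mem_uIcc]
    have hb1 : b ≤ 1 := by linarith
    rcases le_total (f e.1) (f e.2) with hle | hle
    · left; constructor <;> nlinarith
    · right; constructor <;> nlinarith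
  · rw [hob, mul_div_cancel_right₀ _ hne, xc_add, xc_smul, xc_smul, ha']; ring

lemma sum_doublyHitAt_le {T : Finset (Plane × Plane)} {φ : Plane} (hφ : ‖φ‖ = 1) {δ σ c R B : ℝ}
    (hδ : 0 < δ) (hδ1 : δ ≤ 1) (hσ : |σ| ≤ R) (hR : 0 ≤ R) (hc : 0 < c) {d : ℕ → ℝ}
    (hd : ∀ k, 0 < d k) (hdB : ∀ k, d (k + 1) = B * d k) (hB : 2 ≤ B) (hBR : 32 * (R + 1) < B ^ 2)
    (N : ℕ) (𝓜 : Finset Plane) :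
    ∑ k ∈ Finset.range N, (((𝓜.filter fun m => DoublyHitAt (segUnion T) (xc φ)
        (fun p => vc φ p / δ) σ c R (d k) m).image (cell δ (d k) φ)).card : ℝ) * d k ≤
      2 * (2 * (R ^ 2 + 2 * R + 2) + 1) ^ 2 * (R + 1) / c / δ * gweight T := by
  let P : ℕ → Finset (ℤ × ℤ) := fun k => (𝓜.filter fun m => DoublyHitAt (segUnion T) (xc φ)
        (fun p => vc φ p / δ) σ c R (d k) m).image (cell δ (d k) φ)
  let f : Plane → ℝ := fun p => vc φ p / δ - σ * xc φ p
  have hP : ∀ k, ∀ p ∈ P k, ∃ m, cell δ (d k) φ m = p ∧ DoublyHitAt (segUnion T) (xc φ)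
        (fun p => vc φ p / δ) σ c R (d k) m := by
    intro k p hp
    obtain ⟨m, hm, rfl⟩ := Finset.mem_image.1 hp
    exact ⟨m, rfl, (Finset.mem_filter.1 hm).2⟩
  have hP' : ∀ (k : ℕ) (p : ℤ × ℤ), ∃ o₁ : ℝ, p ∈ P k → ∃ m, cell δ (d k) φ m = p ∧
      ∀ o ∈ Set.Icc o₁ (o₁ + c * d k), ∃ h₁ ∈ segUnion T, ∃ h₂ ∈ segUnion T,
        f h₁ = o ∧ f h₂ = o ∧ d k / 4 ≤ xc φ h₂ - xc φ h₁ ∧ xc φ h₂ - xc φ h₁ ≤ R * d k ∧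
        |xc φ h₁ - xc φ m| ≤ R * d k ∧ |vc φ h₁ / δ - vc φ m / δ| ≤ R * d k := by
    intro k p
    by_cases hp : p ∈ P k
    · obtain ⟨m, hm, o₁, o₂, ho, h⟩ := hP k p hp
      exact ⟨o₁, fun _ => ⟨m, hm, fun o hoI => h o ⟨hoI.1, hoI.2.trans (by linarith)⟩⟩⟩
    · exact ⟨0, fun h => absurd h hp⟩
  choose o₁ ho₁ using hP'
  let A : ℝ := R ^ 2 + 2 * R + 2
  have hA : 0 ≤ A := by positivity
  have key := sum_length_le ((Finset.range N).sigma P) T (fun i => o₁ i.1 i.2)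
    (fun i => o₁ i.1 i.2 + c * d i.1) (fun e => f e.1) (fun e => f e.2)
    (fun i _ => by have := hd i.1; have : 0 < c * d i.1 := by positivity
                   linarith) (T.image fun e => f e.1) (2 * (2 * A + 1) ^ 2) (by
    intro o ho
    obtain ⟨H, hHcard, hH⟩ := exists_level_set T φ δ σ ho
    obtain ⟨Q, hQsum, hQ⟩ := exists_scale_charge H hd hdB hB hR hBR N
    have hk : ∀ k, (((P k).filter fun p => o ∈ Set.Icc (o₁ k p) (o₁ k p + c * d k)).card : ℝ) ≤
        (2 * A + 1) ^ 2 * (Q k).card := by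
      intro k
      have hdk := hd k
      let near : ℝ → Finset (ℤ × ℤ) := fun a => (P k).filter fun p =>
        |(p.1 : ℝ) - a / d k| ≤ A ∧ |(p.2 : ℝ) - (o + σ * a) / d k| ≤ A
      have hsub : ((P k).filter fun p => o ∈ Set.Icc (o₁ k p) (o₁ k p + c * d k)) ⊆
          (Q k).biUnion near := by
        intro p hp
        rw [Finset.mem_filter] at hp
        obtain ⟨m, hm, hmo⟩ := ho₁ k p hp.1
        obtain ⟨h₁, hh₁, h₂, hh₂, hf₁, hf₂, hx1, hx2, hmX, hmU⟩ := hmo o hp.2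
        obtain ⟨a, ha, hax⟩ := hQ k _ (hH h₁ hh₁ hf₁) _ (hH h₂ hh₂ hf₂) hx1 hx2
        refine Finset.mem_biUnion.2 ⟨a, ha, Finset.mem_filter.2 ⟨hp.1, ?_, ?_⟩⟩
        · rw [← hm]
          refine (abs_floor_div_sub_le (A := 2 * R + 1) hdk ?_).trans ?_
          · rw [abs_le] at hmX hax ⊢
            constructor <;> linarith [hmX.1, hmX.2, hax.1, hax.2]
          · show _ ≤ R ^ 2 + 2 * R + 2
            nlinarith
        · rw [← hm]
          have : vc φ m / (δ * d k) = vc φ m / δ / d k := by rw [div_div]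
          show |(⌊vc φ m / (δ * d k)⌋ : ℝ) - (o + σ * a) / d k| ≤ A
          rw [this]
          refine (abs_floor_div_sub_le (A := R ^ 2 + 2 * R) hdk ?_).trans ?_
          · have hs : |σ * (a - xc φ h₁)| ≤ R * ((R + 1) * d k) := by
              rw [abs_mul]; exact mul_le_mul hσ hax (abs_nonneg _) hR
            have hf₁' : vc φ h₁ / δ - σ * xc φ h₁ = o := hf₁
            rw [abs_le] at hmU hs ⊢
            constructor <;> linarith [hmU.1, hmU.2, hs.1, hs.2]
          · show _ ≤ R ^ 2 + 2 * R + 2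
            linarith
      calc (((P k).filter fun p => o ∈ Set.Icc (o₁ k p) (o₁ k p + c * d k)).card : ℝ)
          ≤ ((∑ a ∈ Q k, (near a).card : ℕ) : ℝ) := by
            exact_mod_cast (Finset.card_le_card hsub).trans Finset.card_biUnion_le
        _ ≤ ∑ a ∈ Q k, (2 * A + 1) ^ 2 := by
            push_cast
            exact Finset.sum_le_sum fun a _ => card_le_of_near hA fun p hp =>
              (Finset.mem_filter.1 hp).2
        _ = (2 * A + 1) ^ 2 * (Q k).card := by
            rw [Finset.sum_const, nsmul_eq_mul, mul_comm]
    have hfilter : (((Finset.range N).sigma P).filter fun i =>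
        o ∈ Set.Icc (o₁ i.1 i.2) (o₁ i.1 i.2 + c * d i.1)) =
        (Finset.range N).sigma fun k => (P k).filter fun p =>
          o ∈ Set.Icc (o₁ k p) (o₁ k p + c * d k) := by
      ext ⟨k, p⟩
      simp only [Finset.mem_filter, Finset.mem_sigma]
      tauto
    rw [hfilter, Finset.card_sigma]
    push_cast
    calc ∑ k ∈ Finset.range N, (((P k).filter fun p =>
          o ∈ Set.Icc (o₁ k p) (o₁ k p + c * d k)).card : ℝ)
        ≤ ∑ k ∈ Finset.range N, (2 * A + 1) ^ 2 * ((Q k).card : ℝ) :=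
          Finset.sum_le_sum fun k _ => hk k
      _ = (2 * A + 1) ^ 2 * ((∑ k ∈ Finset.range N, (Q k).card : ℕ) : ℝ) := by
          push_cast; rw [Finset.mul_sum]
      _ ≤ (2 * A + 1) ^ 2 * (2 * H.card : ℕ) := by
          gcongr
      _ ≤ (2 * A + 1) ^ 2 * (2 * (T.filter fun e => o ∈ Set.uIcc (f e.1) (f e.2)).card : ℕ) := by
          gcongr
      _ = _ := by push_cast; ring)
  have hlhs : ∑ i ∈ (Finset.range N).sigma P, (o₁ i.1 i.2 + c * d i.1 - o₁ i.1 i.2) =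
      c * ∑ k ∈ Finset.range N, ((P k).card : ℝ) * d k := by
    rw [Finset.sum_sigma, Finset.mul_sum]
    refine Finset.sum_congr rfl fun k _ => ?_
    simp only [add_sub_cancel_left, Finset.sum_const, nsmul_eq_mul]
    ring
  have hrhs : ∑ e ∈ T, |f e.2 - f e.1| ≤ (R + 1) / δ * gweight T := by
    rw [gweight, Finset.mul_sum]
    refine Finset.sum_le_sum fun e _ => ?_
    have h1 : f e.2 - f e.1 = vc φ (e.2 - e.1) / δ - σ * xc φ (e.2 - e.1) := by
      simp only [f, vc_sub, xc_sub]; ring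
    rw [h1, norm_sub_rev]
    refine (abs_sub _ _).trans ?_
    rw [abs_div, abs_mul, abs_of_pos hδ]
    have h2 := abs_vc_le hφ (e.2 - e.1)
    have h3 : |σ| * |xc φ (e.2 - e.1)| ≤ R * ‖e.2 - e.1‖ :=
      mul_le_mul hσ (abs_xc_le hφ _) (abs_nonneg _) hR
    have h4 : |vc φ (e.2 - e.1)| / δ ≤ ‖e.2 - e.1‖ / δ := by gcongr
    have h5 : R * ‖e.2 - e.1‖ ≤ R * ‖e.2 - e.1‖ / δ := by
      rw [le_div_iff₀ hδ]
      have : 0 ≤ R * ‖e.2 - e.1‖ := by positivity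
      nlinarith
    have h6 : (R + 1) / δ * ‖e.2 - e.1‖ = ‖e.2 - e.1‖ / δ + R * ‖e.2 - e.1‖ / δ := by ring
    linarith
  rw [hlhs] at key
  have h7 : c * ∑ k ∈ Finset.range N, ((P k).card : ℝ) * d k ≤
      2 * (2 * A + 1) ^ 2 * ((R + 1) / δ * gweight T) :=
    key.trans (mul_le_mul_of_nonneg_left hrhs (by positivity))
  rw [mul_comm, ← le_div_iff₀ hc] at h7
  refine h7.trans (le_of_eq ?_)
  show _ = 2 * (2 * A + 1) ^ 2 * (R + 1) / c / δ * gweight T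
  field_simp

lemma sum_range_le_residues {f : ℕ → ℝ} (hf : ∀ k, 0 ≤ f k) {p : ℕ} (hp : 0 < p) (N : ℕ) :
    ∑ k ∈ Finset.range N, f k ≤
      ∑ r ∈ Finset.range p, ∑ i ∈ Finset.range N, f (r + p * i) := by
  have h1 : ∀ M : ℕ, ∑ k ∈ Finset.range (p * M), f k =
      ∑ r ∈ Finset.range p, ∑ i ∈ Finset.range M, f (r + p * i) := by
    intro M
    rw [Finset.sum_comm]
    induction M with
    | zero => simp
    | succ M ih =>
      rw [Nat.mul_succ, Finset.sum_range_add, ih, Finset.sum_range_succ]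
      simp only [add_comm]
  rw [← h1]
  exact Finset.sum_le_sum_of_subset_of_nonneg
    (Finset.range_mono (Nat.le_mul_of_pos_left N hp)) fun k _ _ => hf k

/-- The pairs of a frame and a cell at scale `d` that contain a point of `𝓜` with property `P`. -/
def items (δ d : ℝ) (𝓜 : Finset Plane) (P : Plane → Plane → Prop) : Finset (Plane × (ℤ × ℤ)) :=
  ((frames δ ×ˢ 𝓜).filter fun x => P x.1 x.2).image fun x => (x.1, cell δ d x.1 x.2)

lemma mem_items {δ d : ℝ} {𝓜 : Finset Plane} {P : Plane → Plane → Prop}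
    {i : Plane × (ℤ × ℤ)} :
    i ∈ items δ d 𝓜 P ↔ ∃ φ ∈ frames δ, ∃ m ∈ 𝓜, P φ m ∧ i = (φ, cell δ d φ m) := by
  simp only [items, Finset.mem_image, Finset.mem_filter, Finset.mem_product, Prod.exists]
  constructor
  · rintro ⟨φ, m, ⟨⟨h1, h2⟩, h3⟩, rfl⟩
    exact ⟨φ, h1, m, h2, h3, rfl⟩
  · rintro ⟨φ, h1, m, h2, h3, rfl⟩
    exact ⟨φ, m, ⟨⟨h1, h2⟩, h3⟩, rfl⟩

lemma sum_doublyHit_le {q : ℕ} (hq : 0 < q) {c R B : ℝ} (hc : 0 < c) (hR : 1 ≤ R) (hB : 2 ≤ B) :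
    ∃ C : ℝ, 0 < C ∧ ∀ (T : Finset (Plane × Plane)) (δ : ℝ), 0 < δ → δ ≤ 1 →
      ∀ d : ℕ → ℝ, (∀ k, 0 < d k) → (∀ k, d (k + 1) = B * d k) → ∀ (N : ℕ) (𝓜 : Finset Plane),
      ∑ k ∈ Finset.range N, ((items δ (d k) 𝓜 fun φ m => DoublyHit (segUnion T) (xc φ)
        (fun p => vc φ p / δ) q c R (d k) m).card : ℝ) * d k ≤ C / δ ^ 2 * gweight T := by
  obtain ⟨p, hp⟩ := pow_unbounded_of_one_lt (32 * (R + 1)) (by linarith : 1 < B)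
  have hBp : 32 * (R + 1) < (B ^ (p + 1)) ^ 2 := by
    have h1 : 1 ≤ B ^ p := one_le_pow₀ (by linarith)
    have h2 : B ^ p ≤ B ^ (p + 1) := pow_le_pow_right₀ (by linarith) (by omega)
    nlinarith
  have hB2 : 2 ≤ B ^ (p + 1) := by
    have h1 : 1 ≤ B ^ p := one_le_pow₀ (by linarith)
    rw [pow_succ]; nlinarith
  let M : ℤ := ⌈R * q⌉
  let J : Finset ℤ := Finset.Icc (-M) M
  let K : ℝ := 2 * (2 * (R ^ 2 + 2 * R + 2) + 1) ^ 2 * (R + 1) / c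
  have hK : 0 < K := by positivity
  have hM : 0 ≤ M := Int.ceil_nonneg (by positivity)
  have hJ : 0 < J.card := Finset.card_pos.2 ⟨0, Finset.mem_Icc.2 ⟨by omega, hM⟩⟩
  refine ⟨40 * J.card * ((p + 1 : ℕ) * K), by positivity, ?_⟩
  intro T δ hδ hδ1 d hd hdB N 𝓜
  have hdp : ∀ r i, d (r + i) = B ^ i * d r := by
    intro r i
    induction i with
    | zero => simp
    | succ i ih => rw [← add_assoc, hdB, ih, pow_succ]; ring
  let J' : Finset ℤ := J.filter fun n => |(n / q : ℝ)| ≤ R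
  let F : Plane → ℤ → ℕ → Finset (ℤ × ℤ) := fun φ n k => (𝓜.filter fun m =>
    DoublyHitAt (segUnion T) (xc φ) (fun p => vc φ p / δ) (n / q) c R (d k) m).image
      (cell δ (d k) φ)
  have hcard : ∀ k, ((items δ (d k) 𝓜 fun φ m => DoublyHit (segUnion T) (xc φ)
      (fun p => vc φ p / δ) q c R (d k) m).card : ℝ) ≤
      ∑ φ ∈ frames δ, ∑ n ∈ J', ((F φ n k).card : ℝ) := by
    intro k
    have hsub : (items δ (d k) 𝓜 fun φ m => DoublyHit (segUnion T) (xc φ)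
        (fun p => vc φ p / δ) q c R (d k) m) ⊆
        (frames δ).biUnion fun φ => J'.biUnion fun n => (F φ n k).image fun z => (φ, z) := by
      intro i hi
      obtain ⟨φ, hφ, m, hm, ⟨n, hn, hH⟩, rfl⟩ := mem_items.1 hi
      refine Finset.mem_biUnion.2 ⟨φ, hφ, Finset.mem_biUnion.2 ⟨n, ?_, ?_⟩⟩
      · refine Finset.mem_filter.2 ⟨?_, hn⟩
        have hq' : (0 : ℝ) < q := by exact_mod_cast hq
        rw [abs_le, le_div_iff₀ hq', div_le_iff₀ hq'] at hn
        have hc' : R * q ≤ M := Int.le_ceil _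
        refine Finset.mem_Icc.2 ⟨?_, ?_⟩
        · exact_mod_cast (by linarith [hn.1] : (-M : ℝ) ≤ n)
        · exact_mod_cast (by linarith [hn.2] : (n : ℝ) ≤ M)
      · exact Finset.mem_image.2 ⟨_, Finset.mem_image.2 ⟨m, Finset.mem_filter.2 ⟨hm, hH⟩, rfl⟩, rfl⟩
    have := (Finset.card_le_card hsub).trans (Finset.card_biUnion_le.trans
      (Finset.sum_le_sum fun φ _ => Finset.card_biUnion_le.trans
        (Finset.sum_le_sum fun n _ => Finset.card_image_le)))
    exact_mod_cast this
  have hφn : ∀ φ ∈ frames δ, ∀ n ∈ J', ∑ k ∈ Finset.range N, ((F φ n k).card : ℝ) * d k ≤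
      (p + 1 : ℕ) * (K / δ * gweight T) := by
    intro φ hφ n hn
    refine (sum_range_le_residues (fun k => by have := hd k; positivity) (Nat.succ_pos p) N).trans ?_
    refine (Finset.sum_le_card_nsmul _ _ (K / δ * gweight T) fun r _ => ?_).trans (by simp)
    exact sum_doublyHitAt_le (norm_of_mem_frames hφ) hδ hδ1 (Finset.mem_filter.1 hn).2
      (by linarith) hc (d := fun i => d (r + (p + 1) * i)) (fun i => hd _)
      (fun i => by
        show d (r + (p + 1) * (i + 1)) = _
        rw [mul_add, mul_one, ← add_assoc, hdp _ (p + 1)]) hB2 hBp N 𝓜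
  have hg := gweight_nonneg T
  calc _ ≤ ∑ k ∈ Finset.range N, (∑ φ ∈ frames δ, ∑ n ∈ J', ((F φ n k).card : ℝ)) * d k :=
        Finset.sum_le_sum fun k _ => mul_le_mul_of_nonneg_right (hcard k) (hd k).le
    _ = ∑ φ ∈ frames δ, ∑ n ∈ J', ∑ k ∈ Finset.range N, ((F φ n k).card : ℝ) * d k := by
        simp only [Finset.sum_mul]
        rw [Finset.sum_comm]
        exact Finset.sum_congr rfl fun φ _ => Finset.sum_comm
    _ ≤ ∑ φ ∈ frames δ, ∑ n ∈ J', (p + 1 : ℕ) * (K / δ * gweight T) :=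
        Finset.sum_le_sum fun φ hφ => Finset.sum_le_sum fun n hn => hφn φ hφ n hn
    _ = (frames δ).card * (J'.card * ((p + 1 : ℕ) * (K / δ * gweight T))) := by
        simp only [Finset.sum_const, nsmul_eq_mul]
    _ ≤ (40 / δ) * (J.card * ((p + 1 : ℕ) * (K / δ * gweight T))) := by
        have h1 := card_frames_le hδ hδ1
        have h2 : (J'.card : ℝ) ≤ J.card := by
          exact_mod_cast Finset.card_le_card (Finset.filter_subset _ _)
        gcongr
    _ = _ := by field_simp

lemma card_near_items_le {δ A d : ℝ} (hδ : 0 < δ) (hδ1 : δ ≤ 1) (hd : 0 < d) (hA : 0 ≤ A)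
    (hAδ : A * δ ≤ 1 / 8) {e m : Plane} (he : ‖e‖ = 1) {I : Finset (Plane × (ℤ × ℤ))}
    (h : ∀ i ∈ I, i.1 ∈ frames δ ∧ |vc i.1 e| ≤ A * δ ∧ ∃ m', i.2 = cell δ d i.1 m' ∧
      |xc i.1 (m' - m)| ≤ A * d ∧ |vc i.1 (m' - m)| ≤ A * (δ * d)) :
    (I.card : ℝ) ≤ 4 * (48 * A + 1) * (2 * (A + 1) + 1) ^ 2 := by
  let Φ := (frames δ).filter fun φ => |vc φ e| ≤ A * δ
  let G : Plane → Finset (ℤ × ℤ) := fun φ => (I.filter fun i => i.1 = φ).image Prod.snd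
  have hsub : I ⊆ Φ.biUnion fun φ => (G φ).image fun z => (φ, z) := by
    intro i hi
    obtain ⟨h1, h2, -⟩ := h i hi
    refine Finset.mem_biUnion.2 ⟨i.1, Finset.mem_filter.2 ⟨h1, h2⟩, Finset.mem_image.2
      ⟨i.2, Finset.mem_image.2 ⟨i, Finset.mem_filter.2 ⟨hi, rfl⟩, rfl⟩, rfl⟩⟩
  have hG : ∀ φ ∈ Φ, ((G φ).card : ℝ) ≤ (2 * (A + 1) + 1) ^ 2 := by
    intro φ hφ
    refine card_le_of_near (y₁ := xc φ m / d) (y₂ := vc φ m / (δ * d)) (by linarith) ?_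
    intro z hz
    obtain ⟨i, hiφ, rfl⟩ := Finset.mem_image.1 hz
    obtain ⟨hi, rfl⟩ := Finset.mem_filter.1 hiφ
    obtain ⟨-, -, m', h3, h4, h5⟩ := h i hi
    rw [xc_sub] at h4
    rw [vc_sub] at h5
    rw [h3]
    exact ⟨abs_floor_div_sub_le hd h4, abs_floor_div_sub_le (by positivity) h5⟩
  calc (I.card : ℝ) ≤ ((∑ φ ∈ Φ, (G φ).card : ℕ) : ℝ) := by
        exact_mod_cast (Finset.card_le_card hsub).trans (Finset.card_biUnion_le.trans
          (Finset.sum_le_sum fun φ _ => Finset.card_image_le))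
    _ ≤ Φ.card * (2 * (A + 1) + 1) ^ 2 := by
        push_cast
        refine (Finset.sum_le_card_nsmul _ _ _ hG).trans (by rw [nsmul_eq_mul])
    _ ≤ _ := by
        gcongr
        exact card_frames_near_le hδ hδ1 hA hAδ he

lemma abs_xc_rot_le {e f v : Plane} (he : ‖e‖ = 1) (hf : ‖f‖ = 1) {σ a b : ℝ} (hσ : |vc e f| ≤ σ)
    (ha : |xc e v| ≤ a) (hb : |vc e v| ≤ b) : |xc f v| ≤ a + σ * b := by
  rw [xc_rot he]
  have h1 : |xc e f| ≤ 1 := (abs_xc_le he f).trans hf.le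
  refine (abs_add_le _ _).trans ?_
  rw [abs_mul, abs_mul]
  have h2 : |xc e f| * |xc e v| ≤ 1 * a := mul_le_mul h1 ha (abs_nonneg _) zero_le_one
  have h3 : |vc e f| * |vc e v| ≤ σ * b :=
    mul_le_mul hσ hb (abs_nonneg _) ((abs_nonneg _).trans hσ)
  linarith

lemma abs_vc_rot_le {e f v : Plane} (he : ‖e‖ = 1) (hf : ‖f‖ = 1) {σ a b : ℝ} (hσ : |vc e f| ≤ σ)
    (ha : |xc e v| ≤ a) (hb : |vc e v| ≤ b) : |vc f v| ≤ b + σ * a := by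
  rw [vc_rot he]
  have h1 : |xc e f| ≤ 1 := (abs_xc_le he f).trans hf.le
  refine (abs_sub _ _).trans ?_
  rw [abs_mul, abs_mul]
  have h2 : |xc e f| * |vc e v| ≤ 1 * b := mul_le_mul h1 hb (abs_nonneg _) zero_le_one
  have h3 : |vc e f| * |xc e v| ≤ σ * a :=
    mul_le_mul hσ ha (abs_nonneg _) ((abs_nonneg _).trans hσ)
  linarith

lemma one_sub_sq_le_xc {e f : Plane} (he : ‖e‖ = 1) (hf : ‖f‖ = 1) {σ : ℝ} (hpos : 0 < xc e f)
    (hσ : |vc e f| ≤ σ) : 1 - σ ^ 2 ≤ xc e f := by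
  have h1 := xc_sq_add_vc_sq he f
  have h2 : xc e f ≤ 1 := (xc_le_norm he f).trans hf.le
  have h3 : vc e f ^ 2 ≤ σ ^ 2 := sq_le_sq' (by linarith [abs_le.1 hσ]) (abs_le.1 hσ).2
  rw [hf] at h1
  nlinarith

lemma abs_xc_rot_sub_le {e f v : Plane} (he : ‖e‖ = 1) (hf : ‖f‖ = 1) {σ a b : ℝ}
    (hpos : 0 < xc e f) (hσ : |vc e f| ≤ σ) (ha : |xc e v| ≤ a) (hb : |vc e v| ≤ b) :
    |xc f v - xc e v| ≤ σ ^ 2 * a + σ * b := by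
  rw [xc_rot he]
  have h1 := one_sub_sq_le_xc he hf hpos hσ
  have h2 : xc e f ≤ 1 := (xc_le_norm he f).trans hf.le
  have h3 : |vc e f| * |vc e v| ≤ σ * b :=
    mul_le_mul hσ hb (abs_nonneg _) ((abs_nonneg _).trans hσ)
  have h4 : |xc e f - 1| ≤ σ ^ 2 := by rw [abs_le]; constructor <;> nlinarith [sq_nonneg σ]
  have h5 : |xc e f - 1| * |xc e v| ≤ σ ^ 2 * a :=
    mul_le_mul h4 ha (abs_nonneg _) (sq_nonneg _)
  calc |xc e f * xc e v + vc e f * vc e v - xc e v|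
      = |(xc e f - 1) * xc e v + vc e f * vc e v| := by congr 1; ring
    _ ≤ _ := by
      refine (abs_add_le _ _).trans ?_
      rw [abs_mul, abs_mul]
      linarith

/-- Near `m`, every point of `Γ` in a large anisotropic box lies in a thin strip along `e`. -/
def Flat (Γ : Set Plane) (δ : ℝ) (e : Plane) (d : ℝ) (m : Plane) : Prop :=
  ∀ p ∈ Γ, |xc e (p - m)| ≤ 10000 * d → |vc e (p - m)| ≤ 10000 * (δ * d) →
    |vc e (p - m)| ≤ δ * d / 100

lemma exists_flat_of_not_doublyHit : ∃ q : ℕ, 0 < q ∧ ∃ c : ℝ, 0 < c ∧ ∃ R : ℝ, 1 ≤ R ∧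
    ∀ Γ, CurveConnected Γ → ∀ δ : ℝ, 0 < δ → δ ≤ 1 → ∀ d : ℝ, 0 < d → ∀ s ∈ Γ, ∀ t ∈ Γ,
    ∀ m φ : Plane, 2 * d ≤ ‖t - s‖ → ‖t - s‖ ≤ 64 * d → |xc (unit (t - s)) (m - s)| ≤ 64 * d →
    |vc (unit (t - s)) (m - s)| ≤ δ * d / 200 → ‖φ‖ = 1 → 0 < xc φ (t - s) →
    |vc φ (t - s)| ≤ δ * xc φ (t - s) →
    ¬ DoublyHit Γ (xc φ) (fun p => vc φ p / δ) q c R d m → Flat Γ δ (unit (t - s)) d m := by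
  obtain ⟨q, hq, c, hc, R, hR, H⟩ := exists_doublyHit_of_not_collinear (L := 21000) (κ := 1 / 200)
    (by norm_num) (by norm_num) (by norm_num)
  refine ⟨q, hq, c, hc, R, hR, ?_⟩
  intro Γ hΓ δ hδ hδ1 d hd s hs t ht m φ hD hD' hmx hmv hφ hpos hal hnot p hp hpx hpv
  by_contra hcon
  push Not at hcon
  apply hnot
  have hv : t - s ≠ 0 := by
    intro h; rw [h, norm_zero] at hD; linarith
  set e := unit (t - s) with hedef
  have he : ‖e‖ = 1 := norm_unit hv
  have hxe : xc e (t - s) = ‖t - s‖ := xc_unit_self hv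
  have hve : vc e (t - s) = 0 := vc_unit_self _
  set D := ‖t - s‖
  set C := xc e φ
  set W := vc e φ
  have hxφ : ∀ v, xc φ v = C * xc e v + W * vc e v := xc_rot he φ
  have hvφ : ∀ v, vc φ v = C * vc e v - W * xc e v := vc_rot he φ
  have hCW : C ^ 2 + W ^ 2 = 1 := by have := xc_sq_add_vc_sq he φ; rwa [hφ, one_pow] at this
  have hD0 : 0 < D := by linarith
  have hxts : xc φ (t - s) = C * D := by rw [hxφ, hxe, hve]; ring
  have hvts : vc φ (t - s) = -(W * D) := by rw [hvφ, hxe, hve]; ring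
  have hC : 0 < C := by rw [hxts] at hpos; exact pos_of_mul_pos_left hpos hD0.le
  have hW : |W| ≤ δ * C := by
    rw [hxts, hvts, abs_neg, abs_mul, abs_of_pos hD0, ← mul_assoc] at hal
    exact le_of_mul_le_mul_right hal hD0
  have hC1 : C ≤ 1 := by nlinarith [sq_nonneg W]
  have hWδ : |W| ≤ δ := hW.trans (by nlinarith)
  have hC2 : 1 / 2 ≤ C := by
    have : W ^ 2 ≤ C ^ 2 := sq_le_sq' (by nlinarith [abs_le.1 hW]) (by nlinarith [abs_le.1 hW])
    nlinarith
  have hCD : d ≤ C * D := by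
    have := mul_le_mul hC2 hD (by positivity) hC.le
    linarith
  have hCD' : C * D ≤ D := mul_le_of_le_one_left hD0.le hC1
  -- coordinates of a vector in the frame `φ`
  have hXb : ∀ v a b, |xc e v| ≤ a → |vc e v| ≤ δ * b → |xc φ v| ≤ a + b := by
    intro v a b h1 h2
    have h3 := abs_xc_rot_le he hφ hWδ h1 h2
    have hb : 0 ≤ b := by
      by_contra h; push Not at h; nlinarith [abs_nonneg (vc e v)]
    nlinarith [mul_nonneg hδ.le hb]
  have hUb : ∀ v a b, |xc e v| ≤ a → |vc e v| ≤ δ * b → |vc φ v / δ| ≤ a + b := by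
    intro v a b h1 h2
    have h3 := abs_vc_rot_le he hφ hWδ h1 h2
    rw [abs_div, abs_of_pos hδ, div_le_iff₀ hδ]
    linarith
  have hps : p - s = (p - m) + (m - s) := by abel
  have hpsx : |xc e (p - s)| ≤ 10064 * d := by
    rw [hps, xc_add]; exact (abs_add_le _ _).trans (by linarith)
  have hpsv : |vc e (p - s)| ≤ δ * (10001 * d) := by
    rw [hps, vc_add]; refine (abs_add_le _ _).trans ?_
    have : 0 < δ * d := by positivity
    linarith
  have hmsv : |vc e (m - s)| ≤ δ * d := hmv.trans (by have : 0 < δ * d := by positivity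
                                                      linarith)
  have hsub : ∀ a b : Plane, vc φ a / δ - vc φ b / δ = vc φ (a - b) / δ := by
    intro a b; rw [vc_sub]; ring
  refine H Γ (xc φ) (fun p => vc φ p / δ) hΓ (continuous_xc φ) ((continuous_vc φ).div_const δ) d m
    hd s hs t ht p hp ?_ ?_ ?_ ?_ ?_ ?_ ?_ (-(W / C) / δ) ?_ ?_
  · rw [← xc_sub, hxts]; exact hCD
  · rw [← xc_sub, hxts]; linarith
  · simp only [hsub]
    rw [← xc_sub, abs_div, abs_of_pos hδ, div_le_iff₀ hδ]; linarith
  · rw [← xc_sub]; exact (hXb _ _ _ hpsx hpsv).trans (by linarith)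
  · simp only [hsub]; exact (hUb _ _ _ hpsx hpsv).trans (by linarith)
  · rw [abs_sub_comm, ← xc_sub]; exact (hXb _ _ _ hmx hmsv).trans (by linarith)
  · rw [abs_sub_comm]; simp only [hsub]; exact (hUb _ _ _ hmx hmsv).trans (by linarith)
  · simp only [hsub]
    rw [← xc_sub, hxts, hvts]; field_simp
  · simp only [hsub]
    rw [← xc_sub, hxφ, hvφ]
    have hid : (C * vc e (p - s) - W * xc e (p - s)) / δ -
        -(W / C) / δ * (C * xc e (p - s) + W * vc e (p - s)) = vc e (p - s) / (δ * C) := by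
      field_simp
      linear_combination (vc e (p - s)) * hCW
    rw [hid, abs_div, abs_of_pos (by positivity : 0 < δ * C), le_div_iff₀ (by positivity)]
    have h1 : |vc e (p - m)| ≤ |vc e (p - s)| + |vc e (m - s)| := by
      have : p - m = (p - s) - (m - s) := by abel
      rw [this, vc_sub]; exact abs_sub _ _
    have h2 : 0 < d * δ := by positivity
    have h3 := mul_le_mul_of_nonneg_left hC1 h2.le
    have h4 : 1 / 200 * d * (δ * C) = d * δ * C / 200 := by ring
    have h5 : δ * d = d * δ := mul_comm _ _
    rw [h5] at hcon hmv
    rw [h4]; linarith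

lemma exists_crossing_subinterval {f : ℝ → ℝ} (hf : Continuous f) {a b ρ₁ ρ₂ : ℝ} (hab : a ≤ b)
    (hρ : ρ₁ ≤ ρ₂) (ha : f a ≤ ρ₁) (hb : ρ₂ ≤ f b) :
    ∃ a' b', a ≤ a' ∧ a' ≤ b' ∧ b' ≤ b ∧ f a' = ρ₁ ∧ f b' = ρ₂ ∧
      ∀ t ∈ Set.Icc a' b', ρ₁ ≤ f t ∧ f t ≤ ρ₂ := by
  obtain ⟨b', hb', hfb, hle⟩ := exists_first_hit hf hab (ha.trans hρ) hb
  obtain ⟨τ, hτ, hfτ, hle'⟩ := exists_first_hit (f := fun t => - f (-t)) (by fun_prop)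
    (a := -b') (b := -a) (ρ := -ρ₁) (by linarith [hb'.1]) (by simp only [neg_neg]; linarith)
    (by simp only [neg_neg]; linarith)
  refine ⟨-τ, b', by linarith [hτ.2], by linarith [hτ.1], hb'.2, by linarith, hfb, ?_⟩
  intro t ht
  refine ⟨?_, hle t ⟨by linarith [hτ.2, ht.1], ht.2⟩⟩
  have := hle' (-t) ⟨by linarith [ht.2], by linarith [ht.1]⟩
  simp only [neg_neg] at this
  linarith

/-- `Γ` is flat near `m` at scale `d`, has points on both sides of `m`, but no curve of `Γ` inside
the flat box passes `m`. -/
structure IsGap (Γ : Set Plane) (δ : ℝ) (e : Plane) (d : ℝ) (m : Plane) : Prop where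
  norm_eq : ‖e‖ = 1
  flat : Flat Γ δ e d m
  left : ∃ p ∈ Γ, -(32 * d) ≤ xc e (p - m) ∧ xc e (p - m) ≤ -d ∧ |vc e (p - m)| ≤ δ * d / 100
  right : ∃ p ∈ Γ, d ≤ xc e (p - m) ∧ xc e (p - m) ≤ 32 * d ∧ |vc e (p - m)| ≤ δ * d / 100
  noCross : ∀ γ : ℝ → Plane, Continuous γ → ∀ a b : ℝ, a ≤ b →
    (∀ t ∈ Set.Icc a b, γ t ∈ Γ ∧ |xc e (γ t - m)| ≤ d ∧ |vc e (γ t - m)| ≤ 10000 * (δ * d)) →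
    ¬ (xc e (γ a - m) ≤ -d ∧ d ≤ xc e (γ b - m))

namespace IsGap

variable {Γ : Set Plane} {δ d : ℝ} {e m : Plane}

lemma neg (h : IsGap Γ δ e d m) : IsGap Γ δ (-e) d m where
  norm_eq := by rw [norm_neg, h.norm_eq]
  flat := by
    have := h.flat
    simpa only [Flat, xc_neg_left, vc_neg_left, abs_neg] using this
  left := by
    obtain ⟨p, hp, h1, h2, h3⟩ := h.right
    refine ⟨p, hp, ?_, ?_, ?_⟩ <;> simp only [xc_neg_left, vc_neg_left, abs_neg] <;> linarith
  right := by
    obtain ⟨p, hp, h1, h2, h3⟩ := h.left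
    refine ⟨p, hp, ?_, ?_, ?_⟩ <;> simp only [xc_neg_left, vc_neg_left, abs_neg] <;> linarith
  noCross := by
    intro γ hγ a b hab hmem hcon
    simp only [xc_neg_left, vc_neg_left, abs_neg] at hmem hcon
    refine h.noCross (fun t => γ (a + b - t)) (by fun_prop) a b hab (fun t ht => ?_) ⟨?_, ?_⟩
    · exact hmem _ ⟨by linarith [ht.2], by linarith [ht.1]⟩
    · rw [add_sub_cancel_left]; linarith
    · rw [add_sub_cancel_right]; linarith

lemma not_crossing (h : IsGap Γ δ e d m) (hd : 0 < d) {γ : ℝ → Plane} (hγ : Continuous γ) {a b : ℝ}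
    (hab : a ≤ b) (hmem : ∀ t ∈ Set.Icc a b, γ t ∈ Γ ∧ |vc e (γ t - m)| ≤ 10000 * (δ * d))
    (ha : xc e (γ a - m) ≤ -d) (hb : d ≤ xc e (γ b - m)) : False := by
  obtain ⟨a', b', h1, h2, h3, h4, h5, h6⟩ := exists_crossing_subinterval
    (f := fun t => xc e (γ t - m)) ((continuous_xc e).comp (hγ.sub continuous_const)) hab
    (by linarith) ha hb
  refine h.noCross γ hγ a' b' h2 (fun t ht => ?_) ⟨h4.le, h5.ge⟩
  obtain ⟨h7, h8⟩ := hmem t ⟨h1.trans ht.1, ht.2.trans h3⟩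
  exact ⟨h7, abs_le.2 (h6 t ht), h8⟩

lemma exists_left_strand (h : IsGap Γ δ e d m) (hΓ : CurveConnected Γ) (hd : 0 < d) (hδ : 0 < δ)
    {X : ℝ} (hX : 32 * d ≤ X) (hX' : X ≤ 10000 * d) :
    ∃ γ : ℝ → Plane, Continuous γ ∧ ∃ b, 0 ≤ b ∧
      (∀ t ∈ Set.Icc 0 b, γ t ∈ Γ ∧ |xc e (γ t - m)| ≤ X ∧ |vc e (γ t - m)| ≤ δ * d / 100) ∧
      -(32 * d) ≤ xc e (γ 0 - m) ∧ xc e (γ 0 - m) ≤ -d ∧ xc e (γ b - m) = -X := by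
  obtain ⟨p, hp, hp1, hp2, hp3⟩ := h.left
  obtain ⟨q, hq, hq1, hq2, hq3⟩ := h.right
  obtain ⟨γ, hγ, h0, h1, hmem⟩ := hΓ p hp q hq
  have hX0 : 0 < X := by linarith
  have hδd : 0 < δ * d := by positivity
  let g : ℝ → ℝ := fun t => max (|xc e (γ t - m)| / X) (|vc e (γ t - m)| / (10000 * (δ * d)))
  have hg : Continuous g :=
    ((((continuous_xc e).comp (hγ.sub continuous_const)).abs.div_const _).max
      (((continuous_vc e).comp (hγ.sub continuous_const)).abs.div_const _))
  have hg1 : ∀ t, g t ≤ 1 ↔ |xc e (γ t - m)| ≤ X ∧ |vc e (γ t - m)| ≤ 10000 * (δ * d) := by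
    intro t
    simp only [g, max_le_iff]
    rw [div_le_one hX0, div_le_one (by positivity)]
  obtain ⟨t₀, ht₀, hgt₀⟩ : ∃ t₀ ∈ Set.Icc (0 : ℝ) 1, 1 < g t₀ := by
    by_contra hcon
    push Not at hcon
    exact h.not_crossing hd hγ zero_le_one (fun t ht => ⟨hmem t, ((hg1 t).1 (hcon t ht)).2⟩)
      (by rw [h0]; exact hp2) (by rw [h1]; exact hq1)
  obtain ⟨τ, hτ, hgτ, hle⟩ := exists_first_hit hg ht₀.1 (ρ := 1)
    ((hg1 0).2 (by rw [h0]; exact ⟨abs_le.2 ⟨by linarith, by linarith⟩, by linarith⟩)) hgt₀.le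
  have hbox : ∀ t ∈ Set.Icc 0 τ, γ t ∈ Γ ∧ |xc e (γ t - m)| ≤ X ∧
      |vc e (γ t - m)| ≤ δ * d / 100 := by
    intro t ht
    obtain ⟨h2, h3⟩ := (hg1 t).1 (hle t ht)
    exact ⟨hmem t, h2, h.flat _ (hmem t) (h2.trans hX') h3⟩
  refine ⟨γ, hγ, τ, hτ.1, hbox, by rw [h0]; exact hp1, by rw [h0]; exact hp2, ?_⟩
  obtain ⟨-, h2, h3⟩ := hbox τ ⟨hτ.1, le_rfl⟩
  have h4 : |xc e (γ τ - m)| = X := by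
    by_contra hne
    have h5 : |xc e (γ τ - m)| / X < 1 := (div_lt_one hX0).2 (lt_of_le_of_ne h2 hne)
    have h6 : |vc e (γ τ - m)| / (10000 * (δ * d)) < 1 := by
      rw [div_lt_one (by positivity)]; linarith
    exact absurd hgτ (max_lt h5 h6).ne
  rcases abs_choice (xc e (γ τ - m)) with h5 | h5
  · exfalso
    refine h.not_crossing hd hγ hτ.1 (fun t ht => ⟨hmem t, ?_⟩) (by rw [h0]; exact hp2)
      (by rw [← h5, h4]; linarith)
    exact ((hg1 t).1 (hle t ht)).2
  · linarith

lemma exists_right_strand (h : IsGap Γ δ e d m) (hΓ : CurveConnected Γ) (hd : 0 < d) (hδ : 0 < δ)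
    {X : ℝ} (hX : 32 * d ≤ X) (hX' : X ≤ 10000 * d) :
    ∃ γ : ℝ → Plane, Continuous γ ∧ ∃ b, 0 ≤ b ∧
      (∀ t ∈ Set.Icc 0 b, γ t ∈ Γ ∧ |xc e (γ t - m)| ≤ X ∧ |vc e (γ t - m)| ≤ δ * d / 100) ∧
      d ≤ xc e (γ 0 - m) ∧ xc e (γ 0 - m) ≤ 32 * d ∧ xc e (γ b - m) = X := by
  obtain ⟨γ, hγ, b, hb, hmem, h1, h2, h3⟩ := h.neg.exists_left_strand hΓ hd hδ hX hX'
  simp only [xc_neg_left, vc_neg_left, abs_neg] at hmem h1 h2 h3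
  exact ⟨γ, hγ, b, hb, hmem, by linarith, by linarith, by linarith⟩

end IsGap

/-- `Γ` is flat at scale `d` along each of its chords of length comparable to `d`, except at the
frames and places described by `P`. -/
def FlatUnless (Γ : Set Plane) (δ : ℝ) (P : Plane → ℝ → Plane → Prop) : Prop :=
  ∀ d : ℝ, 0 < d → ∀ s ∈ Γ, ∀ t ∈ Γ,
    ∀ m φ : Plane, 2 * d ≤ ‖t - s‖ → ‖t - s‖ ≤ 64 * d → |xc (unit (t - s)) (m - s)| ≤ 64 * d →
    |vc (unit (t - s)) (m - s)| ≤ δ * d / 200 → ‖φ‖ = 1 → 0 < xc φ (t - s) →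
    |vc φ (t - s)| ≤ δ * xc φ (t - s) → ¬ P φ d m → Flat Γ δ (unit (t - s)) d m

namespace IsGap

variable {Γ : Set Plane} {δ d : ℝ} {e m : Plane} {P : Plane → ℝ → Plane → Prop}

lemma step (h : IsGap Γ δ e d m) (hΓ : CurveConnected Γ) (hd : 0 < d) (hδ : 0 < δ)
    (hδ1 : δ ≤ 1 / 1000) (H : FlatUnless Γ δ P) :
    ∃ e', ‖e'‖ = 1 ∧ 0 < xc e e' ∧ |vc e e'| ≤ δ / 4000 ∧ ∃ φ ∈ frames δ, 0 < xc φ e ∧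
      |vc φ e| ≤ 2 * δ ∧ (P φ (4 * d) m ∨ IsGap Γ δ e' (4 * d) m) := by
  have he := h.norm_eq
  have hδd : 0 < δ * d := by positivity
  have hδd1 : δ * d ≤ d / 1000 := by nlinarith
  have hδδd : δ * (δ * d) ≤ d / 1000 := by nlinarith
  have hδ2 : δ ^ 2 ≤ 1 / 10 := by nlinarith
  obtain ⟨γ₁, -, b₁, hb₁, hs, -, -, hsX⟩ := h.exists_left_strand hΓ hd hδ (X := 40 * d)
    (by linarith) (by linarith)
  obtain ⟨γ₂, -, b₂, hb₂, ht, -, -, htX⟩ := h.exists_right_strand hΓ hd hδ (X := 40 * d)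
    (by linarith) (by linarith)
  obtain ⟨hsΓ, -, hsv⟩ := hs b₁ ⟨hb₁, le_rfl⟩
  obtain ⟨htΓ, -, htv⟩ := ht b₂ ⟨hb₂, le_rfl⟩
  set s := γ₁ b₁
  set t := γ₂ b₂
  have hts : t - s = (t - m) - (s - m) := by abel
  have hx : xc e (t - s) = 80 * d := by rw [hts, xc_sub, hsX, htX]; ring
  have hv : |vc e (t - s)| ≤ δ * d / 50 := by
    rw [hts, vc_sub]; refine (abs_sub _ _).trans ?_; linarith
  have hn1 : 80 * d ≤ ‖t - s‖ := hx ▸ xc_le_norm he _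
  have hn2 : ‖t - s‖ ≤ 81 * d := by
    refine (norm_le_abs_add he _).trans ?_
    rw [hx, abs_of_pos (by positivity)]; linarith
  have hne : t - s ≠ 0 := by
    intro h0; rw [h0, norm_zero] at hn1; linarith
  have hn0 : 0 < ‖t - s‖ := norm_pos_iff.2 hne
  set e' := unit (t - s) with he'def
  have he' : ‖e'‖ = 1 := norm_unit hne
  have hxe : 0 < xc e e' := by
    rw [xc_comm, xc_unit, xc_comm, hx]; positivity
  have hve : |vc e e'| ≤ δ / 4000 := by
    rw [vc_comm, abs_neg, vc_unit, vc_comm, mul_neg, abs_neg, abs_mul,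
      abs_of_pos (inv_pos.2 hn0), ← div_eq_inv_mul, div_le_iff₀ hn0]
    have : δ / 4000 * (80 * d) ≤ δ / 4000 * ‖t - s‖ := by gcongr
    have h2 : δ / 4000 * (80 * d) = δ * d / 50 := by ring
    linarith
  have hve' : |vc e' e| ≤ δ / 4000 := by rw [vc_comm, abs_neg]; exact hve
  have hxe' : 0 < xc e' e := by rw [xc_comm]; exact hxe
  obtain ⟨φ, hφ, hφx, hφv⟩ := exists_frame hδ (by linarith) hne
  have hφ1 := norm_of_mem_frames hφ
  have hx' : xc φ (t - s) = ‖t - s‖ * xc φ e' := by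
    rw [xc_comm φ e', he'def, xc_unit, xc_comm, ← mul_assoc, mul_inv_cancel₀ hn0.ne', one_mul]
  have hv' : vc φ (t - s) = ‖t - s‖ * vc φ e' := by
    rw [vc_comm φ e', he'def, vc_unit, vc_comm φ, mul_neg, ← mul_assoc,
      mul_inv_cancel₀ hn0.ne', one_mul]
  have hφx' : 0 < xc e' φ := by
    rw [hx'] at hφx; rw [xc_comm]; exact pos_of_mul_pos_right hφx hn0.le
  have hφv' : |vc e' φ| ≤ δ := by
    rw [vc_comm, abs_neg]
    rw [hx', hv', abs_mul, abs_of_pos hn0, mul_left_comm] at hφv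
    have h1 := le_of_mul_le_mul_left hφv hn0
    have h2 : xc φ e' ≤ 1 := (xc_le_norm hφ1 e').trans he'.le
    exact h1.trans (mul_le_of_le_one_right hδ.le h2)
  have hφe : 0 < xc φ e := by
    rw [xc_rot he']
    have h1 := one_sub_sq_le_xc he' hφ1 hφx' hφv'
    have h2 := one_sub_sq_le_xc he' he hxe' hve'
    have h3 : |vc e' φ * vc e' e| ≤ δ * (δ / 4000) := by
      rw [abs_mul]; exact mul_le_mul hφv' hve' (abs_nonneg _) hδ.le
    have h4 : (δ / 4000) ^ 2 = δ ^ 2 / 16000000 := by ring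
    have h8 : δ * (δ / 4000) = δ ^ 2 / 4000 := by ring
    have h5 : 9 / 10 ≤ xc e' φ := by linarith
    have h6 : 9 / 10 ≤ xc e' e := by linarith [sq_nonneg δ]
    have h7 := mul_le_mul h5 h6 (by norm_num) hφx'.le
    linarith [(abs_le.1 h3).1]
  have hφve : |vc φ e| ≤ 2 * δ := by
    have := abs_vc_rot_le (v := e) he' hφ1 hφv' (((abs_xc_le he' e).trans he.le)) hve'
    linarith
  refine ⟨e', he', hxe, hve, φ, hφ, hφe, hφve, ?_⟩
  rw [or_iff_not_imp_left]
  intro hP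
  have hms : m - s = -(s - m) := by abel
  have hsx : |xc e (s - m)| ≤ 40 * d := by
    rw [hsX, abs_neg, abs_of_pos (by positivity)]
  have htx : |xc e (t - m)| ≤ 40 * d := by
    rw [htX, abs_of_pos (by positivity)]
  have hvs' : ∀ p, |xc e (p - m)| ≤ 40 * d → |vc e (p - m)| ≤ δ * d / 100 →
      |vc e' (p - m)| ≤ δ * d / 50 := by
    intro p h1 h2
    have := abs_vc_rot_le he he' hve h1 h2
    have h3 : δ / 4000 * (40 * d) = δ * d / 100 := by ring
    linarith
  have hsmall : δ / 4000 * (δ * d / 100) ≤ d / 100 := by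
    have : δ / 4000 * (δ * d / 100) = δ * (δ * d) / 400000 := by ring
    linarith
  have hsmall' : (δ / 4000) ^ 2 * (40 * d) ≤ d / 100 := by
    have : (δ / 4000) ^ 2 * (40 * d) = δ * (δ * d) / 400000 := by ring
    linarith
  have hxs' : ∀ p, |xc e (p - m)| ≤ 40 * d → |vc e (p - m)| ≤ δ * d / 100 →
      |xc e' (p - m) - xc e (p - m)| ≤ d := by
    intro p h1 h2
    have := abs_xc_rot_sub_le he he' hxe hve h1 h2
    linarith
  have hms_x : |xc e' (m - s)| ≤ 64 * (4 * d) := by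
    have h1 := abs_le.1 (hxs' s hsx hsv)
    have h2 : xc e' (m - s) = - xc e' (s - m) := by rw [xc_sub, xc_sub]; ring
    rw [h2, abs_le]; constructor <;> linarith [h1.1, h1.2]
  have hms_v : |vc e' (m - s)| ≤ δ * (4 * d) / 200 := by
    have h1 := hvs' s hsx hsv
    have h2 : vc e' (m - s) = - vc e' (s - m) := by rw [vc_sub, vc_sub]; ring
    rw [h2, abs_neg]; linarith
  have hflat : Flat Γ δ e' (4 * d) m := H (4 * d) (by linarith) s hsΓ t htΓ m φ (by linarith)
    (by linarith) hms_x hms_v hφ1 hφx hφv hP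
  refine ⟨he', hflat, ⟨s, hsΓ, ?_, ?_, ?_⟩, ⟨t, htΓ, ?_, ?_, ?_⟩, ?_⟩
  · linarith [(abs_le.1 (hxs' s hsx hsv)).1]
  · linarith [(abs_le.1 (hxs' s hsx hsv)).2]
  · linarith [hvs' s hsx hsv]
  · linarith [(abs_le.1 (hxs' t htx htv)).1]
  · linarith [(abs_le.1 (hxs' t htx htv)).2]
  · linarith [hvs' t htx htv]
  · rintro γ hγ a b hab hmem ⟨ha, hb⟩
    have hfl : ∀ u ∈ Set.Icc a b, |vc e' (γ u - m)| ≤ δ * (4 * d) / 100 := by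
      intro u hu
      obtain ⟨h1, h2, h3⟩ := hmem u hu
      exact hflat _ h1 (by linarith) h3
    have hxx : ∀ u ∈ Set.Icc a b, |xc e (γ u - m) - xc e' (γ u - m)| ≤ d := by
      intro u hu
      have := abs_xc_rot_sub_le he' he hxe' hve' (hmem u hu).2.1 (hfl u hu)
      have h3 : (δ / 4000) ^ 2 * (4 * d) ≤ (δ / 4000) ^ 2 * (40 * d) := by gcongr; linarith
      linarith
    refine h.not_crossing hd hγ hab (fun u hu => ⟨(hmem u hu).1, ?_⟩) ?_ ?_
    · have := abs_vc_rot_le he' he hve' (hmem u hu).2.1 (hfl u hu)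
      linarith
    · linarith [(abs_le.1 (hxx a ⟨le_rfl, hab⟩)).2]
    · linarith [(abs_le.1 (hxx b ⟨hab, le_rfl⟩)).1]

end IsGap

namespace IsGap

variable {Γ : Set Plane} {δ d : ℝ} {e₁ e₂ m₁ m₂ : Plane}

lemma xc_sub_le_of_near (h₁ : IsGap Γ δ e₁ d m₁) (h₂ : IsGap Γ δ e₂ d m₂) (hΓ : CurveConnected Γ)
    (hd : 0 < d) (hδ : 0 < δ) (hδ1 : δ ≤ 1 / 1000) (hxe : 0 < xc e₁ e₂) (hve : |vc e₁ e₂| ≤ 5 * δ)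
    (hx : |xc e₁ (m₂ - m₁)| ≤ 321 * d) (hv : |vc e₁ (m₂ - m₁)| ≤ 16 * (δ * d)) :
    xc e₁ (m₂ - m₁) ≤ 80 * d := by
  by_contra hcon
  push Not at hcon
  have he₁ := h₁.norm_eq
  have he₂ := h₂.norm_eq
  have hδd : 0 < δ * d := by positivity
  have hδδd : δ * (δ * d) ≤ d / 1000000 := by nlinarith
  obtain ⟨γ, hγ, b, hb, hmem, h0, h0', hX⟩ := h₁.exists_right_strand hΓ hd hδ (X := 1000 * d)
    (by linarith) (by linarith)
  have hw : ∀ p : Plane, p - m₂ = (p - m₁) - (m₂ - m₁) := fun p => by abel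
  have hxw : ∀ t ∈ Set.Icc 0 b, |xc e₁ (γ t - m₂)| ≤ 1321 * d := by
    intro t ht
    rw [hw, xc_sub]
    exact (abs_sub _ _).trans (by linarith [(hmem t ht).2.1])
  have hvw : ∀ t ∈ Set.Icc 0 b, |vc e₁ (γ t - m₂)| ≤ 17 * (δ * d) := by
    intro t ht
    rw [hw, vc_sub]
    exact (abs_sub _ _).trans (by linarith [(hmem t ht).2.2])
  have hxx : ∀ t ∈ Set.Icc 0 b, |xc e₂ (γ t - m₂) - xc e₁ (γ t - m₂)| ≤ d := by
    intro t ht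
    have h3 := abs_xc_rot_sub_le he₁ he₂ hxe hve (hxw t ht) (hvw t ht)
    have h4 : (5 * δ) ^ 2 * (1321 * d) + 5 * δ * (17 * (δ * d)) = 33110 * (δ * (δ * d)) := by ring
    rw [h4] at h3
    linarith
  refine h₂.not_crossing hd hγ hb (fun t ht => ⟨(hmem t ht).1, ?_⟩) ?_ ?_
  · have h3 := abs_vc_rot_le he₁ he₂ hve (hxw t ht) (hvw t ht)
    have h4 : 17 * (δ * d) + 5 * δ * (1321 * d) = 6622 * (δ * d) := by ring
    rw [h4] at h3
    linarith
  · have h3 := (abs_le.1 (hxx 0 ⟨le_rfl, hb⟩)).2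
    have h4 : xc e₁ (γ 0 - m₂) = xc e₁ (γ 0 - m₁) - xc e₁ (m₂ - m₁) := by rw [hw, xc_sub]
    linarith
  · have h3 := (abs_le.1 (hxx b ⟨hb, le_rfl⟩)).1
    have h4 : xc e₁ (γ b - m₂) = xc e₁ (γ b - m₁) - xc e₁ (m₂ - m₁) := by rw [hw, xc_sub]
    linarith [(abs_le.1 hx).2]

lemma close_of_near (h₁ : IsGap Γ δ e₁ d m₁) (h₂ : IsGap Γ δ e₂ d m₂) (hΓ : CurveConnected Γ)
    (hd : 0 < d) (hδ : 0 < δ) (hδ1 : δ ≤ 1 / 1000) (hxe : 0 < xc e₁ e₂) (hve : |vc e₁ e₂| ≤ 5 * δ)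
    (hx : |xc e₁ (m₂ - m₁)| ≤ 321 * d) (hv : |vc e₁ (m₂ - m₁)| ≤ 16 * (δ * d)) :
    |xc e₁ (m₂ - m₁)| ≤ 80 * d ∧ |vc e₁ (m₂ - m₁)| ≤ δ * d ∧ |vc e₁ e₂| ≤ δ := by
  have hneg : ∀ v : Plane, xc v (-e₂) = - xc v e₂ ∧ vc v (-e₂) = - vc v e₂ := by
    intro v
    rw [xc_comm, xc_neg_left, xc_comm, vc_comm, vc_neg_left, vc_comm, neg_neg]
    exact ⟨rfl, by rw [vc_comm]⟩
  have hx80 : |xc e₁ (m₂ - m₁)| ≤ 80 * d := by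
    rw [abs_le]
    refine ⟨?_, h₁.xc_sub_le_of_near h₂ hΓ hd hδ hδ1 hxe hve hx hv⟩
    have := h₁.neg.xc_sub_le_of_near h₂.neg hΓ hd hδ hδ1
      (by rw [(hneg _).1, xc_neg_left, neg_neg]; exact hxe)
      (by rw [(hneg _).2, vc_neg_left, neg_neg]; exact hve)
      (by rw [xc_neg_left, abs_neg]; exact hx) (by rw [vc_neg_left, abs_neg]; exact hv)
    rw [xc_neg_left] at this
    linarith
  have he₁ := h₁.norm_eq
  have he₂ := h₂.norm_eq
  have hδd : 0 < δ * d := by positivity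
  have hδδd : δ * (δ * d) ≤ d / 1000000 := by nlinarith
  have hδ2 : δ ^ 2 ≤ 1 / 1000 := by nlinarith
  have hC : 1 / 2 ≤ xc e₁ e₂ := by
    have h3 := one_sub_sq_le_xc he₁ he₂ hxe hve
    have h4 : (5 * δ) ^ 2 = 25 * δ ^ 2 := by ring
    linarith
  obtain ⟨γ₁, -, b₁, hb₁, hs, -, -, hsX⟩ := h₁.exists_left_strand hΓ hd hδ (X := 200 * d)
    (by linarith) (by linarith)
  obtain ⟨γ₂, -, b₂, hb₂, ht, -, -, htX⟩ := h₁.exists_right_strand hΓ hd hδ (X := 200 * d)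
    (by linarith) (by linarith)
  obtain ⟨hsΓ, hsx, hsv⟩ := hs b₁ ⟨hb₁, le_rfl⟩
  obtain ⟨htΓ, htx, htv⟩ := ht b₂ ⟨hb₂, le_rfl⟩
  set s := γ₁ b₁
  set t := γ₂ b₂
  have hw : ∀ p : Plane, p - m₂ = (p - m₁) - (m₂ - m₁) := fun p => by abel
  have hfl : ∀ p ∈ Γ, |xc e₁ (p - m₁)| ≤ 200 * d → |vc e₁ (p - m₁)| ≤ δ * d / 100 →
      |vc e₂ (p - m₂)| ≤ δ * d / 100 := by
    intro p hp hpx hpv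
    have h3 : |xc e₁ (p - m₂)| ≤ 280 * d := by
      rw [hw, xc_sub]; exact (abs_sub _ _).trans (by linarith)
    have h4 : |vc e₁ (p - m₂)| ≤ 17 * (δ * d) := by
      rw [hw, vc_sub]; exact (abs_sub _ _).trans (by linarith)
    refine h₂.flat p hp ?_ ?_
    · refine (abs_xc_rot_le he₁ he₂ hve h3 h4).trans ?_
      have : 5 * δ * (17 * (δ * d)) = 85 * (δ * (δ * d)) := by ring
      linarith
    · refine (abs_vc_rot_le he₁ he₂ hve h3 h4).trans ?_
      have : 5 * δ * (280 * d) = 1400 * (δ * d) := by ring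
      linarith
  have hs2 := hfl s hsΓ hsx hsv
  have ht2 := hfl t htΓ htx htv
  have hC1 : xc e₁ e₂ ≤ 1 := (xc_le_norm he₁ e₂).trans he₂.le
  have hCv : ∀ v : ℝ, |v| ≤ δ * d / 100 → |xc e₁ e₂ * v| ≤ δ * d / 100 := by
    intro v hv
    rw [abs_mul, abs_of_pos hxe]
    exact (mul_le_of_le_one_left (abs_nonneg _) hC1).trans hv
  have hrs := vc_rot he₁ e₂ (s - m₂)
  have hrt := vc_rot he₁ e₂ (t - m₂)
  have hrs' : vc e₂ (s - m₂) = xc e₁ e₂ * vc e₁ (s - m₁) - xc e₁ e₂ * vc e₁ (m₂ - m₁) -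
      vc e₁ e₂ * (-(200 * d) - xc e₁ (m₂ - m₁)) := by
    rw [hrs, hw s, vc_sub, xc_sub, hsX]; ring
  have hrt' : vc e₂ (t - m₂) = xc e₁ e₂ * vc e₁ (t - m₁) - xc e₁ e₂ * vc e₁ (m₂ - m₁) -
      vc e₁ e₂ * (200 * d - xc e₁ (m₂ - m₁)) := by
    rw [hrt, hw t, vc_sub, xc_sub, htX]; ring
  have hCs := abs_le.1 (hCv _ hsv)
  have hCt := abs_le.1 (hCv _ htv)
  have hs2' := abs_le.1 hs2
  have ht2' := abs_le.1 ht2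
  have hW : |vc e₁ e₂| ≤ δ / 10000 := by
    have h5 : |vc e₁ e₂ * (400 * d)| ≤ δ * d / 25 := by
      have h6 : vc e₁ e₂ * (400 * d) = xc e₁ e₂ * vc e₁ (t - m₁) - xc e₁ e₂ * vc e₁ (s - m₁) -
        vc e₂ (t - m₂) + vc e₂ (s - m₂) := by rw [hrs', hrt']; ring
      rw [h6, abs_le]
      constructor <;> linarith [hCs.1, hCs.2, hCt.1, hCt.2, hs2'.1, hs2'.2, ht2'.1, ht2'.2]
    rw [abs_mul, abs_of_pos (by positivity : 0 < 400 * d)] at h5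
    refine le_of_mul_le_mul_right (h5.trans (le_of_eq ?_)) (by positivity : 0 < 400 * d)
    ring
  refine ⟨hx80, ?_, by linarith⟩
  have h5 : |vc e₁ e₂ * (200 * d - xc e₁ (m₂ - m₁))| ≤ δ / 10000 * (280 * d) := by
    rw [abs_mul]
    refine mul_le_mul hW ?_ (abs_nonneg _) (by positivity)
    rw [abs_le] at hx80 ⊢
    constructor <;> linarith [hx80.1, hx80.2]
  have h6 : δ / 10000 * (280 * d) = 28 / 1000 * (δ * d) := by ring
  rw [h6] at h5
  have h7 : |xc e₁ e₂ * vc e₁ (m₂ - m₁)| ≤ δ * d / 2 := by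
    have h8 : xc e₁ e₂ * vc e₁ (m₂ - m₁) = xc e₁ e₂ * vc e₁ (t - m₁) -
      vc e₁ e₂ * (200 * d - xc e₁ (m₂ - m₁)) - vc e₂ (t - m₂) := by rw [hrt']; ring
    rw [h8]
    rw [abs_le] at h5 ⊢
    constructor <;> linarith [h5.1, h5.2, hCt.1, hCt.2, ht2'.1, ht2'.2]
  rw [abs_mul, abs_of_pos hxe] at h7
  have h8 := mul_le_mul_of_nonneg_right hC (abs_nonneg (vc e₁ (m₂ - m₁)))
  linarith

end IsGap

lemma aligned_trans {φ e f : Plane} (hφ : ‖φ‖ = 1) (he : ‖e‖ = 1) (hf : ‖f‖ = 1) {σ τ : ℝ}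
    (hσ : σ ≤ 1 / 10) (hτ : τ ≤ 1 / 10) (hxe : 0 < xc φ e) (hve : |vc φ e| ≤ σ) (hxf : 0 < xc φ f)
    (hvf : |vc φ f| ≤ τ) : 0 < xc e f ∧ |vc e f| ≤ σ + τ := by
  have hσ0 := (abs_nonneg _).trans hve
  have hτ0 := (abs_nonneg _).trans hvf
  constructor
  · rw [xc_rot hφ]
    have h1 := one_sub_sq_le_xc hφ he hxe hve
    have h2 := one_sub_sq_le_xc hφ hf hxf hvf
    have h3 : |vc φ e * vc φ f| ≤ σ * τ := by
      rw [abs_mul]; exact mul_le_mul hve hvf (abs_nonneg _) hσ0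
    have h4 : 9 / 10 ≤ xc φ e := by nlinarith
    have h5 : 9 / 10 ≤ xc φ f := by nlinarith
    have h6 : σ * τ ≤ 1 / 10 * (1 / 10) := mul_le_mul hσ hτ hτ0 (by norm_num)
    have h7 := mul_le_mul h4 h5 (by norm_num) hxe.le
    linarith [(abs_le.1 h3).1]
  · have := abs_vc_rot_le (v := f) hφ he hve ((abs_xc_le hφ f).trans hf.le) hvf
    linarith

/-- A gap persisting from scale `k` up to scale `j - 1`, where it ends with `P` at scale `j`. -/
inductive GapChain (Γ : Set Plane) (δ : ℝ) (P : Plane → ℝ → Plane → Prop) (d : ℕ → ℝ) (m : Plane) :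
    ℕ → Plane → ℕ → Plane → Prop
  | base {k : ℕ} {e φ : Plane} : IsGap Γ δ e (d k) m → P φ (d (k + 1)) m → φ ∈ frames δ →
      0 < xc φ e → |vc φ e| ≤ 2 * δ → GapChain Γ δ P d m k e (k + 1) φ
  | step {k j : ℕ} {e e' φ : Plane} : IsGap Γ δ e (d k) m → 0 < xc e e' → |vc e e'| ≤ δ / 4000 →
      GapChain Γ δ P d m (k + 1) e' j φ → GapChain Γ δ P d m k e j φ

namespace GapChain

variable {Γ : Set Plane} {δ : ℝ} {P : Plane → ℝ → Plane → Prop} {d : ℕ → ℝ} {m m₁ m₂ : Plane}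
  {k j : ℕ} {e e₁ e₂ φ : Plane}

lemma isGap (h : GapChain Γ δ P d m k e j φ) : IsGap Γ δ e (d k) m := by
  cases h <;> assumption

lemma lt (h : GapChain Γ δ P d m k e j φ) : k < j := by
  induction h with
  | base => omega
  | step _ _ _ _ ih => omega

lemma prop_end (h : GapChain Γ δ P d m k e j φ) : φ ∈ frames δ ∧ P φ (d j) m := by
  induction h with
  | base _ h1 h2 => exact ⟨h2, h1⟩
  | step _ _ _ _ ih => exact ih

lemma le_of_isGap_lt {N : ℕ} (hN : ∀ k e, IsGap Γ δ e (d k) m → k < N)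
    (h : GapChain Γ δ P d m k e j φ) : j ≤ N := by
  induction h with
  | base h => exact hN _ _ h
  | step _ _ _ _ ih => exact ih

lemma exists_of_isGap (hΓ : CurveConnected Γ) (hδ : 0 < δ) (hδ1 : δ ≤ 1 / 1000)
    (hd : ∀ k, 0 < d k) (hd4 : ∀ k, d (k + 1) = 4 * d k) (H : FlatUnless Γ δ P) {N : ℕ}
    (hN : ∀ k e, IsGap Γ δ e (d k) m → k < N) (h : IsGap Γ δ e (d k) m) :
    ∃ j φ, GapChain Γ δ P d m k e j φ := by
  obtain ⟨n, hn⟩ : ∃ n, N - k = n := ⟨_, rfl⟩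
  induction n generalizing k e with
  | zero => have := hN k e h; omega
  | succ n ih =>
    obtain ⟨e', he', hx, hv, φ, hφ, hφx, hφv, hor⟩ := h.step hΓ (hd k) hδ hδ1 H
    rw [← hd4] at hor
    rcases hor with hP | hgap
    · exact ⟨k + 1, φ, base h hP hφ hφx hφv⟩
    · obtain ⟨j, ψ, hc⟩ := ih hgap (by omega)
      exact ⟨j, ψ, step h hx hv hc⟩

lemma close (hΓ : CurveConnected Γ) (hδ : 0 < δ) (hδ1 : δ ≤ 1 / 1000) (hd : ∀ k, 0 < d k)
    (hd4 : ∀ k, d (k + 1) = 4 * d k) (h₁ : GapChain Γ δ P d m₁ k e₁ j φ)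
    (h₂ : GapChain Γ δ P d m₂ k e₂ j φ) (hx : |xc φ (m₂ - m₁)| ≤ d j)
    (hv : |vc φ (m₂ - m₁)| ≤ δ * d j) :
    0 < xc e₁ e₂ ∧ |xc e₁ (m₂ - m₁)| ≤ 80 * d k ∧ |vc e₁ (m₂ - m₁)| ≤ δ * d k ∧
      |vc e₁ e₂| ≤ δ := by
  induction h₁ generalizing e₂ with
  | @base k e₁ φ hg₁ hP₁ hφ hx₁ hv₁ =>
    cases h₂ with
    | step _ _ _ h => exact absurd h.lt (lt_irrefl _)
    | base hg₂ hP₂ _ hx₂ hv₂ =>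
      have hdk := hd k
      have hδd : 0 < δ * d k := mul_pos hδ hdk
      have hδδd : δ * (δ * d k) ≤ d k / 1000000 := by nlinarith
      rw [hd4] at hx hv
      have hφ1 := norm_of_mem_frames hφ
      obtain ⟨h3, h4⟩ := aligned_trans hφ1 hg₁.norm_eq hg₂.norm_eq (by linarith) (by linarith)
        hx₁ hv₁ hx₂ hv₂
      refine ⟨h3, hg₁.close_of_near hg₂ hΓ hdk hδ hδ1 h3 (by linarith) ?_ ?_⟩
      · refine (abs_xc_rot_le hφ1 hg₁.norm_eq hv₁ hx hv).trans ?_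
        have : 2 * δ * (δ * (4 * d k)) = 8 * (δ * (δ * d k)) := by ring
        linarith
      · refine (abs_vc_rot_le hφ1 hg₁.norm_eq hv₁ hx hv).trans ?_
        have : δ * (4 * d k) + 2 * δ * (4 * d k) = 12 * (δ * d k) := by ring
        linarith
  | @step k j e₁ e₁' φ hg₁ hx₁ hv₁ hc₁ ih =>
    cases h₂ with
    | base => exact absurd hc₁.lt (lt_irrefl _)
    | @step _ _ _ e₂' _ hg₂ hx₂ hv₂ hc₂ =>
      obtain ⟨h3, h4, h5, h6⟩ := ih hc₂ hx hv
      have hdk := hd k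
      have hδd : 0 < δ * d k := mul_pos hδ hdk
      have hδδd : δ * (δ * d k) ≤ d k / 1000000 := by nlinarith
      rw [hd4] at h4 h5
      have he₁' := hc₁.isGap.norm_eq
      have he₂' := hc₂.isGap.norm_eq
      have hv₁' : |vc e₁' e₁| ≤ δ / 4000 := by rwa [vc_comm, abs_neg]
      have hv₂' : |vc e₂' e₂| ≤ δ / 4000 := by rwa [vc_comm, abs_neg]
      rw [xc_comm] at hx₁ hx₂
      obtain ⟨h7, h8⟩ := aligned_trans he₁' hg₁.norm_eq he₂' (by linarith) (by linarith)
        hx₁ hv₁' h3 h6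
      rw [xc_comm] at h7
      rw [vc_comm, abs_neg] at h8
      obtain ⟨h9, h10⟩ := aligned_trans he₂' hg₁.norm_eq hg₂.norm_eq (by linarith) (by linarith)
        h7 h8 hx₂ hv₂'
      refine ⟨h9, hg₁.close_of_near hg₂ hΓ hdk hδ hδ1 h9 (by linarith) ?_ ?_⟩
      · refine (abs_xc_rot_le he₁' hg₁.norm_eq hv₁' h4 h5).trans ?_
        have : δ / 4000 * (δ * (4 * d k)) = δ * (δ * d k) / 1000 := by ring
        linarith
      · refine (abs_vc_rot_le he₁' hg₁.norm_eq hv₁' h4 h5).trans ?_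
        have : δ / 4000 * (80 * (4 * d k)) = 320 / 4000 * (δ * d k) := by ring
        linarith

end GapChain

lemma abs_sub_le_of_floor_eq {x y d : ℝ} (hd : 0 < d) (h : ⌊x / d⌋ = ⌊y / d⌋) : |x - y| ≤ d := by
  have h1 := Int.floor_le (x / d)
  have h2 := Int.lt_floor_add_one (x / d)
  have h3 := Int.floor_le (y / d)
  have h4 := Int.lt_floor_add_one (y / d)
  rw [h] at h1 h2
  have h5 : |x / d - y / d| ≤ 1 := by rw [abs_le]; constructor <;> linarith
  rwa [← sub_div, abs_div, abs_of_pos hd, div_le_one hd] at h5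

lemma sum_geometric_le {d : ℕ → ℝ} (hd : ∀ k, 0 < d k) (hd4 : ∀ k, d (k + 1) = 4 * d k) (j : ℕ) :
    ∑ k ∈ Finset.range j, d k ≤ d j := by
  induction j with
  | zero => simpa using (hd 0).le
  | succ j ih => rw [Finset.sum_range_succ, hd4]; linarith [hd j]

lemma sum_le_of_later_scales {d a b : ℕ → ℝ} (hd : ∀ k, 0 < d k) (hd4 : ∀ k, d (k + 1) = 4 * d k)
    (hb : ∀ j, 0 ≤ b j) {n : ℝ} (hn : 0 ≤ n) {N : ℕ}
    (hab : ∀ k, a k ≤ n * ∑ j ∈ Finset.Ioc k N, b j) :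
    ∑ k ∈ Finset.range N, a k * d k ≤ n * ∑ j ∈ Finset.range (N + 1), b j * d j := by
  calc ∑ k ∈ Finset.range N, a k * d k
      ≤ ∑ k ∈ Finset.range N, (n * ∑ j ∈ Finset.Ioc k N, b j) * d k :=
        Finset.sum_le_sum fun k _ => mul_le_mul_of_nonneg_right (hab k) (hd k).le
    _ = n * ∑ k ∈ Finset.range N, ∑ j ∈ Finset.Ioc k N, b j * d k := by
        rw [Finset.mul_sum]
        refine Finset.sum_congr rfl fun k _ => ?_
        rw [mul_assoc, Finset.sum_mul]
    _ = n * ∑ j ∈ Finset.range (N + 1), ∑ k ∈ Finset.range j, b j * d k := by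
        congr 1
        refine Finset.sum_comm' fun k j => ?_
        simp only [Finset.mem_range, Finset.mem_Ioc]
        omega
    _ ≤ n * ∑ j ∈ Finset.range (N + 1), b j * d j := by
        refine mul_le_mul_of_nonneg_left (Finset.sum_le_sum fun j _ => ?_) hn
        rw [← Finset.mul_sum]
        exact mul_le_mul_of_nonneg_left (sum_geometric_le hd hd4 j) (hb j)

lemma sum_gap_items_le {Γ : Set Plane} {δ : ℝ} {P : Plane → ℝ → Plane → Prop} {d : ℕ → ℝ}
    (hΓ : CurveConnected Γ) (hδ : 0 < δ) (hδ1 : δ ≤ 1 / 2000) (hd : ∀ k, 0 < d k)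
    (hd4 : ∀ k, d (k + 1) = 4 * d k) (H : FlatUnless Γ δ P) {N : ℕ}
    (hN : ∀ m k e, IsGap Γ δ e (d k) m → k < N) (𝓜 : Finset Plane) {n : ℕ}
    (hn : 4 * (48 * 200 + 1) * (2 * (200 + 1) + 1) ^ 2 ≤ (n : ℝ)) :
    ∑ k ∈ Finset.range N, ((items δ (d k) 𝓜 fun φ m => ∃ e, IsGap Γ δ e (d k) m ∧ 0 < xc φ e ∧
        |vc φ e| ≤ δ).card : ℝ) * d k ≤
      n * ∑ j ∈ Finset.range (N + 1), ((items δ (d j) 𝓜 fun φ m => P φ (d j) m).card : ℝ) * d j := by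
  let I : ℕ → Finset (Plane × (ℤ × ℤ)) := fun k =>
    items δ (d k) 𝓜 fun φ m => ∃ e, IsGap Γ δ e (d k) m ∧ 0 < xc φ e ∧ |vc φ e| ≤ δ
  let J : ℕ → Finset (Plane × (ℤ × ℤ)) := fun j => items δ (d j) 𝓜 fun φ m => P φ (d j) m
  have hk : ∀ k, (I k).card ≤ n * ((Finset.Ioc k N).sigma J).card := by
    intro k
    have hdk := hd k
    have hdata : ∀ i ∈ I k, ∃ m e j ψ, m ∈ 𝓜 ∧ i.1 ∈ frames δ ∧ i.2 = cell δ (d k) i.1 m ∧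
        0 < xc i.1 e ∧ |vc i.1 e| ≤ δ ∧ GapChain Γ δ P d m k e j ψ := by
      intro i hi
      obtain ⟨φ, hφ, m, hm, ⟨e, he, hx, hv⟩, rfl⟩ := mem_items.1 hi
      obtain ⟨j, ψ, hc⟩ := GapChain.exists_of_isGap hΓ hδ (by linarith) hd hd4 H (hN m) he
      exact ⟨m, e, j, ψ, hm, hφ, rfl, hx, hv, hc⟩
    choose! m e j ψ hm hφ hcell hx hv hc using hdata
    refine Finset.card_le_mul_card_image_of_maps_to
      (f := fun i => (⟨j i, (ψ i, cell δ (d (j i)) (ψ i) (m i))⟩ : Σ _ : ℕ, Plane × (ℤ × ℤ)))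
      (fun i hi => ?_) n (fun b _ => ?_)
    · have hci := hc i hi
      refine Finset.mem_sigma.2 ⟨Finset.mem_Ioc.2 ⟨hci.lt, hci.le_of_isGap_lt (hN _)⟩, ?_⟩
      exact mem_items.2 ⟨_, hci.prop_end.1, _, hm i hi, hci.prop_end.2, rfl⟩
    · rcases Finset.eq_empty_or_nonempty ((I k).filter fun i =>
        (⟨j i, (ψ i, cell δ (d (j i)) (ψ i) (m i))⟩ : Σ _ : ℕ, Plane × (ℤ × ℤ)) = b)
        with hemp | ⟨i₁, hmem₁⟩
      · rw [hemp]; exact Nat.zero_le _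
      obtain ⟨hi₁, rfl⟩ := Finset.mem_filter.1 hmem₁
      have hδd : 0 < δ * d k := mul_pos hδ hdk
      have hδδd : δ * (δ * d k) ≤ d k / 1000000 := by nlinarith
      have hgoal := card_near_items_le hδ (by linarith) hdk (A := 200) (by norm_num) (by linarith)
        (e := e i₁) (m := m i₁) (hc i₁ hi₁).isGap.norm_eq (I := (I k).filter fun i =>
        (⟨j i, (ψ i, cell δ (d (j i)) (ψ i) (m i))⟩ : Σ _ : ℕ, Plane × (ℤ × ℤ)) =
          ⟨j i₁, (ψ i₁, cell δ (d (j i₁)) (ψ i₁) (m i₁))⟩) (by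
        intro i hi
        obtain ⟨hi, heq⟩ := Finset.mem_filter.1 hi
        obtain ⟨hj, heq'⟩ := Sigma.mk.inj heq
        obtain ⟨hψ, hcl⟩ := Prod.mk.inj (eq_of_heq heq')
        have hci := hc i hi
        rw [hj, hψ] at hci hcl
        have hφ1 := norm_of_mem_frames (hφ i hi)
        have hdj := hd (j i₁)
        obtain ⟨h1, h2⟩ := Prod.mk.inj hcl
        obtain ⟨h3, h4, h5, h6⟩ := (hc i₁ hi₁).close hΓ hδ (by linarith) hd hd4 hci
          (by rw [xc_sub]; exact abs_sub_le_of_floor_eq hdj h1)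
          (by rw [vc_sub]; exact abs_sub_le_of_floor_eq (mul_pos hδ hdj) h2)
        have he₁ := (hc i₁ hi₁).isGap.norm_eq
        have he := hci.isGap.norm_eq
        have hxi := hx i hi
        have hvi := hv i hi
        rw [xc_comm] at hxi h3
        rw [vc_comm, abs_neg] at hvi h6
        obtain ⟨h7, h8⟩ := aligned_trans he he₁ hφ1 (by linarith) (by linarith) h3 h6 hxi hvi
        refine ⟨hφ i hi, ?_, m i, hcell i hi, ?_, ?_⟩
        · rw [vc_comm, abs_neg]; linarith
        · refine (abs_xc_rot_le he₁ hφ1 h8 h4 h5).trans ?_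
          have : (δ + δ) * (δ * d k) = 2 * (δ * (δ * d k)) := by ring
          linarith
        · refine (abs_vc_rot_le he₁ hφ1 h8 h4 h5).trans ?_
          have : (δ + δ) * (80 * d k) = 160 * (δ * d k) := by ring
          linarith)
      exact_mod_cast hgoal.trans hn
  have hk' : ∀ k, ((I k).card : ℝ) ≤ n * ∑ j ∈ Finset.Ioc k N, ((J j).card : ℝ) := by
    intro k
    have := hk k
    rw [Finset.card_sigma] at this
    exact_mod_cast this
  exact sum_le_of_later_scales hd hd4 (fun j => Nat.cast_nonneg _) (Nat.cast_nonneg n) hk'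

lemma sum_geometric_cutoff_le {d : ℕ → ℝ} (hd : ∀ k, 0 < d k) (hd4 : ∀ k, d (k + 1) = 4 * d k)
    {L : ℝ} (hL : 0 ≤ L) (N : ℕ) : ∑ k ∈ Finset.range N, (if d k ≤ L then d k else 0) ≤ 2 * L := by
  induction N with
  | zero => simpa using hL
  | succ N ih =>
    rw [Finset.sum_range_succ]
    split_ifs with h
    · have : ∑ k ∈ Finset.range N, (if d k ≤ L then d k else 0) ≤ ∑ k ∈ Finset.range N, d k :=
        Finset.sum_le_sum fun k _ => by split_ifs <;> [rfl; exact (hd k).le]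
      have := sum_geometric_le hd hd4 N
      linarith
    · simpa using ih

/-- At scale `d`, near `m`, there is a segment of `T` of length at least `d / 100` that is almost
parallel to `φ`. -/
def EdgeNear (T : Finset (Plane × Plane)) (δ d : ℝ) (φ m : Plane) : Prop :=
  ∃ x ∈ T, d ≤ 100 * ‖x.1 - x.2‖ ∧ |vc φ (unit (x.1 - x.2))| ≤ 100 * δ ∧
    |xc φ (m - x.1)| ≤ 100 * d ∧ |vc φ (m - x.1)| ≤ 100 * (δ * d)

lemma sum_edge_items_le (T : Finset (Plane × Plane)) {δ : ℝ} {d : ℕ → ℝ} (hδ : 0 < δ)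
    (hδ1 : δ ≤ 1 / 2000) (hd : ∀ k, 0 < d k) (hd4 : ∀ k, d (k + 1) = 4 * d k) (N : ℕ)
    (𝓜 : Finset Plane) {n : ℝ} (hn : 4 * (48 * 100 + 1) * (2 * (100 + 1) + 1) ^ 2 ≤ n) :
    ∑ k ∈ Finset.range N, ((items δ (d k) 𝓜 (EdgeNear T δ (d k))).card : ℝ) * d k ≤
      200 * n * gweight T := by
  let Q : ℕ → Plane × Plane → Plane → Plane → Prop := fun k x φ m =>
    |vc φ (unit (x.1 - x.2))| ≤ 100 * δ ∧
    |xc φ (m - x.1)| ≤ 100 * d k ∧ |vc φ (m - x.1)| ≤ 100 * (δ * d k)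
  have hk : ∀ k, ((items δ (d k) 𝓜 (EdgeNear T δ (d k))).card : ℝ) ≤
      ∑ x ∈ T, if d k ≤ 100 * ‖x.1 - x.2‖ then n else 0 := by
    intro k
    have hsub : items δ (d k) 𝓜 (EdgeNear T δ (d k)) ⊆
        (T.filter fun x => d k ≤ 100 * ‖x.1 - x.2‖).biUnion fun x => items δ (d k) 𝓜 (Q k x) := by
      intro i hi
      obtain ⟨φ, hφ, m, hm, ⟨x, hx, h1, h2⟩, rfl⟩ := mem_items.1 hi
      exact Finset.mem_biUnion.2 ⟨x, Finset.mem_filter.2 ⟨hx, h1⟩,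
        mem_items.2 ⟨φ, hφ, m, hm, h2, rfl⟩⟩
    have h1 : ((items δ (d k) 𝓜 (EdgeNear T δ (d k))).card : ℝ) ≤
        ∑ x ∈ T.filter (fun x => d k ≤ 100 * ‖x.1 - x.2‖), ((items δ (d k) 𝓜 (Q k x)).card : ℝ) := by
      exact_mod_cast (Finset.card_le_card hsub).trans Finset.card_biUnion_le
    rw [← Finset.sum_filter]
    refine h1.trans (Finset.sum_le_sum fun x hx => ?_)
    have hpos : 0 < ‖x.1 - x.2‖ := by
      have := (Finset.mem_filter.1 hx).2; have := hd k; linarith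
    refine (card_near_items_le hδ (by linarith) (hd k) (A := 100) (by norm_num) (by linarith)
      (e := unit (x.1 - x.2)) (m := x.1) (norm_unit (norm_pos_iff.1 hpos)) ?_).trans hn
    intro i hi
    obtain ⟨φ, hφ, m, -, ⟨h1, h2, h3⟩, rfl⟩ := mem_items.1 hi
    exact ⟨hφ, h1, m, rfl, h2, h3⟩
  have hn0 : 0 ≤ n := le_trans (by norm_num) hn
  calc ∑ k ∈ Finset.range N, ((items δ (d k) 𝓜 (EdgeNear T δ (d k))).card : ℝ) * d k
      ≤ ∑ k ∈ Finset.range N, ∑ x ∈ T, n * (if d k ≤ 100 * ‖x.1 - x.2‖ then d k else 0) := by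
        refine Finset.sum_le_sum fun k _ => ?_
        refine (mul_le_mul_of_nonneg_right (hk k) (hd k).le).trans_eq ?_
        rw [Finset.sum_mul]
        refine Finset.sum_congr rfl fun x _ => ?_
        split_ifs <;> simp
    _ = ∑ x ∈ T, n * ∑ k ∈ Finset.range N, (if d k ≤ 100 * ‖x.1 - x.2‖ then d k else 0) := by
        rw [Finset.sum_comm]
        simp only [Finset.mul_sum]
    _ ≤ ∑ x ∈ T, n * (2 * (100 * ‖x.1 - x.2‖)) := by
        refine Finset.sum_le_sum fun x _ => mul_le_mul_of_nonneg_left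
          (sum_geometric_cutoff_le hd hd4 (by positivity) N) hn0
    _ = _ := by
        rw [gweight, Finset.mul_sum]
        exact Finset.sum_congr rfl fun x _ => by ring

lemma abs_xc_sub_le_of_mem_segment {e m p a b : Plane} {c : ℝ} (hp : p ∈ segment ℝ a b)
    (ha : |xc e (a - m)| ≤ c) (hb : |xc e (b - m)| ≤ c) : |xc e (p - m)| ≤ c := by
  obtain ⟨α, β, hα, hβ, hαβ, rfl⟩ := hp
  have h : xc e (α • a + β • b - m) = α * xc e (a - m) + β * xc e (b - m) := by
    rw [xc_sub, xc_add, xc_smul, xc_smul, xc_sub, xc_sub]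
    linear_combination xc e m * hαβ
  rw [h]
  calc |α * xc e (a - m) + β * xc e (b - m)| ≤ α * |xc e (a - m)| + β * |xc e (b - m)| := by
        refine (abs_add_le _ _).trans_eq ?_
        rw [abs_mul, abs_mul, abs_of_nonneg hα, abs_of_nonneg hβ]
    _ ≤ α * c + β * c := by gcongr
    _ = c := by rw [← add_mul, hαβ, one_mul]

namespace Flat

variable {Γ : Set Plane} {δ d : ℝ} {e m : Plane}

lemma neg (h : Flat Γ δ e d m) : Flat Γ δ (-e) d m := by
  intro p hp hx hv
  rw [xc_neg_left, abs_neg] at hx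
  rw [vc_neg_left, abs_neg] at hv ⊢
  exact h p hp hx hv

lemma of_isPreconnected (h : Flat Γ δ e d m) (hδd : 0 < δ * d) {K : Set Plane}
    (hK : IsPreconnected K) (hKΓ : K ⊆ Γ) (hKx : ∀ p ∈ K, |xc e (p - m)| ≤ 10000 * d)
    {p q : Plane} (hp : p ∈ K) (hpv : |vc e (p - m)| ≤ 10000 * (δ * d)) (hq : q ∈ K) :
    |vc e (q - m)| ≤ δ * d / 100 := by
  have hp1 := abs_le.1 (h p (hKΓ hp) (hKx p hp) hpv)
  have key : ∀ o : ℝ, |o| = δ * d → o ∉ Set.uIcc (vc e (p - m)) (vc e (q - m)) := by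
    intro o ho hmem
    obtain ⟨y, hy, hyo⟩ := hK.exists_eq (f := fun y => vc e (y - m))
      ((continuous_vc e).comp (continuous_id.sub continuous_const)) hp hq hmem
    have := h y (hKΓ hy) (hKx y hy) (by rw [show vc e (y - m) = o from hyo, ho]; linarith)
    rw [show vc e (y - m) = o from hyo, ho] at this
    linarith
  refine h q (hKΓ hq) (hKx q hq) (abs_le.2 ⟨?_, ?_⟩)
  · by_contra! hlt
    exact key (-(δ * d)) (by rw [abs_neg, abs_of_pos hδd])
      (Set.mem_uIcc.2 (Or.inr ⟨by linarith, by linarith⟩))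
  · by_contra! hlt
    exact key (δ * d) (abs_of_pos hδd) (Set.mem_uIcc.2 (Or.inl ⟨by linarith, by linarith⟩))

lemma of_segment (h : Flat Γ δ e d m) (hδd : 0 < δ * d) {a b p q : Plane}
    (hab : segment ℝ a b ⊆ Γ) (ha : |xc e (a - m)| ≤ 10000 * d) (hb : |xc e (b - m)| ≤ 10000 * d)
    (hp : p ∈ segment ℝ a b) (hpv : |vc e (p - m)| ≤ 10000 * (δ * d)) (hq : q ∈ segment ℝ a b) :
    |vc e (q - m)| ≤ δ * d / 100 :=
  h.of_isPreconnected hδd (convex_segment a b).isPreconnected hab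
    (fun _ hy => abs_xc_sub_le_of_mem_segment hy ha hb) hp hpv hq

lemma of_joinedIn (h : Flat Γ δ e d m) (he : ‖e‖ = 1) (hδd : 0 < δ * d) {u z : Plane} {a ρ : ℝ}
    (hu : |xc e (u - m)| ≤ a) (huv : |vc e (u - m)| ≤ 10000 * (δ * d)) (haρ : a + ρ ≤ 10000 * d)
    (hz : JoinedIn (Γ ∩ Metric.closedBall u ρ) u z) :
    |xc e (z - m)| ≤ a + ρ ∧ |vc e (z - m)| ≤ δ * d / 100 := by
  have hx : ∀ p ∈ Metric.closedBall u ρ, |xc e (p - m)| ≤ a + ρ := by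
    intro p hp
    rw [mem_closedBall_iff_norm] at hp
    have h1 := abs_xc_le he (p - u)
    rw [show p - m = (u - m) + (p - u) by abel, xc_add]
    exact (abs_add_le _ _).trans (by linarith)
  have hmem : ∀ t, hz.somePath t ∈ Γ ∩ Metric.closedBall u ρ := hz.somePath_mem
  refine ⟨hx z hz.target_mem.2, h.of_isPreconnected hδd (K := Set.range hz.somePath)
    (isPreconnected_range hz.somePath.continuous) ?_ ?_ (p := u) ⟨0, hz.somePath.source⟩ huv
    ⟨1, hz.somePath.target⟩⟩
  · rintro _ ⟨t, rfl⟩; exact (hmem t).1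
  · rintro _ ⟨t, rfl⟩; exact (hx _ (hmem t).2).trans haρ

end Flat

lemma xc_le_of_edge {S : Finset Plane} {T : Finset (Plane × Plane)} (hT : IsSpanningTree S T)
    (hmin : gweight T = mst S) {δ d : ℝ} {e m : Plane} (he : ‖e‖ = 1) (hδ : 0 < δ) (hδ1 : δ ≤ 1)
    (hd : 0 < d) (hflat : Flat (segUnion T) δ e d m) {a b h t : Plane} (hab : EAdj T a b)
    (hh : h ∈ segment ℝ a b) (hhx : |xc e (h - m)| ≤ 2 * d)
    (hhv : |vc e (h - m)| ≤ 10000 * (δ * d)) (ht : t ∈ S) (ht1 : 8 * d ≤ xc e (t - m))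
    (ht2 : xc e (t - m) ≤ 32 * d) (htv : vc e (t - m) = 0) : xc e (b - m) ≤ 36 * d := by
  by_contra! hb
  have hδd : 0 < δ * d := mul_pos hδ hd
  have hδd1 : δ * d ≤ d := by nlinarith
  have hhx' := abs_le.1 hhx
  have hhb : segment ℝ h b ⊆ segment ℝ a b :=
    (convex_segment a b).segment_subset hh (right_mem_segment ℝ a b)
  obtain ⟨y, hy, hyx⟩ := (convex_segment (𝕜 := ℝ) h b).isPreconnected.exists_eq
    (f := fun y => xc e (y - m)) ((continuous_xc e).comp (continuous_id.sub continuous_const))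
    (left_mem_segment ℝ h b) (right_mem_segment ℝ h b) (o := xc e (t - m))
    (Set.mem_uIcc.2 (Or.inl ⟨by linarith, by linarith⟩))
  replace hyx : xc e (y - m) = xc e (t - m) := hyx
  have hhy : segment ℝ h y ⊆ segUnion T :=
    ((convex_segment h b).segment_subset (left_mem_segment ℝ h b) hy).trans
      (hhb.trans hab.segment_subset)
  have hyv := hflat.of_segment hδd hhy (by linarith) (by rw [hyx, abs_le]; constructor <;> linarith)
    (left_mem_segment ℝ h y) hhv (right_mem_segment ℝ h y)
  have hyt : ‖y - t‖ ≤ d := by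
    refine (norm_le_abs_add he _).trans ?_
    have h1 : y - t = (y - m) - (t - m) := by abel
    rw [h1, xc_sub, vc_sub, hyx, htv, sub_self, abs_zero, sub_zero]
    linarith
  have h1 := dist_add_dist_of_mem_segment hh
  have h2 := dist_add_dist_of_mem_segment hy
  simp only [dist_eq_norm] at h1 h2
  have h3 : ‖a - y‖ ≤ ‖a - h‖ + ‖h - y‖ := by simpa using norm_add_le (a - h) (h - y)
  have h4 : 4 * d ≤ ‖y - b‖ := by
    have h5 := xc_le_norm he (b - y)
    rw [show b - y = (b - m) - (y - m) by abel, xc_sub, hyx] at h5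
    rw [norm_sub_rev, show b - y = (b - m) - (y - m) by abel]; linarith
  have h6 : 6 * d ≤ ‖h - y‖ := by
    have h5 := xc_le_norm he (y - h)
    rw [show y - h = (y - m) - (h - m) by abel, xc_sub, hyx] at h5
    rw [norm_sub_rev, show y - h = (y - m) - (h - m) by abel]; linarith
  have h7 : ‖a - t‖ ≤ ‖a - y‖ + ‖y - t‖ := by simpa using norm_add_le (a - y) (y - t)
  have h8 : ‖t - b‖ ≤ ‖t - y‖ + ‖y - b‖ := by simpa using norm_add_le (t - y) (y - b)
  rw [norm_sub_rev t y] at h8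
  have h9 := norm_nonneg (a - h)
  exact hT.not_exchange hmin hab ht ⟨by linarith, by linarith⟩

lemma edgeNear_of_edge {S : Finset Plane} {T : Finset (Plane × Plane)} (hT : IsSpanningTree S T)
    (hmin : gweight T = mst S) {δ d : ℝ} {e m φ : Plane} (he : ‖e‖ = 1) (hφ : ‖φ‖ = 1) (hδ : 0 < δ)
    (hδ1 : δ ≤ 1) (hd : 0 < d) (hφe : |vc e φ| ≤ δ) (hflat : Flat (segUnion T) δ e d m)
    {a b h s t : Plane} (hab : EAdj T a b) (hlen : d ≤ 100 * ‖a - b‖)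
    (hh : h ∈ segment ℝ a b) (hhx : |xc e (h - m)| ≤ 2 * d)
    (hhv : |vc e (h - m)| ≤ 10000 * (δ * d)) (hs : s ∈ S) (hs1 : xc e (s - m) ≤ -(8 * d))
    (hs2 : -(32 * d) ≤ xc e (s - m)) (hsv : vc e (s - m) = 0) (ht : t ∈ S)
    (ht1 : 8 * d ≤ xc e (t - m)) (ht2 : xc e (t - m) ≤ 32 * d) (htv : vc e (t - m) = 0) :
    EdgeNear T δ d φ m := by
  wlog hmem : (a, b) ∈ T generalizing a b
  · refine this hab.symm (by rwa [norm_sub_rev]) (by rwa [segment_symm]) ?_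
    exact hab.resolve_left hmem
  have hδd : 0 < δ * d := mul_pos hδ hd
  have hδδd : δ * (δ * d) ≤ d := by nlinarith
  have key : ∀ {a b : Plane}, EAdj T a b → h ∈ segment ℝ a b → |xc e (b - m)| ≤ 36 * d := by
    intro a b hab hh
    rw [abs_le]
    constructor
    · have := xc_le_of_edge hT hmin (e := -e) (by rwa [norm_neg]) hδ hδ1 hd hflat.neg hab hh
        (by rwa [xc_neg_left, abs_neg]) (by rwa [vc_neg_left, abs_neg]) hs
        (by rw [xc_neg_left]; linarith) (by rw [xc_neg_left]; linarith)
        (by rw [vc_neg_left, hsv, neg_zero])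
      rw [xc_neg_left] at this
      linarith
    · exact xc_le_of_edge hT hmin he hδ hδ1 hd hflat hab hh hhx hhv ht ht1 ht2 htv
  have hbx := key hab hh
  have hax := key hab.symm (by rwa [segment_symm])
  have hav := hflat.of_segment hδd hab.segment_subset (by linarith) (by linarith) hh hhv
    (left_mem_segment ℝ a b)
  have hbv := hflat.of_segment hδd hab.segment_subset (by linarith) (by linarith) hh hhv
    (right_mem_segment ℝ a b)
  have hpos : 0 < ‖a - b‖ := by linarith
  have hu := norm_unit (norm_pos_iff.1 hpos)
  have huv : |vc e (unit (a - b))| ≤ 2 * δ := by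
    rw [unit, vc_smul, abs_mul, abs_inv, abs_norm, inv_mul_le_iff₀ hpos,
      show a - b = (a - m) - (b - m) by abel, vc_sub, show a - m - (b - m) = a - b by abel]
    refine (abs_sub _ _).trans ?_
    have : δ * d ≤ δ * (100 * ‖a - b‖) := by gcongr
    linarith
  have hma : xc e (m - a) = - xc e (a - m) ∧ vc e (m - a) = - vc e (a - m) := by
    rw [xc_sub, vc_sub, xc_sub, vc_sub]; constructor <;> ring
  have hax' : |xc e (m - a)| ≤ 36 * d := by rwa [hma.1, abs_neg]
  have hav' : |vc e (m - a)| ≤ δ * d / 100 := by rwa [hma.2, abs_neg]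
  refine ⟨(a, b), hmem, hlen, ?_, ?_, ?_⟩
  · refine (abs_vc_rot_le he hφ hφe ((abs_xc_le he _).trans hu.le) huv).trans ?_
    linarith
  · refine (abs_xc_rot_le he hφ hφe hax' hav').trans ?_
    have : δ * (δ * d / 100) = δ * (δ * d) / 100 := by ring
    linarith
  · refine (abs_vc_rot_le he hφ hφe hax' hav').trans ?_
    have : δ * (36 * d) = 36 * (δ * d) := by ring
    linarith

lemma norm_detour_le {δ d : ℝ} {e m s t z z' : Plane} (he : ‖e‖ = 1) (hδ : 0 < δ) (hδ1 : δ ≤ 1 / 10)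
    (hd : 0 < d) (hs : xc e (s - m) ≤ -(8 * d)) (hsv : vc e (s - m) = 0)
    (ht : 8 * d ≤ xc e (t - m)) (htv : vc e (t - m) = 0) (hz : |xc e (z - m)| ≤ d)
    (hzv : |vc e (z - m)| ≤ δ * d / 100) (hz' : |xc e (z' - m)| ≤ d)
    (hzv' : |vc e (z' - m)| ≤ δ * d / 100) (hzz : d / 100 ≤ ‖z - z'‖)
    (hord : xc e (z - m) ≤ xc e (z' - m)) :
    ‖s - z‖ + ‖z - z'‖ + ‖z' - t‖ ≤ ‖s - t‖ + 3 * δ ^ 2 * d := by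
  have hδd : 0 < δ * d := mul_pos hδ hd
  have hδd1 : δ * d ≤ d / 10 := by nlinarith
  have hx1 := abs_le.1 hz
  have hx2 := abs_le.1 hz'
  have hv1 := abs_le.1 hzv
  have hv2 := abs_le.1 hzv'
  have hc : 0 ≤ δ ^ 2 * d := by positivity
  have step : ∀ p q : Plane, d / 200 ≤ xc e (q - p) → |vc e (q - p)| ≤ δ * d / 50 →
      ‖p - q‖ ≤ xc e (q - p) + δ ^ 2 * d := by
    intro p q hx hv
    rw [norm_sub_rev]
    refine norm_le_xc_add he _ hc (by linarith) ?_ rfl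
    have h1 : vc e (q - p) ^ 2 ≤ (δ * d / 50) ^ 2 := sq_le_sq' (by linarith [(abs_le.1 hv).1])
      (abs_le.1 hv).2
    have h2 : 2 * (δ ^ 2 * d) * (d / 200) ≤ 2 * (δ ^ 2 * d) * xc e (q - p) := by gcongr
    have h3 : (δ * d / 50) ^ 2 = δ ^ 2 * d ^ 2 / 2500 := by ring
    have h4 : 2 * (δ ^ 2 * d) * (d / 200) = δ ^ 2 * d ^ 2 / 100 := by ring
    have h5 : 0 ≤ δ ^ 2 * d ^ 2 := by positivity
    linarith
  have e1 : ∀ p q : Plane, xc e (q - p) = xc e (q - m) - xc e (p - m) := by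
    intro p q; rw [← xc_sub]; congr 1; abel
  have e2 : ∀ p q : Plane, vc e (q - p) = vc e (q - m) - vc e (p - m) := by
    intro p q; rw [← vc_sub]; congr 1; abel
  have hzz2 := norm_le_abs_add he (z' - z)
  rw [norm_sub_rev, e1, e2, abs_of_nonneg (by linarith)] at hzz2
  have hvz : |vc e (z' - m) - vc e (z - m)| ≤ δ * d / 50 := by
    rw [abs_le]; constructor <;> linarith
  have h1 := step s z (by rw [e1]; linarith) (by rw [e2, hsv, sub_zero]; linarith)
  have h2 := step z z' (by rw [e1]; linarith) (by rw [e2]; exact hvz)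
  have h3 := step z' t (by rw [e1]; linarith) (by rw [e2, htv, zero_sub, abs_neg]; linarith)
  have h4 := xc_le_norm he (t - s)
  rw [norm_sub_rev t s] at h4
  rw [e1] at h1 h2 h3 h4
  linarith

lemma pair_cases {S : Finset Plane} {T E : Finset (Plane × Plane)} (hT : IsSpanningTree S T)
    (hmin : gweight T = mst S) {δ d η : ℝ} (hδ : 0 < δ) (hδ1 : δ ≤ 1 / 10) (hd : 0 < d)
    {P : Plane → ℝ → Plane → Prop} (H : FlatUnless (segUnion T) δ P)
    (hE : ∀ u ∈ S, (∃ w ∈ S, 4 * (d / 100) < ‖u - w‖) →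
        (∃ z ∈ S, ∃ z' ∈ S, JoinedIn (segUnion T ∩ Metric.closedBall u (12 * (d / 100))) u z ∧
          JoinedIn (segUnion T ∩ Metric.closedBall u (12 * (d / 100))) u z' ∧ d / 100 ≤ ‖z - z'‖ ∧
          HasPath E z z' ((1 + η) * ‖z - z'‖)) ∨
        ∃ a b, EAdj T a b ∧ JoinedIn (segUnion T ∩ Metric.closedBall u (12 * (d / 100))) u a ∧
          d / 100 ≤ ‖a - b‖)
    {s t φ : Plane} (hs : s ∈ S) (ht : t ∈ S) (hsΓ : s ∈ segUnion T) (htΓ : t ∈ segUnion T)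
    (h16 : 16 * d ≤ ‖t - s‖) (h64 : ‖t - s‖ ≤ 64 * d) (hφ : ‖φ‖ = 1) (hφx : 0 < xc φ (t - s))
    (hφv : |vc φ (t - s)| ≤ δ * xc φ (t - s)) :
    (P φ d (midpoint ℝ s t) ∨
      (∃ e, IsGap (segUnion T) δ e d (midpoint ℝ s t) ∧ 0 < xc φ e ∧ |vc φ e| ≤ δ) ∨
      EdgeNear T δ d φ (midpoint ℝ s t)) ∨
    ∃ z ∈ S, ∃ z' ∈ S, HasPath E z z' ((1 + η) * ‖z - z'‖) ∧ d / 100 ≤ ‖z - z'‖ ∧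
      ‖s - z‖ + ‖z - z'‖ + ‖z' - t‖ ≤ ‖s - t‖ + 3 * δ ^ 2 * d := by
  set m := midpoint ℝ s t
  have hδd : 0 < δ * d := mul_pos hδ hd
  have hpos : 0 < ‖t - s‖ := by linarith
  have hne : t - s ≠ 0 := norm_pos_iff.1 hpos
  set e := unit (t - s) with he_def
  have he : ‖e‖ = 1 := norm_unit hne
  have hex : xc e (t - s) = ‖t - s‖ := xc_unit_self hne
  have hev : vc e (t - s) = 0 := vc_unit_self _
  have hms : m - s = (1 / 2 : ℝ) • (t - s) := by
    rw [midpoint_sub_left]; norm_num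
  have hsm : s - m = (-(1 / 2) : ℝ) • (t - s) := by
    rw [← neg_sub, hms, neg_smul]
  have htm : t - m = (1 / 2 : ℝ) • (t - s) := by
    rw [show t - m = (t - s) - (m - s) by abel, hms]; module
  have hsx : xc e (s - m) = -(1 / 2) * ‖t - s‖ := by rw [hsm, xc_smul, hex]
  have hsv : vc e (s - m) = 0 := by rw [hsm, vc_smul, hev, mul_zero]
  have htx : xc e (t - m) = 1 / 2 * ‖t - s‖ := by rw [htm, xc_smul, hex]
  have htv : vc e (t - m) = 0 := by rw [htm, vc_smul, hev, mul_zero]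
  have hφe : |vc φ e| ≤ δ := by
    rw [he_def, unit, vc_smul, abs_mul, abs_inv, abs_norm, inv_mul_le_iff₀ hpos]
    refine hφv.trans ?_
    rw [mul_comm]
    gcongr
    exact xc_le_norm hφ _
  have hφex : 0 < xc φ e := by
    rw [he_def, unit, xc_smul]; positivity
  have hφe' : |vc e φ| ≤ δ := by rwa [vc_comm, abs_neg]
  by_cases hP : P φ d m
  · exact Or.inl (Or.inl hP)
  have hflat : Flat (segUnion T) δ e d m := by
    refine H d hd s hsΓ t htΓ m φ (by linarith) h64 ?_ ?_ hφ hφx hφv hP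
    · rw [hms, xc_smul, hex, abs_le]; constructor <;> linarith
    · rw [hms, vc_smul, hev, mul_zero, abs_zero]; linarith
  by_cases hgap : ∃ h ∈ segUnion T, xc e (h - m) = 0 ∧ |vc e (h - m)| ≤ 10000 * (δ * d)
  swap
  · refine Or.inl (Or.inr (Or.inl ⟨e, ⟨he, hflat, ⟨s, hsΓ, ?_, ?_, ?_⟩, ⟨t, htΓ, ?_, ?_, ?_⟩, ?_⟩,
      hφex, hφe⟩))
    · linarith
    · linarith
    · rw [hsv, abs_zero]; linarith
    · linarith
    · linarith
    · rw [htv, abs_zero]; linarith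
    · rintro γ hγ a b hab hmem ⟨h1, h2⟩
      obtain ⟨τ, hτ, hτ0⟩ := intermediate_value_Icc hab (f := fun τ => xc e (γ τ - m))
        (((continuous_xc e).comp (hγ.sub continuous_const)).continuousOn)
        (show (0 : ℝ) ∈ _ from ⟨by linarith, by linarith⟩)
      exact hgap ⟨γ τ, (hmem τ hτ).1, hτ0, (hmem τ hτ).2.2⟩
  have edge : ∀ {a b h : Plane}, EAdj T a b → d ≤ 100 * ‖a - b‖ → h ∈ segment ℝ a b →
      |xc e (h - m)| ≤ 2 * d → |vc e (h - m)| ≤ 10000 * (δ * d) → EdgeNear T δ d φ m := by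
    intro a b h h1 h2 h3 h4 h5
    exact edgeNear_of_edge hT hmin he hφ hδ (by linarith) hd hφe' hflat h1 h2 h3 h4 h5 hs
      (by linarith) (by linarith) hsv ht (by linarith) (by linarith) htv
  obtain ⟨h, hhΓ, hhx, hhv⟩ := hgap
  obtain ⟨⟨a, b⟩, habT, hh⟩ := Set.mem_iUnion₂.1 hhΓ
  have hab : EAdj T a b := Or.inl habT
  by_cases hlen : d ≤ 100 * ‖a - b‖
  · exact Or.inl (Or.inr (Or.inr (edge hab hlen hh (by rw [hhx, abs_zero]; linarith) hhv)))
  have h1 := dist_add_dist_of_mem_segment hh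
  simp only [dist_eq_norm] at h1
  have hnear : ∀ p : Plane, ‖p - h‖ ≤ d / 100 → |xc e (p - m)| ≤ d / 100 := by
    intro p hp
    rw [show p - m = (p - h) + (h - m) by abel, xc_add, hhx, add_zero]
    exact (abs_xc_le he _).trans hp
  have hax : |xc e (a - m)| ≤ d / 100 := hnear a (by linarith [norm_nonneg (h - b)])
  have hbx : |xc e (b - m)| ≤ d / 100 :=
    hnear b (by rw [norm_sub_rev]; linarith [norm_nonneg (a - h)])
  have hav : |vc e (a - m)| ≤ δ * d / 100 :=
    hflat.of_segment hδd hab.segment_subset (by linarith) (by linarith) hh hhv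
      (left_mem_segment ℝ a b)
  have hfar : 4 * (d / 100) < ‖a - s‖ := by
    have h2 := xc_le_norm he (a - s)
    rw [show a - s = (a - m) - (s - m) by abel, xc_sub, hsx] at h2
    rw [show a - s = (a - m) - (s - m) by abel]
    linarith [(abs_le.1 hax).1]
  rcases hE a (hT.1 _ habT).1 ⟨s, hs, hfar⟩ with
    ⟨z, hz, z', hz', hjz, hjz', hzz, hpath⟩ | ⟨a', b', hab', hj, hlen'⟩
  · obtain ⟨hzx, hzv⟩ := hflat.of_joinedIn he hδd hax (by linarith) (by linarith) hjz
    obtain ⟨hzx', hzv'⟩ := hflat.of_joinedIn he hδd hax (by linarith) (by linarith) hjz'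
    right
    rcases le_total (xc e (z - m)) (xc e (z' - m)) with hord | hord
    · exact ⟨z, hz, z', hz', hpath, hzz, norm_detour_le he hδ hδ1 hd (by linarith) hsv
        (by linarith) htv (by linarith) hzv (by linarith) hzv' hzz hord⟩
    · rw [norm_sub_rev z z'] at hpath hzz
      exact ⟨z', hz', z, hz, hpath.symm, hzz, norm_detour_le he hδ hδ1 hd (by linarith) hsv
        (by linarith) htv (by linarith) hzv' (by linarith) hzv hzz hord⟩
  · obtain ⟨hax', hav'⟩ := hflat.of_joinedIn he hδd hax (by linarith) (by linarith) hj
    exact Or.inl (Or.inr (Or.inr (edge hab' (by linarith) (left_mem_segment ℝ a' b')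
      (by linarith) (by linarith))))

/-- The pair `(s, t)` is almost served by `E` at scale `d`: it has a short detour through a pair of
`S` at distance at least `13 * d` that is joined by a short path. -/
def Served (S : Finset Plane) (E : Finset (Plane × Plane)) (δ d : ℝ) (s t : Plane) : Prop :=
  ∃ z ∈ S, ∃ z' ∈ S, 13 * d ≤ ‖z - z'‖ ∧ HasPath E z z' ((1 + 32000 * δ ^ 2) * ‖z - z'‖) ∧
    ‖s - z‖ + ‖z - z'‖ + ‖z' - t‖ ≤ ‖s - t‖ + 128000 * δ ^ 2 * d

lemma Served.mono {S : Finset Plane} {E F : Finset (Plane × Plane)} {δ d : ℝ} {s t : Plane}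
    (h : Served S E δ d s t) (hEF : E ⊆ F) : Served S F δ d s t := by
  obtain ⟨z, hz, z', hz', h1, h2, h3⟩ := h
  exact ⟨z, hz, z', hz', h1, h2.mono hEF le_rfl, h3⟩

lemma mem_Ico_of_floor_eq {x d : ℝ} {i : ℤ} (hd : 0 < d) (h : ⌊x / d⌋ = i) :
    i * d ≤ x ∧ x < i * d + d := by
  obtain ⟨h1, h2⟩ := Int.floor_eq_iff.1 h
  rw [le_div_iff₀ hd] at h1
  rw [div_lt_iff₀ hd] at h2
  exact ⟨h1, by linarith⟩

lemma exists_cell_pair_gadget (S : Finset Plane) {φ : Plane} (hφ : ‖φ‖ = 1) {δ d : ℝ} (hδ : 0 < δ)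
    (hδ1 : δ ≤ 1) (hd : 0 < d) {c c' : ℤ × ℤ} (h14 : 14 ≤ c'.1 - c.1) (h80 : c'.1 - c.1 ≤ 80)
    (hv : |c'.2 - c.2| ≤ 80) :
    ∃ E : Finset (Plane × Plane), gweight E ≤ 360 * d ∧ ∀ s ∈ S, ∀ t ∈ S, cell δ d φ s = c →
      cell δ d φ t = c' → Served S E δ d s t := by
  have hδd : 0 < δ * d := mul_pos hδ hd
  have hmem : ∀ c : ℤ × ℤ, ∀ a ∈ S.filter (fun a => cell δ d φ a = c),
      (c.1 * d ≤ xc φ a ∧ xc φ a < c.1 * d + d) ∧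
      (c.2 * (δ * d) ≤ vc φ a ∧ vc φ a < c.2 * (δ * d) + δ * d) := by
    intro c a ha
    have h := (Finset.mem_filter.1 ha).2
    exact ⟨mem_Ico_of_floor_eq hd (congrArg Prod.fst h),
      mem_Ico_of_floor_eq hδd (congrArg Prod.snd h)⟩
  obtain ⟨E, hE, h⟩ := exists_gadget hφ hδ hδ1 hd (R := 80) (by norm_num)
    (fun a ha => (hmem c a ha).1) (fun a ha => (hmem c a ha).2)
    (fun a ha => (hmem c' a ha).1) (fun a ha => (hmem c' a ha).2)
    (by
      rw [← sub_mul]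
      have : (14 : ℝ) ≤ c'.1 - c.1 := by exact_mod_cast h14
      gcongr)
    (by
      rw [← sub_mul]
      have : (c'.1 : ℝ) - c.1 ≤ 80 := by exact_mod_cast h80
      gcongr)
    (by
      rw [← sub_mul, abs_mul, abs_of_pos hδd]
      have : |(c'.2 : ℝ) - c.2| ≤ 80 := by exact_mod_cast hv
      gcongr)
  refine ⟨E, hE.trans_eq (by ring), fun s hs t ht hsc htc => ?_⟩
  obtain ⟨z, hz, z', hz', h1, h2, h3⟩ := h s (Finset.mem_filter.2 ⟨hs, hsc⟩) t
    (Finset.mem_filter.2 ⟨ht, htc⟩)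
  refine ⟨z, (Finset.mem_filter.1 hz).1, z', (Finset.mem_filter.1 hz').1, h1, ?_, ?_⟩
  · convert h2 using 3; ring
  · convert h3 using 2; ring

lemma exists_item_gadget (S : Finset Plane) {φ : Plane} (hφ : ‖φ‖ = 1) {δ d : ℝ} (hδ : 0 < δ)
    (hδ1 : δ ≤ 1 / 100) (hd : 0 < d) (c₀ : ℤ × ℤ) :
    ∃ E : Finset (Plane × Plane), gweight E ≤ 81 ^ 4 * 360 * d ∧ ∀ s ∈ S, ∀ t ∈ S,
      cell δ d φ (midpoint ℝ s t) = c₀ → 16 * d ≤ ‖t - s‖ → ‖t - s‖ ≤ 64 * d → 0 < xc φ (t - s) →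
      |vc φ (t - s)| ≤ δ * xc φ (t - s) → Served S E δ d s t := by
  have hδd : 0 < δ * d := mul_pos hδ hd
  let B : Finset (ℤ × ℤ) :=
    Finset.Icc (c₀.1 - 40) (c₀.1 + 40) ×ˢ Finset.Icc (c₀.2 - 40) (c₀.2 + 40)
  have hB : B.card = 81 ^ 2 := by
    rw [Finset.card_product, Int.card_Icc, Int.card_Icc,
      show c₀.1 + 40 + 1 - (c₀.1 - 40) = 81 by ring,
      show c₀.2 + 40 + 1 - (c₀.2 - 40) = 81 by ring]
    rfl
  have hex : ∀ x : (ℤ × ℤ) × (ℤ × ℤ), x ∈ B ×ˢ B →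
      ∃ E : Finset (Plane × Plane), gweight E ≤ 360 * d ∧
      (14 ≤ x.2.1 - x.1.1 → ∀ s ∈ S, ∀ t ∈ S, cell δ d φ s = x.1 →
      cell δ d φ t = x.2 → Served S E δ d s t) := by
    rintro ⟨c, c'⟩ hx
    simp only [B, Finset.mem_product, Finset.mem_Icc] at hx
    by_cases h14 : 14 ≤ c'.1 - c.1
    · obtain ⟨E, hE, h⟩ := exists_cell_pair_gadget S hφ hδ (by linarith) hd h14 (by omega)
        (by rw [abs_le]; omega)
      exact ⟨E, hE, fun _ => h⟩
    · exact ⟨∅, by simp only [gweight, Finset.sum_empty]; positivity, fun h => absurd h h14⟩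
  choose! G hG hserve using hex
  refine ⟨(B ×ˢ B).biUnion G, ?_, ?_⟩
  · calc gweight ((B ×ˢ B).biUnion G) ≤ ∑ x ∈ B ×ˢ B, gweight (G x) := gweight_biUnion_le _ _
      _ ≤ ∑ x ∈ B ×ˢ B, 360 * d := Finset.sum_le_sum hG
      _ = _ := by
        rw [Finset.sum_const, Finset.card_product, hB, nsmul_eq_mul]
        push_cast; ring
  · intro s hs t ht hm h16 h64 hx hv
    set m := midpoint ℝ s t
    have hms : m - s = (1 / 2 : ℝ) • (t - s) := by rw [midpoint_sub_left]; norm_num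
    have hsm : s - m = (-(1 / 2) : ℝ) • (t - s) := by rw [← neg_sub, hms, neg_smul]
    have htm : t - m = (1 / 2 : ℝ) • (t - s) := by
      rw [show t - m = (t - s) - (m - s) by abel, hms]; module
    have hx2 : xc φ (t - s) ≤ 64 * d := (xc_le_norm hφ _).trans h64
    have hv2 : |vc φ (t - s)| ≤ 64 * (δ * d) := by
      refine hv.trans ((mul_le_mul_of_nonneg_left hx2 hδ.le).trans_eq (by ring))
    have hv3 : |vc φ (t - s)| ≤ 1 / 100 * xc φ (t - s) := by
      refine hv.trans (mul_le_mul_of_nonneg_right hδ1 hx.le)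
    have hx1 : 15 * d ≤ xc φ (t - s) := by
      have := norm_le_abs_add hφ (t - s)
      rw [abs_of_pos hx] at this
      linarith
    have near : ∀ {x y d : ℝ}, 0 < d → |x - y| ≤ 32 * d →
        ⌊y / d⌋ - 40 ≤ ⌊x / d⌋ ∧ ⌊x / d⌋ ≤ ⌊y / d⌋ + 40 := by
      intro x y d hd h
      have h1 := abs_le.1 (abs_floor_div_sub_le hd h)
      have h2 := Int.floor_le (y / d)
      have h3 := Int.lt_floor_add_one (y / d)
      constructor
      · have : ((⌊y / d⌋ - 40 : ℤ) : ℝ) ≤ ⌊x / d⌋ := by push_cast; linarith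
        exact_mod_cast this
      · have : (⌊x / d⌋ : ℝ) ≤ ((⌊y / d⌋ + 40 : ℤ) : ℝ) := by push_cast; linarith
        exact_mod_cast this
    have inB : ∀ p : Plane, |xc φ (p - m)| ≤ 32 * d → |vc φ (p - m)| ≤ 32 * (δ * d) →
        cell δ d φ p ∈ B := by
      intro p h1 h2
      rw [xc_sub] at h1
      rw [vc_sub] at h2
      simp only [B, Finset.mem_product, Finset.mem_Icc, ← hm]
      exact ⟨near hd h1, near hδd h2⟩
    have hsB : cell δ d φ s ∈ B := by
      apply inB
      · rw [hsm, xc_smul, abs_mul, abs_neg, abs_of_pos (by norm_num), abs_of_pos hx]; linarith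
      · rw [hsm, vc_smul, abs_mul, abs_neg, abs_of_pos (by norm_num)]; linarith
    have htB : cell δ d φ t ∈ B := by
      apply inB
      · rw [htm, xc_smul, abs_mul, abs_of_pos (by norm_num), abs_of_pos hx]; linarith
      · rw [htm, vc_smul, abs_mul, abs_of_pos (by norm_num)]; linarith
    have hmem : (cell δ d φ s, cell δ d φ t) ∈ B ×ˢ B := Finset.mem_product.2 ⟨hsB, htB⟩
    refine (hserve _ hmem ?_ s hs t ht rfl rfl).mono (Finset.subset_biUnion_of_mem G hmem)
    have h1 := Int.floor_le (xc φ s / d)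
    have h2 := Int.lt_floor_add_one (xc φ t / d)
    have h3 : 15 ≤ xc φ t / d - xc φ s / d := by
      rw [← sub_div, le_div_iff₀ hd, ← xc_sub]; exact hx1
    have h4 : (14 : ℝ) ≤ ((⌊xc φ t / d⌋ - ⌊xc φ s / d⌋ : ℤ) : ℝ) := by push_cast; linarith
    exact_mod_cast h4

lemma exists_dist_bound (T : Finset (Plane × Plane)) :
    ∃ M : ℝ, ∀ p ∈ segUnion T, ∀ q ∈ segUnion T, ‖p - q‖ ≤ M := by
  have h : Bornology.IsBounded (segUnion T) := by
    refine (Bornology.isBounded_biUnion_finset T).2 fun x _ => ?_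
    rw [← convexHull_pair]
    exact isBounded_convexHull.2 (Set.toFinite _).isBounded
  obtain ⟨M, hM⟩ := Metric.isBounded_iff.1 h
  exact ⟨M, fun p hp q hq => by rw [← dist_eq_norm]; exact hM hp hq⟩

lemma exists_min_dist (S : Finset Plane) :
    ∃ ρ : ℝ, 0 < ρ ∧ ∀ s ∈ S, ∀ t ∈ S, s ≠ t → ρ ≤ ‖t - s‖ := by
  rcases S.offDiag.eq_empty_or_nonempty with h | h
  · refine ⟨1, one_pos, fun s hs t ht hne => ?_⟩
    have : (s, t) ∈ S.offDiag := Finset.mem_offDiag.2 ⟨hs, ht, hne⟩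
    rw [h] at this
    exact absurd this (Finset.notMem_empty _)
  · obtain ⟨x, hx, hmin⟩ := Finset.exists_min_image S.offDiag (fun x => ‖x.2 - x.1‖) h
    refine ⟨‖x.2 - x.1‖, norm_pos_iff.2 (sub_ne_zero.2 (Finset.mem_offDiag.1 hx).2.2.symm), ?_⟩
    exact fun s hs t ht hne => hmin (s, t) (Finset.mem_offDiag.2 ⟨hs, ht, hne⟩)

lemma exists_good_network : ∃ C : ℝ, 0 < C ∧ ∀ S : Finset Plane, 2 ≤ S.card → ∀ δ : ℝ, 0 < δ →
    δ ≤ 1 / 2000 → ∃ E : Finset (Plane × Plane), gweight E ≤ C / δ ^ 2 * mst S ∧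
      ∀ s ∈ S, ∀ t ∈ S, s ≠ t → ∃ z ∈ S, ∃ z' ∈ S,
        HasPath E z z' ((1 + 32000 * δ ^ 2) * ‖z - z'‖) ∧ 1 / 6400 * ‖s - t‖ ≤ ‖z - z'‖ ∧
        ‖s - z‖ + ‖z - z'‖ + ‖z' - t‖ ≤ (1 + 8000 * δ ^ 2) * ‖s - t‖ := by
  obtain ⟨q, hq, c, hc, R, hR, Hflat⟩ := exists_flat_of_not_doublyHit
  obtain ⟨C, hC, Hsum⟩ := sum_doublyHit_le hq hc hR (B := 4) (by norm_num)
  obtain ⟨n, hn⟩ : ∃ n : ℕ, (4 * (48 * 200 + 1) * (2 * (200 + 1) + 1) ^ 2 : ℝ) ≤ n :=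
    exists_nat_ge _
  let W : ℝ := 81 ^ 4 * 360
  refine ⟨2 + W * (C + n * C + 200 * n), by positivity, ?_⟩
  intro S hS δ hδ hδ1
  have hδ2 : 0 < δ ^ 2 := by positivity
  obtain ⟨T, hT, hmin⟩ := exists_minimum_spanning_tree (Finset.card_pos.1 (by omega : 0 < S.card))
  have hcon := hT.connectsOn
  have hΓ : CurveConnected (segUnion T) := fun p hp q hq => hcon.exists_curve hp hq
  let P : Plane → ℝ → Plane → Prop := fun φ d m =>
    DoublyHit (segUnion T) (xc φ) (fun p => vc φ p / δ) q c R d m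
  have H : FlatUnless (segUnion T) δ P := Hflat _ hΓ δ hδ (by linarith)
  obtain ⟨M, hM⟩ := exists_dist_bound T
  obtain ⟨ρ, hρ, hρS⟩ := exists_min_dist S
  let d : ℕ → ℝ := fun k => ρ / 16 * 4 ^ k
  have hd : ∀ k, 0 < d k := fun k => by positivity
  have hd4 : ∀ k, d (k + 1) = 4 * d k := fun k => by simp only [d]; ring
  have hdmono : Monotone d := monotone_nat_of_le_succ fun k => by rw [hd4]; linarith [hd k]
  obtain ⟨N, hN⟩ : ∃ N, M < d N := by
    obtain ⟨N, hN⟩ := pow_unbounded_of_one_lt (M / (ρ / 16)) (by norm_num : (1 : ℝ) < 4)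
    exact ⟨N, by rwa [div_lt_iff₀' (by positivity)] at hN⟩
  have hlt : ∀ k, d k ≤ M → k < N := by
    intro k hk
    by_contra! hle
    linarith [hdmono hle]
  have hgapN : ∀ m k e, IsGap (segUnion T) δ e (d k) m → k < N := by
    intro m k e h
    obtain ⟨p, hp, -, hp1, -⟩ := h.left
    obtain ⟨r, hr, hr1, -⟩ := h.right
    apply hlt
    have h1 := xc_le_norm h.norm_eq (r - p)
    have h2 := hM r hr p hp
    rw [show r - p = (r - m) - (p - m) by abel, xc_sub, sub_sub_sub_cancel_right] at h1
    linarith [hd k]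
  obtain ⟨E₀, hE₀, hwalk⟩ := exists_walk_network hT hmin hS (η := 32000 * δ ^ 2) (by positivity)
    (fun k => d k / 100) (fun k => by have := hd k; positivity)
    (fun k => by rw [hd4]; linarith [hd k]) N
  let 𝓜 : Finset Plane := (S ×ˢ S).image fun x => midpoint ℝ x.1 x.2
  let I₁ : ℕ → Finset (Plane × (ℤ × ℤ)) := fun k => items δ (d k) 𝓜 fun φ m => P φ (d k) m
  let I₂ : ℕ → Finset (Plane × (ℤ × ℤ)) := fun k => items δ (d k) 𝓜 fun φ m =>
    ∃ e, IsGap (segUnion T) δ e (d k) m ∧ 0 < xc φ e ∧ |vc φ e| ≤ δ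
  let I₃ : ℕ → Finset (Plane × (ℤ × ℤ)) := fun k => items δ (d k) 𝓜 (EdgeNear T δ (d k))
  let I : ℕ → Finset (Plane × (ℤ × ℤ)) := fun k => I₁ k ∪ (I₂ k ∪ I₃ k)
  have hframe : ∀ k, ∀ i ∈ I k, ‖i.1‖ = 1 := by
    intro k i hi
    simp only [I, I₁, I₂, I₃, Finset.mem_union, mem_items] at hi
    rcases hi with ⟨φ, hφ, m, -, -, rfl⟩ | ⟨φ, hφ, m, -, -, rfl⟩ | ⟨φ, hφ, m, -, -, rfl⟩ <;>
      exact norm_of_mem_frames hφ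
  have hitem : ∀ k, ∀ i ∈ I k, ∃ E : Finset (Plane × Plane), gweight E ≤ W * d k ∧
      ∀ s ∈ S, ∀ t ∈ S, cell δ (d k) i.1 (midpoint ℝ s t) = i.2 → 16 * d k ≤ ‖t - s‖ →
      ‖t - s‖ ≤ 64 * d k → 0 < xc i.1 (t - s) → |vc i.1 (t - s)| ≤ δ * xc i.1 (t - s) →
      Served S E δ (d k) s t := fun k i hi =>
    exists_item_gadget S (hframe k i hi) hδ (by linarith) (hd k) i.2
  choose! G hG hserve using hitem
  let E₁ := (Finset.range N).biUnion fun k => (I k).biUnion (G k)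
  refine ⟨E₀ ∪ E₁, ?_, ?_⟩
  · have hmst : 0 ≤ mst S := hmin ▸ gweight_nonneg T
    have hcard : ∀ k, ((I k).card : ℝ) ≤ (I₁ k).card + ((I₂ k).card + (I₃ k).card) := by
      intro k
      exact_mod_cast (Finset.card_union_le _ _).trans
        (Nat.add_le_add_left (Finset.card_union_le _ _) _)
    have h1 : ∑ k ∈ Finset.range N, ((I₁ k).card : ℝ) * d k ≤ C / δ ^ 2 * gweight T :=
      Hsum T δ hδ (by linarith) d hd hd4 N 𝓜
    have h1' : ∑ k ∈ Finset.range (N + 1), ((I₁ k).card : ℝ) * d k ≤ C / δ ^ 2 * gweight T :=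
      Hsum T δ hδ (by linarith) d hd hd4 (N + 1) 𝓜
    have h2 : ∑ k ∈ Finset.range N, ((I₂ k).card : ℝ) * d k ≤ n * (C / δ ^ 2 * gweight T) :=
      (sum_gap_items_le hΓ hδ hδ1 hd hd4 H hgapN 𝓜 hn).trans
        (mul_le_mul_of_nonneg_left h1' n.cast_nonneg)
    have h3 : ∑ k ∈ Finset.range N, ((I₃ k).card : ℝ) * d k ≤ 200 * n * gweight T :=
      sum_edge_items_le T hδ hδ1 hd hd4 N 𝓜 (le_trans (by norm_num) hn)
    have hE₁ : gweight E₁ ≤ W * (∑ k ∈ Finset.range N, ((I₁ k).card : ℝ) * d k +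
        (∑ k ∈ Finset.range N, ((I₂ k).card : ℝ) * d k +
          ∑ k ∈ Finset.range N, ((I₃ k).card : ℝ) * d k)) := by
      rw [← Finset.sum_add_distrib, ← Finset.sum_add_distrib, Finset.mul_sum]
      refine (gweight_biUnion_le _ _).trans (Finset.sum_le_sum fun k _ => ?_)
      calc gweight ((I k).biUnion (G k)) ≤ ∑ i ∈ I k, gweight (G k i) := gweight_biUnion_le _ _
        _ ≤ ∑ i ∈ I k, W * d k := Finset.sum_le_sum (hG k)
        _ = (I k).card * (W * d k) := by rw [Finset.sum_const, nsmul_eq_mul]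
        _ ≤ ((I₁ k).card + ((I₂ k).card + (I₃ k).card)) * (W * d k) :=
          mul_le_mul_of_nonneg_right (hcard k) (mul_nonneg (by positivity) (hd k).le)
        _ = _ := by ring
    have hW : 0 ≤ W := by positivity
    have hinv : 1 ≤ 1 / δ ^ 2 := by
      rw [le_div_iff₀ hδ2]; nlinarith
    have h4 : W * (∑ k ∈ Finset.range N, ((I₁ k).card : ℝ) * d k +
        (∑ k ∈ Finset.range N, ((I₂ k).card : ℝ) * d k +
          ∑ k ∈ Finset.range N, ((I₃ k).card : ℝ) * d k)) ≤
        W * (C / δ ^ 2 * mst S + (n * (C / δ ^ 2 * mst S) + 200 * n * (1 / δ ^ 2 * mst S))) := by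
      rw [← hmin]
      refine mul_le_mul_of_nonneg_left (add_le_add h1 (add_le_add h2 (h3.trans ?_))) hW
      refine mul_le_mul_of_nonneg_left ?_ (by positivity)
      exact le_mul_of_one_le_left (gweight_nonneg T) hinv
    have h5 : (1 + 2 / (32000 * δ ^ 2)) * mst S ≤ 2 * (1 / δ ^ 2) * mst S := by
      refine mul_le_mul_of_nonneg_right ?_ hmst
      have : 2 / (32000 * δ ^ 2) = 1 / 16000 * (1 / δ ^ 2) := by field_simp; norm_num
      rw [this]; linarith
    refine (gweight_union_le _ _).trans ?_
    calc gweight E₀ + gweight E₁ ≤ 2 * (1 / δ ^ 2) * mst S + W * (C / δ ^ 2 * mst S +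
          (n * (C / δ ^ 2 * mst S) + 200 * n * (1 / δ ^ 2 * mst S))) :=
          add_le_add (hE₀.trans h5) (hE₁.trans h4)
      _ = _ := by ring
  · intro s hs t ht hne
    have hts : t - s ≠ 0 := sub_ne_zero.2 hne.symm
    have hsΓ := hcon.mem_segUnion hS hs
    have htΓ := hcon.mem_segUnion hS ht
    obtain ⟨k, hk1, hk2⟩ := exists_nat_pow_near (x := ‖t - s‖ / ρ) (y := 4)
      (by rw [le_div_iff₀ hρ, one_mul]; exact hρS s hs t ht hne) (by norm_num)
    rw [le_div_iff₀ hρ] at hk1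
    rw [div_lt_iff₀ hρ] at hk2
    have h16 : 16 * d k ≤ ‖t - s‖ := by
      refine le_trans (le_of_eq ?_) hk1; simp only [d]; ring
    have h64 : ‖t - s‖ ≤ 64 * d k := by
      refine hk2.le.trans_eq ?_; simp only [d]; ring
    have hdk := hd k
    have hkN : k < N := hlt k (by linarith [hM t htΓ s hsΓ])
    obtain ⟨φ, hφ, hφx, hφv⟩ := exists_frame hδ (by linarith) hts
    have hnorm : ‖s - t‖ = ‖t - s‖ := norm_sub_rev s t
    have hδd : δ ^ 2 * d k ≤ δ ^ 2 * (‖s - t‖ / 16) :=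
      mul_le_mul_of_nonneg_left (by linarith) hδ2.le
    have hδn : 0 ≤ δ ^ 2 * ‖s - t‖ := by positivity
    rcases pair_cases hT hmin hδ (by linarith) hdk H (hwalk k hkN) hs ht hsΓ htΓ h16 h64
      (norm_of_mem_frames hφ) hφx hφv with hexp | ⟨z, hz, z', hz', hpath, hzz, hdet⟩
    · have hm : midpoint ℝ s t ∈ 𝓜 :=
        Finset.mem_image.2 ⟨(s, t), Finset.mem_product.2 ⟨hs, ht⟩, rfl⟩
      have hi : (φ, cell δ (d k) φ (midpoint ℝ s t)) ∈ I k := by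
        simp only [I, I₁, I₂, I₃, Finset.mem_union, mem_items]
        rcases hexp with h | h | h
        · exact Or.inl ⟨φ, hφ, _, hm, h, rfl⟩
        · exact Or.inr (Or.inl ⟨φ, hφ, _, hm, h, rfl⟩)
        · exact Or.inr (Or.inr ⟨φ, hφ, _, hm, h, rfl⟩)
      have hsub : G k (φ, cell δ (d k) φ (midpoint ℝ s t)) ⊆ E₀ ∪ E₁ :=
        ((Finset.subset_biUnion_of_mem (G k) hi).trans
          (Finset.subset_biUnion_of_mem (fun k => (I k).biUnion (G k))
            (Finset.mem_range.2 hkN))).trans Finset.subset_union_right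
      obtain ⟨z, hz, z', hz', h1, h2, h3⟩ :=
        (hserve k _ hi s hs t ht rfl h16 h64 hφx hφv).mono hsub
      exact ⟨z, hz, z', hz', h2, by linarith, by linarith⟩
    · exact ⟨z, hz, z', hz', hpath.mono Finset.subset_union_left le_rfl, by linarith, by linarith⟩

-- **Statement 7.** There is an absolute constant `C > 0` such that every finite planar
-- point set `S` with at least two points and every `ε ∈ (0,1]` admit a Euclidean Steiner
-- `(1+ε)`-spanner (a geometric graph) of weight at most `C · ε⁻¹ · mst(S)`.
theorem steiner_spanner_lightness_upper_bound :
    ∃ C : ℝ, 0 < C ∧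
      ∀ S : Finset Plane, 2 ≤ S.card →
      ∀ ε : ℝ, 0 < ε → ε ≤ 1 →
      ∃ E : Finset (Plane × Plane),
        gweight E ≤ C * ε⁻¹ * mst S ∧
        ∀ s ∈ S, ∀ t ∈ S, HasPath E s t ((1 + ε) * ‖s - t‖) := by
  obtain ⟨C, hC, H⟩ := exists_good_network
  refine ⟨C * 10 ^ 9, by positivity, ?_⟩
  intro S hS ε hε hε1
  have hsq : Real.sqrt (ε / 10 ^ 9) ^ 2 = ε / 10 ^ 9 := Real.sq_sqrt (by positivity)
  obtain ⟨E, hE, hgood⟩ := H S hS (Real.sqrt (ε / 10 ^ 9)) (Real.sqrt_pos.2 (by positivity))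
    (Real.sqrt_le_iff.2 ⟨by norm_num, by norm_num; linarith⟩)
  rw [hsq] at hE hgood
  refine ⟨E, hE.trans_eq (by field_simp), fun s hs t ht => ?_⟩
  refine (hasPath_of_good_pairs (K := 2 * 10 ^ 8) (by positivity) (by linarith) (by norm_num)
    (by linarith) (by norm_num) (by norm_num) (by norm_num) hgood s hs t ht).mono
    subset_rfl ?_
  gcongr
  linarith

end
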